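/- There is a positive constant c such that, for every even integer k ≥ 6, every two-coloring of the edges of the complete graph on 3k/2 − 1 vertices with colors red and blue contains at least (ck)^k monochromatic cycles of length k, where a monochromatic cycle of length k is a cycle on k vertices all of whose edges receive the same color, and cycles are counted as subgraphs (each subgraph isomorphic to C_k counted once). -/

import Mathlib

noncomputable section

/-- The number of cycles with `k` vertices in `G`, counted as subgraphs. -/
def cycleCount {V : Type*} (G : SimpleGraph V) (k : ℕ) : ℕ :=
  Nat.card {f : ZMod k → V // Function.Injective f ∧ ∀ i, G.Adj (f i) (f (i + 1))} / (2 * k)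

namespace CycleRamsey

/-- `f` traverses a cycle with `m` vertices in `G`. -/
def IsCyc {V : Type*} (G : SimpleGraph V) (m : ℕ) (f : ZMod m → V) : Prop :=
  Function.Injective f ∧ ∀ i, G.Adj (f i) (f (i + 1))

/-- `G` contains a cycle with `m` vertices. -/
def HasCyc {V : Type*} (G : SimpleGraph V) (m : ℕ) : Prop := ∃ f : ZMod m → V, IsCyc G m f

/-- `L` lists the vertices of a path in `G` from `a` to `b`. -/
structure PathList {V : Type*} (G : SimpleGraph V) (L : List V) (a b : V) : Prop where
  nodup : L.Nodup
  chain : L.IsChain G.Adj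
  head : L.head? = some a
  last : L.getLast? = some b

section
variable {V : Type*} {G H : SimpleGraph V} {m : ℕ} {f : ZMod m → V} {a b c d x : V}
  {L L₁ L₂ : List V}

lemma HasCyc.mono (h : G ≤ H) (hc : HasCyc G m) : HasCyc H m :=
  let ⟨f, hf, hf'⟩ := hc
  ⟨f, hf, fun i => h (hf' i)⟩

lemma PathList.append (h₁ : PathList G L₁ a b) (h₂ : PathList G L₂ c d) (hbc : G.Adj b c)
    (hd : ∀ v ∈ L₁, v ∉ L₂) : PathList G (L₁ ++ L₂) a d := by
  refine ⟨?_, ?_, ?_, ?_⟩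
  · exact List.nodup_append'.2 ⟨h₁.nodup, h₂.nodup, fun v hv hv' => hd v hv hv'⟩
  · refine List.isChain_append.2 ⟨h₁.chain, h₂.chain, ?_⟩
    intro u hu v hv
    rw [h₁.last] at hu
    rw [h₂.head] at hv
    simp at hu hv
    subst hu hv
    exact hbc
  · simp [List.head?_append, h₁.head]
  · simp [List.getLast?_append, h₂.last]

lemma PathList.reverse (h : PathList G L a b) : PathList G L.reverse b a := by
  refine ⟨List.nodup_reverse.2 h.nodup, ?_, by simp [h.last], by simp [h.head]⟩
  rw [List.isChain_reverse]
  refine h.chain.imp ?_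
  intro u v huv
  exact huv.symm

lemma PathList.singleton (a : V) : PathList G [a] a a :=
  ⟨by simp, by simp, by simp, by simp⟩

lemma PathList.ne_nil (h : PathList G L a b) : L ≠ [] := by
  rintro rfl
  simpa using h.head

lemma PathList.head_mem (h : PathList G L a b) : a ∈ L :=
  List.mem_of_mem_head? (by rw [h.head]; rfl)

lemma PathList.last_mem (h : PathList G L a b) : b ∈ L :=
  List.mem_of_mem_getLast? (by rw [h.last]; rfl)

/-- Traversal of a nonempty closed list of vertices. -/
def cycOfList (L : List V) (m : ℕ) [NeZero m] (hm : L.length = m) (i : ZMod m) : V :=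
  L[i.val]'(by rw [hm]; exact ZMod.val_lt i)

lemma PathList.isCyc (h : PathList G L a b) (hba : G.Adj b a) [NeZero m] (hm : L.length = m) :
    IsCyc G m (cycOfList L m hm) := by
  refine ⟨?_, ?_⟩
  · intro i j hij
    have := (List.Nodup.getElem_inj_iff h.nodup).1 hij
    exact ZMod.val_injective _ this
  · intro i
    unfold cycOfList
    have hi := ZMod.val_lt i
    by_cases hlt : i.val + 1 < m
    · have : (i + 1).val = i.val + 1 := by
        have h := ZMod.val_cast_of_lt hlt
        simpa using h
      simp only [this]
      exact List.isChain_iff_getElem.1 h.chain _ (by omega)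
    · have h1 : i.val = m - 1 := by omega
      have h2 : (i + 1).val = 0 := by
        have : i + 1 = 0 := by
          have : ((i.val + 1 : ℕ) : ZMod m) = 0 := by
            have : i.val + 1 = m := by omega
            rw [this]; simp
          simpa using this
        rw [this]; simp
      have h3 := h.head
      have h4 := h.last
      rw [List.head?_eq_getElem?] at h3
      rw [List.getLast?_eq_getElem?] at h4
      simp only [h1, h2]
      obtain ⟨_, h3⟩ := List.getElem?_eq_some_iff.1 h3
      obtain ⟨_, h4⟩ := List.getElem?_eq_some_iff.1 h4
      rw [h3]
      have : L[m - 1]'(by omega) = b := by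
        rw [← h4]; congr 1; omega
      rw [this]
      exact hba

lemma PathList.hasCyc (h : PathList G L a b) (hba : G.Adj b a) (hm : L.length = m) :
    HasCyc G m := by
  have : NeZero m := ⟨by
    rw [← hm]
    exact fun h0 => h.ne_nil (List.length_eq_zero_iff.1 h0)⟩
  exact ⟨_, h.isCyc hba hm⟩

/-- The segment of `d` vertices of `f` starting at `f a`. -/
def seg {m : ℕ} (f : ZMod m → V) (a : ZMod m) (d : ℕ) : List V :=
  (List.range d).map fun t : ℕ => f (a + (t : ZMod m))

@[simp] lemma length_seg (f : ZMod m → V) (a : ZMod m) (d : ℕ) : (seg f a d).length = d := by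
  simp [seg]

lemma mem_seg {f : ZMod m → V} {a : ZMod m} {d : ℕ} {v : V} :
    v ∈ seg f a d ↔ ∃ t < d, f (a + t) = v := by
  simp [seg]

lemma natCast_inj_of_lt {s t : ℕ} (hs : s < m) (ht : t < m) (h : (s : ZMod m) = t) : s = t := by
  have := (ZMod.natCast_eq_natCast_iff' s t m).1 h
  rwa [Nat.mod_eq_of_lt hs, Nat.mod_eq_of_lt ht] at this

lemma IsCyc.seg_pathList (hf : IsCyc G m f) (a : ZMod m) {d : ℕ} (hd : d < m) :
    PathList G (seg f a (d + 1)) (f a) (f (a + d)) := by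
  refine ⟨?_, ?_, ?_, ?_⟩
  · refine List.Nodup.map_on ?_ List.nodup_range
    intro s hs t ht hst
    have h1 := add_left_cancel (hf.1 hst)
    simp at hs ht
    exact natCast_inj_of_lt (by omega) (by omega) h1
  · unfold seg
    rw [List.isChain_map, List.isChain_iff_getElem]
    intro i hi
    simp
    have := hf.2 (a + i)
    rwa [add_assoc] at this
  · simp [seg, List.head?_range]
  · simp [seg, List.getLast?_range]

lemma exists_natCast_lt [NeZero m] (i j : ZMod m) : ∃ t < m, j = i + (t : ZMod m) :=
  ⟨(j - i).val, ZMod.val_lt _, by simp⟩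

lemma mem_seg_full [NeZero m] (f : ZMod m → V) (a : ZMod m) (v : V) :
    v ∈ seg f a m ↔ v ∈ Set.range f := by
  rw [mem_seg]
  constructor
  · rintro ⟨t, -, rfl⟩; exact ⟨_, rfl⟩
  · rintro ⟨j, rfl⟩
    obtain ⟨t, ht, rfl⟩ := exists_natCast_lt a j
    exact ⟨t, ht, rfl⟩

lemma seg_add (f : ZMod m → V) (a : ZMod m) (d e : ℕ) :
    seg f a (d + e) = seg f a d ++ seg f (a + d) e := by
  simp [seg, List.range_add, add_assoc]

lemma IsCyc.rev (hf : IsCyc G m f) : IsCyc G m (fun i => f (-i)) := by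
  refine ⟨fun i j h => neg_injective (hf.1 h), fun i => ?_⟩
  have := hf.2 (-(i + 1))
  simpa using this.symm

/-- A full traversal, opened between `f i` and `f (i + 1)`. -/
lemma IsCyc.open_pathList [NeZero m] (hf : IsCyc G m f) (i : ZMod m) :
    PathList G (seg f (i + 1) m) (f (i + 1)) (f i) := by
  have hm : m ≠ 0 := NeZero.ne m
  have := hf.seg_pathList (i + 1) (d := m - 1) (by omega)
  have h1 : m - 1 + 1 = m := by omega
  rw [h1] at this
  convert this using 2
  rw [add_assoc, add_comm 1, ← Nat.cast_add_one, h1]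
  simp

/-- A chord skipping `d` vertices shortens the cycle by `d`. -/
lemma IsCyc.hasCyc_sub (hf : IsCyc G m f) (i : ZMod m) {d : ℕ} (hd : d < m)
    (h : G.Adj (f i) (f (i + 1 + d))) : HasCyc G (m - d) := by
  have h0 := hf.seg_pathList (i + 1 + d) (d := m - d - 1) (by omega)
  have h1 : m - d - 1 + 1 = m - d := by omega
  rw [h1] at h0
  have h2 : i + 1 + d + ((m - d - 1 : ℕ) : ZMod m) = i := by
    have : ((1 + d + (m - d - 1) : ℕ) : ZMod m) = 0 := by
      have : 1 + d + (m - d - 1) = m := by omega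
      rw [this]; simp
    push_cast at this
    linear_combination this
  rw [h2] at h0
  exact h0.hasCyc h (by simp)

/-- Rerouting a cycle through an outside vertex `x` adjacent to `f i` and `f j`. -/
lemma IsCyc.reroute [NeZero m] (hf : IsCyc G m f) (hx : x ∉ Set.range f) {i j : ZMod m}
    (hij : i ≠ j) (hi : G.Adj x (f i)) (hj : G.Adj x (f j)) :
    ∃ L, PathList G L (f (i + 1)) (f (j + 1)) ∧ L.length = m + 1 ∧
      ∀ v, v ∈ L ↔ v ∈ Set.range f ∨ v = x := by
  obtain ⟨t, ht, rfl⟩ := exists_natCast_lt i j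
  have ht0 : t ≠ 0 := by rintro rfl; simp at hij
  obtain ⟨d, rfl⟩ := Nat.exists_eq_succ_of_ne_zero ht0
  have p1 := hf.seg_pathList (i + 1) (d := d) (by omega)
  have e1 : i + 1 + (d : ZMod m) = i + ((d + 1 : ℕ) : ZMod m) := by push_cast; ring
  have p2 := hf.seg_pathList (i + 1 + (d + 1 : ℕ)) (d := m - (d + 1) - 1) (by omega)
  have e2 : i + 1 + ((d + 1 : ℕ) : ZMod m) + ((m - (d + 1) - 1 : ℕ) : ZMod m) = i := by
    have : ((1 + (d + 1) + (m - (d + 1) - 1) : ℕ) : ZMod m) = 0 := by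
      have : 1 + (d + 1) + (m - (d + 1) - 1) = m := by omega
      rw [this]; simp
    push_cast at this ⊢
    linear_combination this
  have e3 : m - (d + 1) - 1 + 1 = m - (d + 1) := by omega
  rw [e2, e3] at p2
  rw [e1] at p1
  have hmem : ∀ v, v ∈ seg f (i + 1) (d + 1) ∨ v ∈ seg f (i + 1 + (d + 1 : ℕ)) (m - (d + 1)) ↔
      v ∈ Set.range f := by
    intro v
    rw [← List.mem_append, ← seg_add, show d + 1 + (m - (d + 1)) = m by omega, mem_seg_full]
  have hnd : ∀ v ∈ seg f (i + 1) (d + 1),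
      v ∉ seg f (i + 1 + (d + 1 : ℕ)) (m - (d + 1)) := by
    have h2 := seg_add f (i + 1) (d + 1) (m - (d + 1))
    rw [show d + 1 + (m - (d + 1)) = m by omega] at h2
    have h3 := (hf.open_pathList i).nodup
    rw [h2] at h3
    intro v hv hv'
    exact (List.nodup_append'.1 h3).2.2 hv hv'
  have q1 : PathList G _ _ _ := p1.append (PathList.singleton x) (hj.symm) (by
    intro v hv hv'
    simp at hv'
    subst hv'
    exact hx ((hmem v).1 (Or.inl hv)))
  have q2 := q1.append p2.reverse hi (by
    intro v hv hv'
    rw [List.mem_reverse] at hv'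
    rw [List.mem_append, List.mem_singleton] at hv
    rcases hv with hv | rfl
    · exact hnd v hv hv'
    · exact hx ((hmem v).1 (Or.inr hv')))
  refine ⟨seg f (i + 1) (d + 1) ++ [x] ++ (seg f (i + 1 + (d + 1 : ℕ)) (m - (d + 1))).reverse,
    ?_, ?_, ?_⟩
  · convert q2 using 2
    push_cast; ring
  · simp; omega
  · intro v
    rw [← hmem]
    simp only [List.mem_append, List.mem_reverse, List.mem_singleton]
    tauto

end

section
variable {V : Type*} {G H : SimpleGraph V} {m : ℕ} {f : ZMod m → V} {a b c d u v x z : V}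
  {L L₁ L₂ : List V}

/-- The vertex `x` together with the successors on `f` of its neighbours. -/
def succSet (G : SimpleGraph V) {m : ℕ} (f : ZMod m → V) (x : V) : Set V :=
  {v | v = x ∨ ∃ i, G.Adj x (f i) ∧ v = f (i + 1)}

lemma IsCyc.exists_pathList_succSet [NeZero m] (hf : IsCyc G m f) (hx : x ∉ Set.range f)
    (hu : u ∈ succSet G f x) (hv : v ∈ succSet G f x) (huv : u ≠ v) :
    ∃ L, PathList G L u v ∧ L.length = m + 1 ∧ ∀ w, w ∈ L ↔ w ∈ Set.range f ∨ w = x := by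
  have key : ∀ i, G.Adj x (f i) → ∃ L, PathList G L (f (i + 1)) x ∧ L.length = m + 1 ∧
      ∀ w, w ∈ L ↔ w ∈ Set.range f ∨ w = x := by
    intro i hi
    refine ⟨_, (hf.open_pathList i).append (PathList.singleton x) hi.symm ?_, by simp, ?_⟩
    · intro w hw hw'
      rw [mem_seg_full] at hw
      simp at hw'
      exact hx (hw' ▸ hw)
    · intro w
      rw [List.mem_append, mem_seg_full]
      simp
  rcases hu with rfl | ⟨i, hi, rfl⟩
  · rcases hv with rfl | ⟨j, hj, rfl⟩
    · exact absurd rfl huv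
    · obtain ⟨L, h1, h2, h3⟩ := key j hj
      exact ⟨_, h1.reverse, by simpa using h2, fun w => by rw [List.mem_reverse, h3]⟩
  · rcases hv with rfl | ⟨j, hj, rfl⟩
    · exact key i hi
    · exact hf.reroute hx (fun h => huv (by rw [h])) hi hj

lemma IsCyc.hasCyc_succ [NeZero m] (hf : IsCyc G m f) (hx : x ∉ Set.range f)
    (hu : u ∈ succSet G f x) (hv : v ∈ succSet G f x) (huv : G.Adj u v) : HasCyc G (m + 1) := by
  obtain ⟨L, h1, h2, -⟩ := hf.exists_pathList_succSet hx hu hv huv.ne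
  exact h1.hasCyc huv.symm h2

lemma IsCyc.hasCyc_add_two [NeZero m] (hf : IsCyc G m f) (hx : x ∉ Set.range f)
    (hz : z ∉ Set.range f) (hzx : z ≠ x) (hu : u ∈ succSet G f x) (hv : v ∈ succSet G f x)
    (huv : u ≠ v) (hzu : G.Adj z u) (hzv : G.Adj z v) : HasCyc G (m + 2) := by
  obtain ⟨L, h1, h2, h3⟩ := hf.exists_pathList_succSet hx hu hv huv
  refine (h1.append (PathList.singleton z) hzv.symm ?_).hasCyc hzu (by simp [h2])
  intro w hw hw'
  rw [h3] at hw
  simp at hw'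
  subst hw'
  tauto

lemma pathList_map {l : List ℕ} {f : ℕ → V} {p q s : ℕ} (hf : Set.InjOn f {i | i < s})
    (hl : ∀ i ∈ l, i < s) (hnd : l.Nodup) (hc : l.IsChain fun i j => G.Adj (f i) (f j))
    (hp : l.head? = some p) (hq : l.getLast? = some q) :
    PathList G (l.map f) (f p) (f q) := by
  refine ⟨List.Nodup.map_on (fun i hi j hj h => hf (hl i hi) (hl j hj) h) hnd, ?_, ?_, ?_⟩
  · rwa [List.isChain_map]
  · simp [hp]
  · simp [hq]

lemma compl_adj_of (h : u ≠ v) (h' : ¬ G.Adj u v) : Gᶜ.Adj u v := by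
  rw [SimpleGraph.compl_adj]; exact ⟨h, h'⟩

lemma IsCyc.ne_add (hf : IsCyc G m f) {i : ZMod m} {t : ℕ} (h0 : 0 < t) (ht : t < m) :
    f i ≠ f (i + t) := by
  intro h
  have h := hf.1 h
  have : (t : ZMod m) = (0 : ℕ) := by
    have : i + 0 = i + (t : ZMod m) := by simpa using h
    simpa using (add_left_cancel this).symm
  have := natCast_inj_of_lt ht (by omega) this
  omega

lemma injOn_natCast (hf : IsCyc G m f) : Set.InjOn (fun i : ℕ => f (i : ZMod m)) {i | i < m} :=
  fun _ hi _ hj h => natCast_inj_of_lt hi hj (hf.1 h)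

lemma IsCyc.hasCyc_pred_of_odd (hf : IsCyc G m f) (h7 : 7 ≤ m) (hodd : Odd m) :
    HasCyc G (m - 1) ∨ HasCyc Gᶜ (m - 1) := by
  by_contra! hcon
  obtain ⟨hG, hB⟩ := hcon
  have h2 : ∀ i, Gᶜ.Adj (f i) (f (i + 2)) := by
    intro i
    refine compl_adj_of (by simpa using hf.ne_add (i := i) (t := 2) (by omega) (by omega)) ?_
    intro h
    refine hG (hf.hasCyc_sub i (d := 1) (by omega) ?_)
    convert h using 2
    push_cast; ring
  have hu : IsUnit (2 : ZMod m) := by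
    have := (ZMod.isUnit_iff_coprime 2 m).2 (Nat.coprime_two_left.2 hodd)
    simpa using this
  have hg : IsCyc Gᶜ m (fun j => f (2 * j)) := by
    refine ⟨fun i j h => hu.mul_left_cancel (hf.1 h), fun i => ?_⟩
    convert h2 (2 * i) using 2
    ring
  have h4 : ∀ i, G.Adj (f i) (f (i + 4)) := by
    intro i
    by_contra h
    obtain ⟨j, rfl⟩ : ∃ j, i = 2 * j := by
      obtain ⟨c, hc⟩ := hu.exists_right_inv
      exact ⟨c * i, by rw [← mul_assoc, hc, one_mul]⟩
    refine hB (hg.hasCyc_sub j (d := 1) (by omega) ?_)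
    have := compl_adj_of (by simpa using hf.ne_add (i := 2 * j) (t := 4) (by omega) (by omega)) h
    convert this using 2
    push_cast; ring
  have hadj1 : ∀ i : ℕ, G.Adj (f (i : ZMod m)) (f ((i + 1 : ℕ) : ZMod m)) := by
    intro i; push_cast; exact hf.2 _
  have hadj4 : ∀ i : ℕ, G.Adj (f (i : ZMod m)) (f ((i + 4 : ℕ) : ZMod m)) := by
    intro i; push_cast; exact h4 _
  have hp := pathList_map (G := G) (l := [0, 4, 5, 1, 2] ++ List.range' 6 (m - 6))
    (p := 0) (q := m - 1) (injOn_natCast hf) ?_ ?_ ?_ ?_ ?_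
  · refine hG (hp.hasCyc ?_ (by simp; omega))
    have := hadj1 (m - 1)
    rwa [show m - 1 + 1 = m by omega, ZMod.natCast_self, ← Nat.cast_zero] at this
  · intro i hi
    simp at hi
    omega
  · rw [List.nodup_append']
    refine ⟨by simp, List.nodup_range', ?_⟩
    intro i hi hi'
    simp at hi hi'
    omega
  · rw [List.isChain_append]
    refine ⟨?_, ?_, ?_⟩
    · simp only [List.isChain_cons_cons, List.isChain_singleton, and_true]
      exact ⟨hadj4 0, hadj1 4, (hadj4 1).symm, hadj1 1⟩
    · rw [List.isChain_iff_getElem]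
      intro i hi
      simp only [List.getElem_range']
      have := hadj1 (6 + i)
      convert this using 3 <;> ring
    · intro u hu v hv
      simp [List.head?_range'] at hu hv
      obtain ⟨-, rfl⟩ := hv
      subst hu
      exact hadj4 2
  · simp
  · rw [List.getLast?_append, List.getLast?_range']
    rw [if_neg (by omega)]
    simp
    omega

lemma IsCyc.hasCyc_pred_of_even (hf : IsCyc G m f) (h8 : 8 ≤ m) (heven : Even m) :
    HasCyc G (m - 1) ∨ HasCyc G (m - 2) ∨ HasCyc Gᶜ (m - 1) := by
  by_contra! hcon
  obtain ⟨hG, hG', hB⟩ := hcon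
  have h2 : ∀ i : ℕ, Gᶜ.Adj (f (i : ZMod m)) (f ((i + 2 : ℕ) : ZMod m)) := by
    intro i
    refine compl_adj_of (by
      push_cast
      simpa using hf.ne_add (i := i) (t := 2) (by omega) (by omega)) ?_
    intro h
    refine hG (hf.hasCyc_sub i (d := 1) (by omega) ?_)
    convert h using 2
    push_cast; ring
  have h3 : ∀ i : ℕ, Gᶜ.Adj (f (i : ZMod m)) (f ((i + 3 : ℕ) : ZMod m)) := by
    intro i
    refine compl_adj_of (by
      push_cast
      simpa using hf.ne_add (i := i) (t := 3) (by omega) (by omega)) ?_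
    intro h
    refine hG' (hf.hasCyc_sub i (d := 2) (by omega) ?_)
    convert h using 2
    push_cast; ring
  obtain ⟨l, rfl⟩ := heven
  have hp := pathList_map (G := Gᶜ)
    (l := (List.range (l - 1)).map (fun i => 2 + 2 * i) ++ (List.range l).map (fun i => 1 + 2 * i))
    (p := 2) (q := l + l - 1) (injOn_natCast hf) ?_ ?_ ?_ ?_ ?_
  · refine hB (hp.hasCyc ?_ (by simp; omega))
    have := h3 (l + l - 1)
    rw [show l + l - 1 + 3 = 2 + (l + l) by omega] at this
    rw [Nat.cast_add, ZMod.natCast_self, add_zero] at this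
    exact this
  · intro i hi
    simp only [List.mem_append, List.mem_map, List.mem_range] at hi
    omega
  · rw [List.nodup_append']
    refine ⟨List.nodup_range.map fun i j h => ?_, List.nodup_range.map fun i j h => ?_, ?_⟩
    · simpa using h
    · simpa using h
    intro i hi hi'
    simp only [List.mem_map, List.mem_range] at hi hi'
    omega
  · rw [List.isChain_append]
    refine ⟨?_, ?_, ?_⟩
    · rw [List.isChain_map, List.isChain_iff_getElem]
      intro i hi
      simp only [List.getElem_range]
      exact h2 (2 + 2 * i)
    · rw [List.isChain_map, List.isChain_iff_getElem]
      intro i hi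
      simp only [List.getElem_range]
      exact h2 (1 + 2 * i)
    · intro u hu v hv
      rw [List.getLast?_map, List.getLast?_range, if_neg (by omega)] at hu
      rw [List.head?_map, List.head?_range, if_neg (by omega)] at hv
      simp at hu hv
      subst hu hv
      have := (h3 (2 + 2 * (l - 1 - 1)))
      rw [show 2 + 2 * (l - 1 - 1) + 3 = 1 + (l + l) by omega] at this
      rw [Nat.cast_add _ (l + l), ZMod.natCast_self, add_zero] at this
      exact this
  · rw [List.head?_append, List.head?_map, List.head?_range, if_neg (by omega)]
    simp
  · rw [List.getLast?_append, List.getLast?_map, List.getLast?_range, if_neg (by omega)]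
    simp
    omega

/-- A monochromatic cycle can be shortened to any even length at least six. -/
lemma hasCyc_of_le {n : ℕ} (hn : 3 ≤ n) :
    ∀ m, 2 * n ≤ m → (HasCyc G m ∨ HasCyc Gᶜ m) → HasCyc G (2 * n) ∨ HasCyc Gᶜ (2 * n) := by
  intro m
  induction m using Nat.strong_induction_on with
  | _ m ih =>
    have key : ∀ K : SimpleGraph V, 2 * n < m → HasCyc K m →
        ∃ m' < m, 2 * n ≤ m' ∧ (HasCyc K m' ∨ HasCyc Kᶜ m') := by
      rintro K hm ⟨f, hf⟩
      rcases Nat.even_or_odd m with he | ho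
      · have : 2 * n + 2 ≤ m := by
          obtain ⟨l, rfl⟩ := he
          omega
        rcases hf.hasCyc_pred_of_even (by omega) he with h | h | h
        · exact ⟨m - 1, by omega, by omega, Or.inl h⟩
        · exact ⟨m - 2, by omega, by omega, Or.inl h⟩
        · exact ⟨m - 1, by omega, by omega, Or.inr h⟩
      · exact ⟨m - 1, by omega, by omega, hf.hasCyc_pred_of_odd (by omega) ho⟩
    intro hm h
    rcases hm.eq_or_lt with rfl | hlt
    · exact h
    rcases h with h | h
    · obtain ⟨m', h1, h2, h3⟩ := key G hlt h
      exact ih m' h1 h2 h3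
    · obtain ⟨m', h1, h2, h3⟩ := key Gᶜ hlt h
      rw [compl_compl] at h3
      exact ih m' h1 h2 h3.symm

end

open Finset

section
open scoped Classical
variable {V : Type*} {G H : SimpleGraph V} {m : ℕ} {f : ZMod m → V} {a b c d u v x z : V}
  {L L₁ L₂ : List V}

/-- The bipartite graph formed by the edges of `G` between `X` and `Y`. -/
def between (G : SimpleGraph V) (X Y : Finset V) : SimpleGraph V where
  Adj u v := G.Adj u v ∧ (u ∈ X ∧ v ∈ Y ∨ u ∈ Y ∧ v ∈ X)
  symm := ⟨fun u v h => ⟨h.1.symm, by tauto⟩⟩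
  loopless := ⟨fun u h => G.loopless.irrefl u h.1⟩

lemma between_le (X Y : Finset V) : between G X Y ≤ G := fun _ _ h => h.1

lemma between_adj {X Y : Finset V} :
    (between G X Y).Adj u v ↔ G.Adj u v ∧ (u ∈ X ∧ v ∈ Y ∨ u ∈ Y ∧ v ∈ X) := Iff.rfl

lemma IsCyc.card_filter_between {X Y : Finset V} (hXY : Disjoint X Y) {s : ℕ} [NeZero (2 * s)]
    {f : ZMod (2 * s) → V} (hf : IsCyc (between G X Y) (2 * s) f) :
    #{v ∈ X | v ∈ Set.range f} = s ∧ #{v ∈ Y | v ∈ Set.range f} = s := by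
  have hd : ∀ v, v ∈ X → v ∉ Y := fun v h h' => disjoint_left.1 hXY h h'
  have e : ∀ Z : Finset V, #{v ∈ Z | v ∈ Set.range f} = #{i : ZMod (2 * s) | f i ∈ Z} := by
    intro Z
    rw [← card_image_of_injective _ hf.1]
    congr 1
    ext v
    simp only [mem_filter, Set.mem_range, mem_image, mem_univ, true_and]
    constructor
    · rintro ⟨h, i, rfl⟩; exact ⟨i, h, rfl⟩
    · rintro ⟨i, h, rfl⟩; exact ⟨h, i, rfl⟩
  have h1 : #{i : ZMod (2 * s) | f i ∈ X} = #{i : ZMod (2 * s) | f i ∈ Y} := by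
    rw [← card_image_of_injective _ (add_left_injective (1 : ZMod (2 * s)))]
    congr 1
    ext i
    simp only [mem_filter, mem_image, mem_univ, true_and]
    constructor
    · rintro ⟨j, h, rfl⟩
      rcases (hf.2 j).2 with h' | h'
      · exact h'.2
      · exact absurd h'.1 (hd _ h)
    · intro h
      refine ⟨i - 1, ?_, by ring⟩
      have := (hf.2 (i - 1)).2
      rw [sub_add_cancel] at this
      rcases this with h' | h'
      · exact h'.1
      · exact absurd h (hd _ h'.2)
  have h2 : #{i : ZMod (2 * s) | f i ∈ X} + #{i : ZMod (2 * s) | f i ∈ Y} = 2 * s := by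
    rw [← card_union_of_disjoint, ← filter_or, filter_true_of_mem, card_univ, ZMod.card]
    · intro i _
      rcases (hf.2 i).2 with h' | h'
      · exact Or.inl h'.1
      · exact Or.inr h'.1
    · rw [disjoint_left]
      intro i hi hi'
      simp at hi hi'
      exact hd _ hi hi'
  rw [e, e]
  omega

lemma two_le_card_common {X Y : Finset V} {d e : ℕ} {x₀ : V}
    (hY : #Y + 2 + e ≤ 2 * d) (hX : ∀ x ∈ X, x ≠ x₀ → d ≤ #{y ∈ Y | G.Adj x y})
    (hx₀ : x₀ ∈ X → d ≤ #{y ∈ Y | G.Adj x₀ y} + e) (hu : u ∈ X) (hv : v ∈ X) (huv : u ≠ v) :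
    2 ≤ #{y ∈ Y | G.Adj u y ∧ G.Adj v y} := by
  have h1 : 2 * d ≤ #{y ∈ Y | G.Adj u y} + #{y ∈ Y | G.Adj v y} + e := by
    by_cases h : u = x₀
    · subst h
      have := hX v hv huv.symm
      have := hx₀ hu
      omega
    · have := hX u hu h
      by_cases h' : v = x₀
      · subst h'
        have := hx₀ hv
        omega
      · have := hX v hv h'
        omega
  have h2 := card_union_add_card_inter {y ∈ Y | G.Adj u y} {y ∈ Y | G.Adj v y}
  rw [← filter_and] at h2
  have h3 : #({y ∈ Y | G.Adj u y} ∪ {y ∈ Y | G.Adj v y}) ≤ #Y :=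
    card_le_card (union_subset (filter_subset _ _) (filter_subset _ _))
  omega

lemma IsCyc.hasCyc_between_add_two {X Y : Finset V} (hXY : Disjoint X Y) {d e : ℕ} {x₀ : V}
    (hY : #Y + 2 + e ≤ 2 * d) (hX : ∀ x ∈ X, x ≠ x₀ → d ≤ #{y ∈ Y | G.Adj x y})
    (hx₀ : x₀ ∈ X → d ≤ #{y ∈ Y | G.Adj x₀ y} + e) (hXd : #X ≤ d)
    {s : ℕ} (hs2 : 2 ≤ s) (hs : s < #X) {f : ZMod (2 * s) → V}
    (hf : IsCyc (between G X Y) (2 * s) f) : HasCyc (between G X Y) (2 * s + 2) := by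
  have : NeZero (2 * s) := ⟨by omega⟩
  have hd : ∀ v, v ∈ X → v ∉ Y := fun v h h' => disjoint_left.1 hXY h h'
  obtain ⟨hDX, hDY⟩ := hf.card_filter_between hXY
  obtain ⟨x, hxX, hxf⟩ : ∃ x ∈ X, x ∉ Set.range f := by
    by_contra! h
    rw [filter_true_of_mem h] at hDX
    omega
  set I : Finset (ZMod (2 * s)) := {i | (between G X Y).Adj x (f i)} with hI
  rcases Nat.eq_zero_or_pos #I with h0 | hpos
  · have hI0 : ∀ i, f i ∈ Y → ¬ G.Adj x (f i) := by
      intro i hi hadj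
      rw [card_eq_zero] at h0
      have : i ∈ I := by simp [hI, between_adj, hadj, hxX, hi]
      simp [h0] at this
    obtain ⟨i, hi⟩ : ∃ i, f i ∈ X := by
      rcases (hf.2 0).2 with h | h
      · exact ⟨_, h.1⟩
      · exact ⟨_, h.2⟩
    have hi1 : f (i + 1) ∈ Y := by
      rcases (hf.2 i).2 with h | h
      · exact h.2
      · exact absurd h.1 (hd _ hi)
    have hi2 : f (i + 1 + 1) ∈ X := by
      rcases (hf.2 (i + 1)).2 with h | h
      · exact absurd hi1 (hd _ h.1)
      · exact h.2
    have hxne : ∀ j, x ≠ f j := fun j h => hxf ⟨j, h.symm⟩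
    obtain ⟨y₁, hy₁⟩ : ∃ y, y ∈ ({y ∈ Y | G.Adj (f i) y ∧ G.Adj x y} : Finset V) := by
      apply card_pos.1
      have := two_le_card_common hY hX hx₀ hi hxX (hxne i).symm
      omega
    obtain ⟨y₂, hy₂, hne⟩ := exists_mem_ne
      (two_le_card_common hY hX hx₀ hi2 hxX (hxne _).symm) y₁
    simp only [mem_filter] at hy₁ hy₂
    have hy₁f : y₁ ∉ Set.range f := by
      rintro ⟨j, rfl⟩; exact hI0 j hy₁.1 hy₁.2.2
    have hy₂f : y₂ ∉ Set.range f := by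
      rintro ⟨j, rfl⟩; exact hI0 j hy₂.1 hy₂.2.2
    have p := hf.seg_pathList (i + 1 + 1) (d := 2 * s - 2) (by omega)
    have e1 : i + 1 + 1 + ((2 * s - 2 : ℕ) : ZMod (2 * s)) = i := by
      have : ((2 + (2 * s - 2) : ℕ) : ZMod (2 * s)) = 0 := by
        rw [show 2 + (2 * s - 2) = 2 * s by omega, ZMod.natCast_self]
      rw [Nat.cast_add] at this
      push_cast at this ⊢
      linear_combination this
    rw [e1] at p
    have hmem : ∀ w ∈ seg f (i + 1 + 1) (2 * s - 2 + 1), w ∈ Set.range f := by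
      intro w hw
      obtain ⟨t, -, rfl⟩ := mem_seg.1 hw
      exact ⟨_, rfl⟩
    have hq : PathList (between G X Y) [y₁, x, y₂] y₁ y₂ := by
      refine ⟨?_, ?_, rfl, rfl⟩
      · have h1 : y₁ ≠ x := by rintro rfl; exact hd _ hxX hy₁.1
        have h2 : y₂ ≠ x := by rintro rfl; exact hd _ hxX hy₂.1
        simp [h1, hne.symm, h2.symm]
      · simp only [List.isChain_cons_cons, List.isChain_singleton, and_true, between_adj]
        exact ⟨⟨hy₁.2.2.symm, Or.inr ⟨hy₁.1, hxX⟩⟩, ⟨hy₂.2.2, Or.inl ⟨hxX, hy₂.1⟩⟩⟩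
    refine (p.append hq ⟨hy₁.2.1, Or.inl ⟨hi, hy₁.1⟩⟩ ?_).hasCyc
      ⟨hy₂.2.1.symm, Or.inr ⟨hy₂.1, hi2⟩⟩ (by simp; omega)
    intro w hw hw'
    have hw := hmem w hw
    simp at hw'
    rcases hw' with rfl | rfl | rfl
    · exact hy₁f hw
    · exact hxf hw
    · exact hy₂f hw
  · by_contra hno
    set Q' := I.image (fun i => f (i + 1)) with hQ'
    have hcardQ : #Q' = #I := card_image_of_injective _ (fun i j h => by simpa using hf.1 h)
    have hxQ' : x ∉ Q' := by
      rw [hQ', mem_image]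
      rintro ⟨i, -, h⟩
      exact hxf ⟨_, h⟩
    have hIY : ∀ i ∈ I, f i ∈ Y := by
      intro i hi
      simp only [hI, mem_filter, mem_univ, true_and, between_adj] at hi
      rcases hi.2 with h | h
      · exact h.2
      · exact absurd h.1 (hd _ hxX)
    have hQX : ∀ q ∈ insert x Q', q ∈ X := by
      intro q hq
      rcases mem_insert.1 hq with rfl | hq
      · exact hxX
      · obtain ⟨i, hi, rfl⟩ := mem_image.1 hq
        rcases (hf.2 i).2 with h | h
        · exact absurd (hIY i hi) (hd _ h.1)
        · exact h.2
    have hQs : ∀ q ∈ insert x Q', q ∈ succSet (between G X Y) f x := by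
      intro q hq
      rcases mem_insert.1 hq with rfl | hq
      · exact Or.inl rfl
      · obtain ⟨i, hi, rfl⟩ := mem_image.1 hq
        exact Or.inr ⟨i, by simpa [hI] using hi, rfl⟩
    have hlow : (#I + 1) * d ≤ ∑ q ∈ insert x Q', #{y ∈ Y | G.Adj q y} + e := by
      have hc : #(insert x Q') = #I + 1 := by rw [card_insert_of_notMem hxQ', hcardQ]
      have h1 : ∑ q ∈ insert x Q', d ≤
          ∑ q ∈ insert x Q', (#{y ∈ Y | G.Adj q y} + if q = x₀ then e else 0) := by
        refine sum_le_sum fun q hq => ?_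
        split_ifs with h
        · subst h; exact hx₀ (hQX _ hq)
        · exact hX q (hQX _ hq) h
      rw [sum_const, hc, smul_eq_mul, sum_add_distrib] at h1
      refine h1.trans (Nat.add_le_add_left ?_ _)
      rw [sum_ite_eq']
      split_ifs <;> omega
    have hsplit : ∀ q, #{y ∈ Y | G.Adj q y} =
        #{y ∈ ({v ∈ Y | v ∉ Set.range f} : Finset V) | G.Adj q y} +
        #{y ∈ ({v ∈ Y | v ∈ Set.range f} : Finset V) | G.Adj q y} := by
      intro q
      rw [filter_comm, filter_comm (p := fun v => v ∈ Set.range f), add_comm]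
      exact (card_filter_add_card_filter_not _).symm
    have hout : ∑ q ∈ insert x Q', #{y ∈ ({v ∈ Y | v ∉ Set.range f} : Finset V) | G.Adj q y}
        ≤ #{v ∈ Y | v ∉ Set.range f} := by
      have := sum_card_bipartiteAbove_eq_sum_card_bipartiteBelow (s := insert x Q')
        (t := ({v ∈ Y | v ∉ Set.range f} : Finset V)) G.Adj
      unfold bipartiteAbove bipartiteBelow at this
      rw [this, card_eq_sum_ones]
      refine sum_le_sum fun y hy => ?_
      rw [mem_filter] at hy
      by_contra! h
      obtain ⟨u, hu, v, hv, huv⟩ := one_lt_card.1 h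
      rw [mem_filter] at hu hv
      have hyx : y ≠ x := by rintro rfl; exact hd _ hxX hy.1
      exact hno (hf.hasCyc_add_two hxf hy.2 hyx (hQs _ hu.1) (hQs _ hv.1) huv
        ⟨hu.2.symm, Or.inr ⟨hy.1, hQX _ hu.1⟩⟩ ⟨hv.2.symm, Or.inr ⟨hy.1, hQX _ hv.1⟩⟩)
    have hin : ∑ q ∈ insert x Q', #{y ∈ ({v ∈ Y | v ∈ Set.range f} : Finset V) | G.Adj q y}
        ≤ #I + #I * s := by
      rw [sum_insert hxQ']
      refine Nat.add_le_add ?_ ?_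
      · rw [← card_image_of_injective I hf.1]
        refine card_le_card fun y hy => ?_
        simp only [mem_filter] at hy
        obtain ⟨⟨hyY, i, rfl⟩, hxy⟩ := hy
        exact mem_image.2 ⟨i, by simp [hI, between_adj, hxy, hxX, hyY], rfl⟩
      · refine (sum_le_card_nsmul _ _ s fun q _ => ?_).trans_eq (by rw [hcardQ, smul_eq_mul])
        exact (card_le_card (filter_subset _ _)).trans hDY.le
    have hYs := card_filter_add_card_filter_not (s := Y) (fun v => v ∈ Set.range f)
    rw [hDY] at hYs
    rw [sum_congr rfl (fun q _ => hsplit q), sum_add_distrib] at hlow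
    have hfin : (#I + 1) * d + s + 2 ≤ 2 * d + #I + #I * s := by omega
    obtain ⟨t, ht⟩ : ∃ t, #I = t + 1 := ⟨#I - 1, by omega⟩
    obtain ⟨r, rfl⟩ : ∃ r, d = s + 1 + r := ⟨d - (s + 1), by omega⟩
    rw [ht] at hfin
    nlinarith [Nat.zero_le (t * r)]

/-- A bipartite graph in which the vertices of one small side `X` all have large degree, with
at most one slightly worse exception, has a cycle through all of `X`. -/
lemma hasCyc_two_mul_card {X Y : Finset V} (hXY : Disjoint X Y) {d e : ℕ} {x₀ : V}
    (hY : #Y + 2 + e ≤ 2 * d) (hX : ∀ x ∈ X, x ≠ x₀ → d ≤ #{y ∈ Y | G.Adj x y})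
    (hx₀ : x₀ ∈ X → d ≤ #{y ∈ Y | G.Adj x₀ y} + e) (h2 : 2 ≤ #X) (hXd : #X ≤ d) :
    HasCyc G (2 * #X) := by
  have hd : ∀ v, v ∈ X → v ∉ Y := fun v h h' => disjoint_left.1 hXY h h'
  suffices h : ∀ s, 2 ≤ s → s ≤ #X → HasCyc (between G X Y) (2 * s) from
    (h _ h2 le_rfl).mono (between_le X Y)
  intro s hs
  induction s, hs using Nat.le_induction with
  | base =>
    intro _
    obtain ⟨u, hu, v, hv, huv⟩ := one_lt_card.1 h2
    obtain ⟨y₁, hy₁, y₂, hy₂, hne⟩ := one_lt_card.1 (two_le_card_common hY hX hx₀ hu hv huv)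
    rw [mem_filter] at hy₁ hy₂
    have ne : ∀ p ∈ X, ∀ q ∈ Y, p ≠ q := by rintro p hp q hq rfl; exact hd _ hp hq
    have hp : PathList (between G X Y) [u, y₁, v, y₂] u y₂ := by
      refine ⟨?_, ?_, rfl, rfl⟩
      · simp [huv, hne, ne u hu y₁ hy₁.1, ne u hu y₂ hy₂.1, (ne v hv y₁ hy₁.1).symm,
          ne v hv y₂ hy₂.1]
      · simp only [List.isChain_cons_cons, List.isChain_singleton, and_true, between_adj]
        exact ⟨⟨hy₁.2.1, Or.inl ⟨hu, hy₁.1⟩⟩, ⟨hy₁.2.2.symm, Or.inr ⟨hy₁.1, hv⟩⟩,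
          ⟨hy₂.2.2, Or.inl ⟨hv, hy₂.1⟩⟩⟩
    exact hp.hasCyc ⟨hy₂.2.1.symm, Or.inr ⟨hy₂.1, hu⟩⟩ rfl
  | succ s hs ih =>
    intro hle
    obtain ⟨f, hf⟩ := ih (by omega)
    exact hf.hasCyc_between_add_two hXY hY hX hx₀ hXd hs (by omega)

lemma PathList.exists_cross {S : Finset V} (h : PathList G L a b) (hLS : ∀ v ∈ L, v ∈ S)
    (hdeg : ∀ v ∈ S, #S ≤ 2 * #{w ∈ S | G.Adj v w})
    (ha : ∀ w ∈ S, G.Adj a w → w ∈ L) (hb : ∀ w ∈ S, G.Adj b w → w ∈ L) :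
    ∃ L', ∃ c d, PathList G L' c d ∧ G.Adj d c ∧ L'.length = L.length ∧ ∀ v, v ∈ L' ↔ v ∈ L := by
  set l := L.length with hl
  have hl0 : 0 < l := List.length_pos_iff.2 h.ne_nil
  set p : ℕ → V := fun i => L.getD i a with hp
  have hpe : ∀ i (hi : i < l), p i = L[i] := fun i hi => by
    rw [hp]; exact List.getD_eq_getElem _ _ hi
  have hpinj : Set.InjOn p {i | i < l} := by
    intro i hi j hj hij
    simp only [Set.mem_ofPred_eq] at hi hj
    rw [hpe i hi, hpe j hj] at hij
    exact (List.Nodup.getElem_inj_iff h.nodup).1 hij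
  have hpL : ∀ v, v ∈ L ↔ ∃ i < l, p i = v := by
    intro v
    rw [List.mem_iff_getElem]
    constructor
    · rintro ⟨i, hi, rfl⟩; exact ⟨i, hi, hpe i hi⟩
    · rintro ⟨i, hi, rfl⟩; exact ⟨i, hi, (hpe i hi).symm⟩
  have hadj : ∀ i, i + 1 < l → G.Adj (p i) (p (i + 1)) := by
    intro i hi
    rw [hpe i (by omega), hpe _ hi]
    exact List.isChain_iff_getElem.1 h.chain _ hi
  have hp0 : p 0 = a := by
    have := h.head
    rw [List.head?_eq_getElem?] at this
    simp [hp, List.getD, this]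
  have hpl : p (l - 1) = b := by
    have := h.last
    rw [List.getLast?_eq_getElem?] at this
    simp [hp, List.getD, hl, this]
  have hSa : #S ≤ 2 * #{i ∈ range (l - 1) | G.Adj a (p (i + 1))} := by
    refine (hdeg a (hLS a h.head_mem)).trans (Nat.mul_le_mul_left 2 ?_)
    refine (card_le_card (t := Finset.image (fun i => p (i + 1)) _) ?_).trans card_image_le
    intro w hw
    rw [mem_filter] at hw
    obtain ⟨i, hi, rfl⟩ := (hpL w).1 (ha w hw.1 hw.2)
    have hi0 : i ≠ 0 := by rintro rfl; rw [hp0] at hw; exact hw.2.ne rfl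
    refine mem_image.2 ⟨i - 1, ?_, by rw [show i - 1 + 1 = i by omega]⟩
    rw [mem_filter, mem_range, show i - 1 + 1 = i by omega]
    exact ⟨by omega, hw.2⟩
  have hSb : #S ≤ 2 * #{i ∈ range (l - 1) | G.Adj b (p i)} := by
    refine (hdeg b (hLS b h.last_mem)).trans (Nat.mul_le_mul_left 2 ?_)
    refine (card_le_card (t := Finset.image p _) ?_).trans card_image_le
    intro w hw
    rw [mem_filter] at hw
    obtain ⟨i, hi, rfl⟩ := (hpL w).1 (hb w hw.1 hw.2)
    have hi0 : i ≠ l - 1 := by rintro rfl; rw [hpl] at hw; exact hw.2.ne rfl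
    exact mem_image.2 ⟨i, by rw [mem_filter, mem_range]; exact ⟨by omega, hw.2⟩, rfl⟩
  have hlS : l ≤ #S := by
    rw [hl, ← List.toFinset_card_of_nodup h.nodup]
    exact card_le_card fun v hv => hLS v (List.mem_toFinset.1 hv)
  obtain ⟨i, hi⟩ : ({i ∈ range (l - 1) | G.Adj a (p (i + 1))} ∩
      {i ∈ range (l - 1) | G.Adj b (p i)}).Nonempty := by
    rw [← card_pos]
    have h1 := card_union_add_card_inter {i ∈ range (l - 1) | G.Adj a (p (i + 1))}
      {i ∈ range (l - 1) | G.Adj b (p i)}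
    have h2 : #({i ∈ range (l - 1) | G.Adj a (p (i + 1))} ∪
      {i ∈ range (l - 1) | G.Adj b (p i)}) ≤ l - 1 := by
      refine (card_le_card (union_subset (filter_subset _ _) (filter_subset _ _))).trans ?_
      simp
    omega
  simp only [mem_inter, mem_filter, mem_range] at hi
  obtain ⟨⟨hil, hai⟩, -, hbi⟩ := hi
  have q1 : PathList G ((List.range (i + 1)).map p) (p 0) (p i) := by
    refine pathList_map hpinj ?_ List.nodup_range ?_ (by simp [List.head?_range])
      (by simp [List.getLast?_range])
    · intro j hj
      rw [List.mem_range] at hj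
      omega
    · rw [List.isChain_iff_getElem]
      intro j hj
      simp only [List.length_range] at hj
      simp only [List.getElem_range]
      exact hadj j (by omega)
  have q2 : PathList G ((List.range' (i + 1) (l - 1 - i)).map p) (p (i + 1)) (p (l - 1)) := by
    refine pathList_map hpinj ?_ List.nodup_range' ?_ ?_ ?_
    · intro j hj
      simp at hj
      omega
    · rw [List.isChain_iff_getElem]
      intro j hj
      simp only [List.length_range'] at hj
      simp only [List.getElem_range', one_mul]
      exact hadj _ (by omega)
    · simp [List.head?_range']; omega
    · rw [List.getLast?_range', if_neg (by omega)]
      simp; omega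
  refine ⟨_, _, _, q1.append q2.reverse (by rw [hpl]; exact hbi.symm) ?_, ?_, ?_, ?_⟩
  · intro v hv hv'
    simp only [List.mem_reverse, List.mem_map, List.mem_range, List.mem_range'_1] at hv hv'
    obtain ⟨j, hj, rfl⟩ := hv
    obtain ⟨j', hj', h⟩ := hv'
    have := hpinj (show j' < l by omega) (show j < l by omega) h
    omega
  · rw [hp0]; exact hai.symm
  · simp; omega
  · intro v
    rw [hpL]
    simp only [List.mem_append, List.mem_reverse, List.mem_map, List.mem_range, List.mem_range'_1]
    constructor
    · rintro (⟨j, hj, rfl⟩ | ⟨j, hj, rfl⟩)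
      · exact ⟨j, by omega, rfl⟩
      · exact ⟨j, by omega, rfl⟩
    · rintro ⟨j, hj, rfl⟩
      by_cases hji : j < i + 1
      · exact Or.inl ⟨j, hji, rfl⟩
      · exact Or.inr ⟨j, by omega, rfl⟩

lemma PathList.exists_isCyc (h : PathList G L a b) (hba : G.Adj b a) :
    ∃ f, IsCyc G L.length f ∧ ∀ v, v ∈ L ↔ v ∈ Set.range f := by
  have : NeZero L.length := ⟨fun h0 => h.ne_nil (List.length_eq_zero_iff.1 h0)⟩
  refine ⟨_, h.isCyc hba rfl, fun v => ?_⟩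
  rw [List.mem_iff_getElem]
  constructor
  · rintro ⟨i, hi, rfl⟩
    refine ⟨i, ?_⟩
    unfold cycOfList
    congr 1
    exact ZMod.val_cast_of_lt hi
  · rintro ⟨i, rfl⟩
    exact ⟨i.val, ZMod.val_lt i, rfl⟩

/-- **Dirac's theorem** for the subgraph induced on `S`. -/
lemma dirac {S : Finset V} (h0 : 0 < #S) (hdeg : ∀ v ∈ S, #S ≤ 2 * #{w ∈ S | G.Adj v w}) :
    HasCyc G #S := by
  set P : ℕ → Prop := fun l => ∃ L a b, PathList G L a b ∧ (∀ v ∈ L, v ∈ S) ∧ L.length = l with hP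
  have hPb : ∀ l, P l → l ≤ #S := by
    rintro l ⟨L, a, b, h, hL, rfl⟩
    rw [← List.toFinset_card_of_nodup h.nodup]
    exact card_le_card fun v hv => hL v (List.mem_toFinset.1 hv)
  have hP1 : P 1 := by
    obtain ⟨v, hv⟩ := card_pos.1 h0
    exact ⟨[v], v, v, PathList.singleton v, by simpa using hv, rfl⟩
  obtain ⟨L, a, b, h, hLS, hlen⟩ := Nat.findGreatest_spec (hPb 1 hP1) hP1
  have hmax : ∀ l, P l → l ≤ L.length := by
    intro l hl
    rw [hlen]
    exact Nat.le_findGreatest (hPb l hl) hl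
  have hend : ∀ L a b, PathList G L a b → (∀ v ∈ L, v ∈ S) → L.length = Nat.findGreatest P #S →
      ∀ w ∈ S, G.Adj b w → w ∈ L := by
    intro L' a' b' h' hLS' hlen' w hw hbw
    by_contra hwL
    have := hmax (L'.length + 1) ⟨L' ++ [w], a', w, h'.append (PathList.singleton w) hbw (by
      intro v hv hv'
      simp at hv'
      exact hwL (hv' ▸ hv)), by
        intro v hv
        rcases List.mem_append.1 hv with hv | hv
        · exact hLS' v hv
        · simp at hv; exact hv ▸ hw, by simp⟩
    omega
  obtain ⟨L', c, d, h', hdc, hlen', hmem⟩ := h.exists_cross hLS hdeg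
    (by simpa using hend _ _ _ h.reverse (by simpa using hLS) (by simpa using hlen))
    (hend _ _ _ h hLS hlen)
  obtain ⟨f, hf, hfr⟩ := h'.exists_isCyc hdc
  have hfl : IsCyc G L'.length f := hf
  by_cases hS : L.length = #S
  · exact h'.hasCyc hdc (by omega)
  exfalso
  have hlS := hPb _ ⟨L, a, b, h, hLS, rfl⟩
  obtain ⟨z, hz, hzL⟩ : ∃ z ∈ S, z ∉ L := by
    by_contra! hc
    apply hS
    refine le_antisymm hlS ?_
    rw [← List.toFinset_card_of_nodup h.nodup]
    exact card_le_card fun v hv => List.mem_toFinset.2 (hc v hv)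
  have hLcard : #S + 2 ≤ 2 * L.length := by
    have h1 := hdeg b (hLS b h.last_mem)
    have h2 : #{w ∈ S | G.Adj b w} + 1 ≤ L.length := by
      rw [← List.toFinset_card_of_nodup h.nodup, ← card_insert_of_notMem (a := b)]
      · refine card_le_card fun v hv => List.mem_toFinset.2 ?_
        rcases mem_insert.1 hv with rfl | hv
        · exact h.last_mem
        · rw [mem_filter] at hv
          exact hend _ _ _ h hLS hlen _ hv.1 hv.2
      · simp
    omega
  obtain ⟨w, hw, hwL⟩ : ∃ w ∈ ({w ∈ S | G.Adj z w} : Finset V), w ∈ L := by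
    by_contra! hc
    have h1 := hdeg z hz
    have h2 : #({w ∈ S | G.Adj z w} ∪ L.toFinset) ≤ #S := by
      refine card_le_card (union_subset (filter_subset _ _) ?_)
      intro v hv; exact hLS v (List.mem_toFinset.1 hv)
    rw [card_union_of_disjoint, List.toFinset_card_of_nodup h.nodup] at h2
    · omega
    · rw [disjoint_left]
      intro v hv hv'
      exact hc v hv (List.mem_toFinset.1 hv')
  rw [mem_filter] at hw
  rw [← hmem, hfr] at hwL
  obtain ⟨i, rfl⟩ := hwL
  have : NeZero L'.length := ⟨fun h0 => h'.ne_nil (List.length_eq_zero_iff.1 h0)⟩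
  have hmemf : ∀ v, v ∈ seg f (i + 1) L'.length ↔ v ∈ L := by
    intro v; rw [mem_seg_full, ← hfr, hmem]
  have := hend _ _ _ (hfl.open_pathList i) (fun v hv => hLS v ((hmemf v).1 hv))
    (by simp [hlen', hlen]) z hz hw.2.symm
  exact hzL ((hmemf z).1 this)

end

section
open scoped Classical
variable {V : Type*} {G K : SimpleGraph V} {m n : ℕ} {f : ZMod m → V} {a b c d u v w x z : V}
  {L L₁ L₂ : List V}

lemma adj_of_eq_compl (hK : K = Gᶜ) (h : u ≠ v) (h' : ¬ G.Adj u v) : K.Adj u v :=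
  hK ▸ compl_adj_of h h'

lemma hasCyc_four {y₁ y₂ : V} (huv : u ≠ v) (hy : y₁ ≠ y₂) (h₁ : G.Adj u y₁) (h₂ : G.Adj u y₂)
    (h₃ : G.Adj v y₁) (h₄ : G.Adj v y₂) : HasCyc G 4 := by
  have hp : PathList G [u, y₁, v, y₂] u y₂ := by
    refine ⟨?_, ?_, rfl, rfl⟩
    · simp [huv, hy, h₁.ne, h₂.ne, h₃.ne', h₄.ne]
    · simp only [List.isChain_cons_cons, List.isChain_singleton, and_true]
      exact ⟨h₁, h₃.symm, h₄⟩
  exact hp.hasCyc h₂.symm rfl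

lemma exists_mono_four [Fintype V] (h : 8 ≤ Fintype.card V) : HasCyc G 4 ∨ HasCyc Gᶜ 4 := by
  obtain ⟨v⟩ : Nonempty V := Fintype.card_pos_iff.1 (by omega)
  have key : ∀ K : SimpleGraph V, 4 ≤ #{w | K.Adj v w} → HasCyc K 4 ∨ HasCyc Kᶜ 4 := by
    intro K hK
    obtain ⟨A, hA, hA4⟩ := exists_subset_card_eq hK
    by_contra! hcon
    have hone : ∀ z, z ≠ v → #{y ∈ A | K.Adj z y} ≤ 1 := by
      intro z hz
      by_contra! h1
      obtain ⟨y₁, hy₁, y₂, hy₂, hne⟩ := one_lt_card.1 h1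
      rw [mem_filter] at hy₁ hy₂
      have e1 := hA hy₁.1
      have e2 := hA hy₂.1
      simp only [mem_filter, mem_univ, true_and] at e1 e2
      exact hcon.1 (hasCyc_four hz hne hy₁.2 hy₂.2 e1 e2)
    have hZ : 1 < #((insert v A)ᶜ) := by
      rw [card_compl]
      have := card_insert_le v A
      omega
    obtain ⟨z₁, hz₁, z₂, hz₂, hz⟩ := one_lt_card.1 hZ
    rw [mem_compl, mem_insert, not_or] at hz₁ hz₂
    have hc : 1 < #(A \ ({y ∈ A | K.Adj z₁ y} ∪ {y ∈ A | K.Adj z₂ y})) := by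
      have h1 := le_card_sdiff ({y ∈ A | K.Adj z₁ y} ∪ {y ∈ A | K.Adj z₂ y}) A
      have h2 := card_union_le {y ∈ A | K.Adj z₁ y} {y ∈ A | K.Adj z₂ y}
      have h3 := hone z₁ hz₁.1
      have h4 := hone z₂ hz₂.1
      omega
    obtain ⟨y₁, hy₁, y₂, hy₂, hy⟩ := one_lt_card.1 hc
    simp only [mem_sdiff, mem_union, mem_filter, not_or, not_and] at hy₁ hy₂
    have ne : ∀ z ∉ A, ∀ y ∈ A, z ≠ y := by rintro z hz y hy rfl; exact hz hy
    exact hcon.2 (hasCyc_four hz hy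
      (compl_adj_of (ne _ hz₁.2 _ hy₁.1) (hy₁.2.1 hy₁.1))
      (compl_adj_of (ne _ hz₁.2 _ hy₂.1) (hy₂.2.1 hy₂.1))
      (compl_adj_of (ne _ hz₂.2 _ hy₁.1) (hy₁.2.2 hy₁.1))
      (compl_adj_of (ne _ hz₂.2 _ hy₂.1) (hy₂.2.2 hy₂.1)))
  by_cases h4 : 4 ≤ #{w | G.Adj v w}
  · exact key G h4
  · obtain ⟨K, hK⟩ : ∃ K, K = Gᶜ := ⟨_, rfl⟩
    have : 4 ≤ #{w | K.Adj v w} := by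
      have h1 : (univ : Finset V) ⊆
          insert v (({w | G.Adj v w} : Finset V) ∪ ({w | K.Adj v w} : Finset V)) := by
        intro w _
        simp only [mem_insert, mem_union, mem_filter, mem_univ, true_and, hK, SimpleGraph.compl_adj]
        tauto
      have h2 := card_le_card h1
      have h3 := card_insert_le v (({w | G.Adj v w} : Finset V) ∪ ({w | K.Adj v w} : Finset V))
      have h4 := card_union_le ({w | G.Adj v w} : Finset V) ({w | K.Adj v w})
      rw [card_univ] at h2
      omega
    have := key K this
    rw [hK, compl_compl] at this
    exact this.symm

/-- The positions on `f` of the neighbours of `w`. -/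
def nbIdx (G : SimpleGraph V) {m : ℕ} [NeZero m] (f : ZMod m → V) (w : V) : Finset (ZMod m) :=
  {i | G.Adj w (f i)}

@[simp] lemma mem_nbIdx [NeZero m] {i : ZMod m} : i ∈ nbIdx G f w ↔ G.Adj w (f i) := by
  simp [nbIdx]

lemma IsCyc.notMem_nbIdx_succ [NeZero m] (hf : IsCyc G m f) (hno : ¬ HasCyc G (m + 1))
    (hw : w ∉ Set.range f) {i : ZMod m} (hi : i ∈ nbIdx G f w) : i + 1 ∉ nbIdx G f w := by
  intro h
  rw [mem_nbIdx] at hi h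
  exact hno (hf.hasCyc_succ hw (Or.inl rfl) (Or.inr ⟨i, hi, rfl⟩) h)

lemma IsCyc.two_mul_card_nbIdx_le [NeZero m] (hf : IsCyc G m f) (hno : ¬ HasCyc G (m + 1))
    (hw : w ∉ Set.range f) : 2 * #(nbIdx G f w) ≤ m := by
  have h1 : #((nbIdx G f w).image (· + 1)) = #(nbIdx G f w) :=
    card_image_of_injective _ (add_left_injective 1)
  have h2 : Disjoint (nbIdx G f w) ((nbIdx G f w).image (· + 1)) := by
    rw [disjoint_left]
    intro i hi hi'
    obtain ⟨j, hj, rfl⟩ := mem_image.1 hi'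
    exact hf.notMem_nbIdx_succ hno hw hj hi
  have h3 := card_le_univ (nbIdx G f w ∪ (nbIdx G f w).image (· + 1))
  rw [card_union_of_disjoint h2, h1, ZMod.card] at h3
  omega

lemma IsCyc.card_compl_adj [NeZero m] (hK : K = Gᶜ) (hf : IsCyc G m f) (hw : w ∉ Set.range f) :
    #{y ∈ univ.image f | K.Adj w y} + #(nbIdx G f w) = m := by
  have h1 : ({y ∈ univ.image f | K.Adj w y} : Finset V) = ((nbIdx G f w)ᶜ).image f := by
    ext y
    simp only [mem_filter, mem_image, mem_univ, true_and, mem_compl, mem_nbIdx]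
    constructor
    · rintro ⟨⟨i, rfl⟩, h⟩
      exact ⟨i, ((SimpleGraph.compl_adj _ _ _).1 (hK ▸ h)).2, rfl⟩
    · rintro ⟨i, h, rfl⟩
      exact ⟨⟨i, rfl⟩, adj_of_eq_compl hK (fun h' => hw ⟨i, h'.symm⟩) h⟩
  rw [h1, card_image_of_injective _ hf.1, card_compl, ZMod.card]
  have := card_le_univ (nbIdx G f w)
  rw [ZMod.card] at this
  omega

lemma IsCyc.card_outside [Fintype V] [NeZero m] (hf : IsCyc G m f) :
    #{v : V | v ∉ Set.range f} + m = Fintype.card V := by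
  have h1 : ({v : V | v ∉ Set.range f} : Finset V) = (univ.image f)ᶜ := by
    ext v; simp
  have h2 : #(univ.image f) = m := by
    rw [card_image_of_injective _ hf.1, card_univ, ZMod.card]
  have := card_le_univ (univ.image f)
  rw [h1, card_compl, h2]
  omega

/-- The path of all vertices of `f` except `f (i + 1)`. -/
lemma IsCyc.skip_pathList [NeZero m] (hf : IsCyc G m f) (h2 : 2 ≤ m) (i : ZMod m) :
    PathList G (seg f (i + 1 + 1) (m - 1)) (f (i + 1 + 1)) (f i) := by
  have p := hf.seg_pathList (i + 1 + 1) (d := m - 2) (by omega)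
  have e1 : i + 1 + 1 + ((m - 2 : ℕ) : ZMod m) = i := by
    have : ((2 + (m - 2) : ℕ) : ZMod m) = 0 := by
      rw [show 2 + (m - 2) = m by omega, ZMod.natCast_self]
    rw [Nat.cast_add] at this
    push_cast at this ⊢
    linear_combination this
  rwa [e1, show m - 2 + 1 = m - 1 by omega] at p

lemma IsCyc.hasCyc_replace [NeZero m] (hf : IsCyc G m f) (h2 : 2 ≤ m) {i : ZMod m}
    (hL : PathList G L a b) (hdisj : ∀ v ∈ L, v ∉ Set.range f) (ha : G.Adj (f i) a)
    (hb : G.Adj b (f (i + 1 + 1))) {m' : ℕ} (hm' : m - 1 + L.length = m') : HasCyc G m' := by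
  refine ((hf.skip_pathList h2 i).append hL ha ?_).hasCyc hb (by simpa using hm')
  intro v hv hv'
  obtain ⟨t, -, rfl⟩ := mem_seg.1 hv
  exact hdisj _ hv' ⟨_, rfl⟩

lemma IsCyc.false_of_length_even [Fintype V] (hK : K = Gᶜ) (hn : 3 ≤ n)
    (hV : 3 * n - 1 ≤ Fintype.card V)
    {f : ZMod (2 * n - 2) → V} (hf : IsCyc G (2 * n - 2) f)
    (hG : ∀ m, 2 * n - 1 ≤ m → ¬ HasCyc G m) (hB : ¬ HasCyc K (2 * n)) : False := by
  have : NeZero (2 * n - 2) := ⟨by omega⟩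
  have hno1 : ¬ HasCyc G (2 * n - 2 + 1) := hG _ (by omega)
  have hno2 : ¬ HasCyc G (2 * n - 2 + 2) := hG _ (by omega)
  set W : Finset V := {v | v ∉ Set.range f} with hW
  have hWcard := hf.card_outside
  rw [← hW] at hWcard
  have hWr : ∀ w ∈ W, w ∉ Set.range f := fun w hw => by simpa [hW] using hw
  have hNle : ∀ w ∈ W, #(nbIdx G f w) ≤ n - 1 := by
    intro w hw
    have := hf.two_mul_card_nbIdx_le hno1 (hWr w hw)
    omega
  rcases le_or_gt #{w ∈ W | #(nbIdx G f w) = n - 1} 1 with hΘ | hΘ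
  · have hcard : n ≤ #{w ∈ W | ¬ #(nbIdx G f w) = n - 1} := by
      have := card_filter_add_card_filter_not (s := W) (fun w => #(nbIdx G f w) = n - 1)
      omega
    obtain ⟨X, hXs, hXc⟩ := exists_subset_card_eq hcard
    have hXW : ∀ w ∈ X, w ∈ W ∧ #(nbIdx G f w) ≠ n - 1 := fun w hw => by
      simpa using hXs hw
    obtain ⟨x₀⟩ : Nonempty V := ⟨f 0⟩
    have hd : ∀ x ∈ X, n ≤ #{y ∈ univ.image f | K.Adj x y} := by
      intro x hx
      have h1 := hf.card_compl_adj hK (hWr x (hXW x hx).1)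
      have h2 := hNle x (hXW x hx).1
      have h3 := (hXW x hx).2
      omega
    have := hasCyc_two_mul_card (G := K) (X := X) (Y := univ.image f) (d := n) (e := 0)
      (x₀ := x₀) ?_ ?_ (fun x hx _ => hd x hx) (fun hx => hd _ hx) (by omega) (by omega)
    · rw [hXc] at this
      exact hB this
    · rw [disjoint_left]
      intro x hx hx'
      obtain ⟨i, -, rfl⟩ := mem_image.1 hx'
      exact hWr _ (hXW _ hx).1 ⟨i, rfl⟩
    · rw [card_image_of_injective _ hf.1, card_univ, ZMod.card]
      omega
  · obtain ⟨w₁, hw₁, w₂, hw₂, hw⟩ := one_lt_card.1 hΘ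
    rw [mem_filter] at hw₁ hw₂
    have hr₁ := hWr _ hw₁.1
    have hr₂ := hWr _ hw₂.1
    have halt : ∀ w ∈ W, #(nbIdx G f w) = n - 1 → ∀ i, i + 1 ∈ nbIdx G f w ↔ i ∉ nbIdx G f w := by
      intro w hw hc
      have h1 : (nbIdx G f w).image (· + 1) = (nbIdx G f w)ᶜ := by
        refine eq_of_subset_of_card_le ?_ ?_
        · intro i hi
          obtain ⟨j, hj, rfl⟩ := mem_image.1 hi
          exact mem_compl.2 (hf.notMem_nbIdx_succ hno1 (hWr w hw) hj)
        · rw [card_image_of_injective _ (add_left_injective 1), card_compl, ZMod.card]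
          omega
      intro i
      have h2 : i + 1 ∈ (nbIdx G f w).image (· + 1) ↔ i ∈ nbIdx G f w := by simp
      rw [h1, mem_compl] at h2
      tauto
    have halt₁ := halt _ hw₁.1 hw₁.2
    have halt₂ := halt _ hw₂.1 hw₂.2
    have hsucc : ∀ w, (∀ i, i + 1 ∈ nbIdx G f w ↔ i ∉ nbIdx G f w) → ∀ i, i ∉ nbIdx G f w →
        f i ∈ succSet G f w := by
      intro w hw i hi
      refine Or.inr ⟨i - 1, ?_, by rw [sub_add_cancel]⟩
      have := hw (i - 1)
      rw [sub_add_cancel] at this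
      rw [← mem_nbIdx]
      tauto
    have hne2 : ∀ i : ZMod (2 * n - 2), f i ≠ f (i + 1 + 1) := by
      intro i
      have := hf.ne_add (i := i) (t := 2) (by omega) (by omega)
      rw [add_assoc, one_add_one_eq_two]
      simpa using this
    have hsub : nbIdx G f w₂ ⊆ nbIdx G f w₁ := by
      intro i hi
      by_contra hi'
      have h2 : i + 1 + 1 ∈ nbIdx G f w₂ := by rw [halt₂, halt₂]; tauto
      have h1 : i + 1 + 1 ∉ nbIdx G f w₁ := by rw [halt₁, halt₁]; tauto
      exact hno2 (hf.hasCyc_add_two hr₁ hr₂ hw.symm (hsucc _ halt₁ _ hi') (hsucc _ halt₁ _ h1)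
        (hne2 i) (by simpa using hi) (by simpa using h2))
    have hN : nbIdx G f w₂ = nbIdx G f w₁ := eq_of_subset_of_card_le hsub (by omega)
    obtain ⟨i₀, hi₀⟩ : (nbIdx G f w₁).Nonempty := card_pos.1 (by omega)
    have hi₀' : i₀ + 1 + 1 ∈ nbIdx G f w₁ := by rw [halt₁, halt₁]; tauto
    have hb₁₂ : ¬ G.Adj w₁ w₂ := by
      intro h
      refine hno1 (hf.hasCyc_replace (L := [w₁, w₂]) (a := w₁) (b := w₂) (i := i₀) (by omega)
        ?_ ?_ ?_ ?_ ?_)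
      · exact ⟨by simpa using hw, by simpa using h, rfl, rfl⟩
      · intro v hv
        simp at hv
        rcases hv with rfl | rfl <;> assumption
      · exact (mem_nbIdx.1 hi₀).symm
      · rw [← hN] at hi₀'
        exact mem_nbIdx.1 hi₀'
      · simp; omega
    set O : Finset V := insert w₁ (insert w₂ (((nbIdx G f w₁)ᶜ).image f)) with hO
    have hw₁O : w₁ ∉ insert w₂ (((nbIdx G f w₁)ᶜ).image f) := by
      rw [mem_insert, mem_image, not_or]
      exact ⟨hw, fun ⟨i, _, h⟩ => hr₁ ⟨i, h⟩⟩
    have hw₂O : w₂ ∉ ((nbIdx G f w₁)ᶜ).image f := by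
      rw [mem_image]
      exact fun ⟨i, _, h⟩ => hr₂ ⟨i, h⟩
    have hOcard : #O = n + 1 := by
      rw [hO, card_insert_of_notMem hw₁O, card_insert_of_notMem hw₂O,
        card_image_of_injective _ hf.1, card_compl, ZMod.card]
      omega
    have hOpair : ∀ u ∈ O, ∀ v ∈ O, u ≠ v → (u ∈ succSet G f w₁ ∧ v ∈ succSet G f w₁) ∨
        (u ∈ succSet G f w₂ ∧ v ∈ succSet G f w₂) ∨ (u = w₁ ∧ v = w₂) ∨ (u = w₂ ∧ v = w₁) := by
      have h0 : ∀ u ∈ O, u = w₁ ∨ u = w₂ ∨ (u ∈ succSet G f w₁ ∧ u ∈ succSet G f w₂) := by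
        intro u hu
        rw [hO, mem_insert, mem_insert, mem_image] at hu
        rcases hu with h | h | ⟨i, hi, rfl⟩
        · exact Or.inl h
        · exact Or.inr (Or.inl h)
        · rw [mem_compl] at hi
          exact Or.inr (Or.inr ⟨hsucc _ halt₁ _ hi, hsucc _ halt₂ _ (hN ▸ hi)⟩)
      have e1 : w₁ ∈ succSet G f w₁ := Or.inl rfl
      have e2 : w₂ ∈ succSet G f w₂ := Or.inl rfl
      intro u hu v hv huv
      rcases h0 u hu with h | h | hu'
      · rcases h0 v hv with h' | h' | hv'
        · exact absurd (h.trans h'.symm) huv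
        · exact Or.inr (Or.inr (Or.inl ⟨h, h'⟩))
        · exact Or.inl ⟨h ▸ e1, hv'.1⟩
      · rcases h0 v hv with h' | h' | hv'
        · exact Or.inr (Or.inr (Or.inr ⟨h, h'⟩))
        · exact absurd (h.trans h'.symm) huv
        · exact Or.inr (Or.inl ⟨h ▸ e2, hv'.2⟩)
      · rcases h0 v hv with h' | h' | hv'
        · exact Or.inl ⟨hu'.1, h' ▸ e1⟩
        · exact Or.inr (Or.inl ⟨hu'.2, h' ▸ e2⟩)
        · exact Or.inl ⟨hu'.1, hv'.1⟩
    have hOind : ∀ u ∈ O, ∀ v ∈ O, ¬ G.Adj u v := by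
      intro u hu v hv huv
      rcases hOpair u hu v hv huv.ne with h | h | ⟨rfl, rfl⟩ | ⟨rfl, rfl⟩
      · exact hno1 (hf.hasCyc_succ hr₁ h.1 h.2 huv)
      · exact hno1 (hf.hasCyc_succ hr₂ h.1 h.2 huv)
      · exact hb₁₂ huv
      · exact hb₁₂ huv.symm
    have hOone : ∀ w ∈ W, w ∉ O → #{v ∈ O | G.Adj w v} ≤ 1 := by
      intro w hwW hwO
      by_contra! hc
      obtain ⟨u, hu, v, hv, huv⟩ := one_lt_card.1 hc
      rw [mem_filter] at hu hv
      have hww₁ : w ≠ w₁ := by rintro rfl; exact hwO (by simp [hO])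
      have hww₂ : w ≠ w₂ := by rintro rfl; exact hwO (by simp [hO])
      have hlast : G.Adj w w₁ → G.Adj w w₂ → False := by
        intro h1 h2
        refine hno2 (hf.hasCyc_replace (L := [w₁, w, w₂]) (a := w₁) (b := w₂) (i := i₀)
          (by omega) ?_ ?_ ?_ ?_ ?_)
        · refine ⟨by simp [hw, hww₁.symm, hww₂], ?_, rfl, rfl⟩
          simp only [List.isChain_cons_cons, List.isChain_singleton, and_true]
          exact ⟨h1.symm, h2⟩
        · intro v hv
          simp at hv
          rcases hv with rfl | rfl | rfl
          · exact hr₁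
          · exact hWr _ hwW
          · exact hr₂
        · exact (mem_nbIdx.1 hi₀).symm
        · rw [← hN] at hi₀'
          exact mem_nbIdx.1 hi₀'
        · simp; omega
      rcases hOpair u hu.1 v hv.1 huv with h | h | ⟨rfl, rfl⟩ | ⟨rfl, rfl⟩
      · exact hno2 (hf.hasCyc_add_two hr₁ (hWr w hwW) hww₁ h.1 h.2 huv hu.2 hv.2)
      · exact hno2 (hf.hasCyc_add_two hr₂ (hWr w hwW) hww₂ h.1 h.2 huv hu.2 hv.2)
      · exact hlast hu.2 hv.2
      · exact hlast hv.2 hu.2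
    have hW' : n - 1 ≤ #((W.erase w₁).erase w₂) := by
      rw [card_erase_of_mem (mem_erase.2 ⟨hw.symm, hw₂.1⟩), card_erase_of_mem hw₁.1]
      omega
    obtain ⟨W', hW's, hW'c⟩ := exists_subset_card_eq hW'
    have hW'W : ∀ w ∈ W', w ∈ W ∧ w ∉ O := by
      intro w hwW'
      have h1 := hW's hwW'
      simp only [mem_erase] at h1
      refine ⟨h1.2.2, ?_⟩
      rw [hO, mem_insert, mem_insert, mem_image]
      rintro (h | h | ⟨i, -, rfl⟩)
      · exact h1.2.1 h
      · exact h1.1 h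
      · exact hWr _ h1.2.2 ⟨i, rfl⟩
    have hdisj : Disjoint O W' := disjoint_right.2 fun w hw => (hW'W w hw).2
    have hS : #(O ∪ W') = 2 * n := by
      rw [card_union_of_disjoint hdisj]; omega
    have := dirac (G := K) (S := O ∪ W') (by omega) ?_
    · rw [hS] at this
      exact hB this
    intro v hv
    rw [hS]
    refine Nat.mul_le_mul_left 2 ?_
    rcases mem_union.1 hv with hv | hv
    · have : O.erase v ⊆ {w ∈ O ∪ W' | K.Adj v w} := by
        intro u hu
        rw [mem_erase] at hu
        rw [mem_filter, mem_union]
        exact ⟨Or.inl hu.2, adj_of_eq_compl hK hu.1.symm (hOind v hv u hu.2)⟩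
      have := card_le_card this
      rw [card_erase_of_mem hv] at this
      omega
    · have h1 : {u ∈ O | ¬ G.Adj v u} ⊆ {w ∈ O ∪ W' | K.Adj v w} := by
        intro u hu
        rw [mem_filter] at hu
        rw [mem_filter, mem_union]
        refine ⟨Or.inl hu.1, adj_of_eq_compl hK ?_ hu.2⟩
        rintro rfl
        exact (hW'W _ hv).2 hu.1
      have h2 := card_le_card h1
      have h3 := card_filter_add_card_filter_not (s := O) (fun u => G.Adj v u)
      have h4 := hOone v (hW'W _ hv).1 (hW'W _ hv).2
      omega

end

section
open scoped Classical
variable {V : Type*} {G K : SimpleGraph V} {m n : ℕ} {f : ZMod m → V} {a b c d u v w x z : V}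
  {L L₁ L₂ : List V}

lemma IsCyc.false_of_length_odd [Fintype V] (hK : K = Gᶜ) (hn : 3 ≤ n)
    (hV : 3 * n - 1 ≤ Fintype.card V) {f : ZMod (2 * n - 1) → V} (hf : IsCyc G (2 * n - 1) f)
    (hG : ∀ m, 2 * n ≤ m → ¬ HasCyc G m) (hB : ¬ HasCyc K (2 * n)) : False := by
  have : NeZero (2 * n - 1) := ⟨by omega⟩
  have hno1 : ¬ HasCyc G (2 * n - 1 + 1) := hG _ (by omega)
  have hno2 : ¬ HasCyc G (2 * n - 1 + 2) := hG _ (by omega)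
  set W : Finset V := {v | v ∉ Set.range f} with hW
  have hWcard := hf.card_outside
  rw [← hW] at hWcard
  have hWr : ∀ w ∈ W, w ∉ Set.range f := fun w hw => by simpa [hW] using hw
  have hNle : ∀ w ∈ W, #(nbIdx G f w) ≤ n - 1 := by
    intro w hw
    have := hf.two_mul_card_nbIdx_le hno1 (hWr w hw)
    omega
  by_cases hΘ : ∀ w ∈ W, #(nbIdx G f w) ≠ n - 1
  · obtain ⟨X, hXW, hXc⟩ := exists_subset_card_eq (show n ≤ #W by omega)
    obtain ⟨x₀⟩ : Nonempty V := ⟨f 0⟩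
    have hd : ∀ x ∈ X, n + 1 ≤ #{y ∈ univ.image f | K.Adj x y} := by
      intro x hx
      have h1 := hf.card_compl_adj hK (hWr x (hXW hx))
      have h2 := hNle x (hXW hx)
      have h3 := hΘ x (hXW hx)
      omega
    have := hasCyc_two_mul_card (G := K) (X := X) (Y := univ.image f) (d := n + 1) (e := 0)
      (x₀ := x₀) ?_ ?_ (fun x hx _ => hd x hx) (fun hx => hd _ hx) (by omega) (by omega)
    · rw [hXc] at this
      exact hB this
    · rw [disjoint_left]
      intro x hx hx'
      obtain ⟨i, -, rfl⟩ := mem_image.1 hx'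
      exact hWr _ (hXW hx) ⟨i, rfl⟩
    · rw [card_image_of_injective _ hf.1, card_univ, ZMod.card]
      omega
  push Not at hΘ
  obtain ⟨w₁, hw₁, hN₁⟩ := hΘ
  have hr₁ := hWr _ hw₁
  set N := nbIdx G f w₁ with hN
  have hNs : Disjoint N (N.image (· + 1)) := by
    rw [disjoint_left]
    intro i hi hi'
    obtain ⟨j, hj, rfl⟩ := mem_image.1 hi'
    exact hf.notMem_nbIdx_succ hno1 hr₁ hj hi
  obtain ⟨z, hz⟩ : ∃ z, (N ∪ N.image (· + 1))ᶜ = {z} := by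
    rw [← card_eq_one, card_compl, card_union_of_disjoint hNs,
      card_image_of_injective _ (add_left_injective 1), ZMod.card]
    omega
  have hz' : ∀ i, i ∉ N → i = z ∨ i - 1 ∈ N := by
    intro i hi
    by_contra! h
    have : i ∈ (N ∪ N.image (· + 1))ᶜ := by
      rw [mem_compl, mem_union, mem_image, not_or]
      exact ⟨hi, fun ⟨j, hj, hj'⟩ => h.2 (by simpa [← hj'] using hj)⟩
    rw [hz, mem_singleton] at this
    exact h.1 this
  have hzN : z ∉ N ∧ z - 1 ∉ N := by
    have : z ∈ (N ∪ N.image (· + 1))ᶜ := by rw [hz]; simp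
    rw [mem_compl, mem_union, not_or] at this
    exact ⟨this.1, fun h => this.2 (mem_image.2 ⟨_, h, by ring⟩)⟩
  have hz'' : ∀ i, i ∉ N → i = z - 1 ∨ i + 1 ∈ N := by
    intro i hi
    by_contra! h
    rcases hz' (i + 1) h.2 with h' | h'
    · exact h.1 (by rw [← h']; ring)
    · exact hi (by simpa using h')
  have hzz : z ≠ z - 1 := by
    intro h
    have := hf.2 (z - 1)
    rw [sub_add_cancel, ← h] at this
    exact this.ne rfl
  have hw₁O : w₁ ∉ Nᶜ.image f := by
    rw [mem_image]
    exact fun ⟨i, _, h⟩ => hr₁ ⟨i, h⟩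
  set O : Finset V := insert w₁ (Nᶜ.image f) with hO
  have hOcard : #O = n + 1 := by
    rw [hO, card_insert_of_notMem hw₁O, card_image_of_injective _ hf.1, card_compl, ZMod.card]
    omega
  have hOmem : ∀ u ∈ O, (u = f z ∨ u ∈ succSet G f w₁) ∧
      (u = f (z - 1) ∨ u ∈ succSet G (fun i => f (-i)) w₁) := by
    intro u hu
    rw [hO, mem_insert, mem_image] at hu
    rcases hu with rfl | ⟨i, hi, rfl⟩
    · exact ⟨Or.inr (Or.inl rfl), Or.inr (Or.inl rfl)⟩
    · rw [mem_compl] at hi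
      constructor
      · rcases hz' i hi with rfl | h
        · exact Or.inl rfl
        · exact Or.inr (Or.inr ⟨i - 1, by simpa [hN] using h, by rw [sub_add_cancel]⟩)
      · rcases hz'' i hi with rfl | h
        · exact Or.inl rfl
        · exact Or.inr (Or.inr ⟨-(i + 1), by simpa [hN] using h, by simp⟩)
  have hr₁' : w₁ ∉ Set.range fun i => f (-i) := by
    rintro ⟨i, hi⟩; exact hr₁ ⟨_, hi⟩
  have hOpair : ∀ u ∈ O, ∀ v ∈ O, u ≠ v → (u ∈ succSet G f w₁ ∧ v ∈ succSet G f w₁) ∨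
      (u ∈ succSet G (fun i => f (-i)) w₁ ∧ v ∈ succSet G (fun i => f (-i)) w₁) ∨
      (u = f z ∧ v = f (z - 1)) ∨ (u = f (z - 1) ∧ v = f z) := by
    intro u hu v hv huv
    obtain ⟨hu1, hu2⟩ := hOmem u hu
    obtain ⟨hv1, hv2⟩ := hOmem v hv
    rcases hu1 with hu1 | hu1
    · rcases hv2 with hv2 | hv2
      · exact Or.inr (Or.inr (Or.inl ⟨hu1, hv2⟩))
      · rcases hu2 with hu2 | hu2
        · exact absurd (hf.1 (hu1.symm.trans hu2)) hzz
        · exact Or.inr (Or.inl ⟨hu2, hv2⟩)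
    · rcases hv1 with hv1 | hv1
      · rcases hu2 with hu2 | hu2
        · exact Or.inr (Or.inr (Or.inr ⟨hu2, hv1⟩))
        · rcases hv2 with hv2 | hv2
          · exact absurd (hf.1 (hv1.symm.trans hv2)) hzz
          · exact Or.inr (Or.inl ⟨hu2, hv2⟩)
      · exact Or.inl ⟨hu1, hv1⟩
  have hOind : ∀ u ∈ O, ∀ v ∈ O, G.Adj u v →
      (u = f z ∧ v = f (z - 1)) ∨ (u = f (z - 1) ∧ v = f z) := by
    intro u hu v hv huv
    rcases hOpair u hu v hv huv.ne with h | h | h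
    · exact absurd (hf.hasCyc_succ hr₁ h.1 h.2 huv) hno1
    · exact absurd (hf.rev.hasCyc_succ hr₁' h.1 h.2 huv) hno1
    · exact h
  have hOone : ∀ w ∈ W, w ∉ O → ∀ u ∈ O, ∀ v ∈ O, G.Adj w u → G.Adj w v → u = v := by
    intro w hwW hwO u hu v hv hwu hwv
    by_contra huv
    have hww₁ : w ≠ w₁ := by rintro rfl; exact hwO (by simp [hO])
    have hwr := hWr w hwW
    have hwr' : w ∉ Set.range fun i => f (-i) := by
      rintro ⟨i, hi⟩; exact hwr ⟨_, hi⟩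
    have hlast : G.Adj w (f z) → G.Adj w (f (z - 1)) → False := by
      intro h1 h2
      refine hf.notMem_nbIdx_succ hno1 hwr (mem_nbIdx.2 h2) ?_
      rw [sub_add_cancel]
      exact mem_nbIdx.2 h1
    rcases hOpair u hu v hv huv with h | h | ⟨rfl, rfl⟩ | ⟨rfl, rfl⟩
    · exact hno2 (hf.hasCyc_add_two hr₁ hwr hww₁ h.1 h.2 huv hwu hwv)
    · exact hno2 (hf.rev.hasCyc_add_two hr₁' hwr' hww₁ h.1 h.2 huv hwu hwv)
    · exact hlast hwu hwv
    · exact hlast hwv hwu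
  have hW' : n - 1 ≤ #(W.erase w₁) := by
    rw [card_erase_of_mem hw₁]
    omega
  obtain ⟨W', hW's, hW'c⟩ := exists_subset_card_eq hW'
  have hW'W : ∀ w ∈ W', w ∈ W ∧ w ∉ O := by
    intro w hwW'
    have h1 := hW's hwW'
    simp only [mem_erase] at h1
    refine ⟨h1.2, ?_⟩
    rw [hO, mem_insert, mem_image]
    rintro (h | ⟨i, -, rfl⟩)
    · exact h1.1 h
    · exact hWr _ h1.2 ⟨i, rfl⟩
  have hdisj : Disjoint O W' := disjoint_right.2 fun w hw => (hW'W w hw).2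
  have hS : #(O ∪ W') = 2 * n := by
    rw [card_union_of_disjoint hdisj]; omega
  have hspecial : ∀ p ∈ O, ∀ p', (∀ q ∈ O, G.Adj p q → q = p') → ∃ w ∈ W', ¬ G.Adj p w := by
    intro p hp p' hpp'
    by_contra! hall
    have hpW' : p ∉ W' := fun h => (hW'W p h).2 hp
    have hYc : #(O.erase p) = n := by rw [card_erase_of_mem hp]; omega
    have hXc : #(insert p W') = n := by rw [card_insert_of_notMem hpW']; omega
    have := hasCyc_two_mul_card (G := K) (X := insert p W') (Y := O.erase p) (d := n) (e := 1)
      (x₀ := p) ?_ (by omega) ?_ ?_ (by omega) (by omega)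
    · rw [hXc] at this
      exact hB this
    · rw [disjoint_right]
      intro q hq hq'
      rw [mem_erase] at hq
      rcases mem_insert.1 hq' with h | h
      · exact hq.1 h
      · exact (hW'W q h).2 hq.2
    · intro w hw hwp
      have hw := (mem_insert.1 hw).resolve_left hwp
      rw [filter_true_of_mem, hYc]
      intro q hq
      rw [mem_erase] at hq
      refine adj_of_eq_compl hK ?_ ?_
      · rintro rfl; exact (hW'W _ hw).2 hq.2
      · intro hadj
        exact hq.1 (hOone w (hW'W w hw).1 (hW'W w hw).2 q hq.2 p hp hadj (hall w hw).symm)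
    · intro _
      have : (O.erase p).erase p' ⊆ {y ∈ O.erase p | K.Adj p y} := by
        intro q hq
        rw [mem_erase, mem_erase] at hq
        rw [mem_filter, mem_erase]
        exact ⟨hq.2, adj_of_eq_compl hK hq.2.1.symm fun h => hq.1 (hpp' q hq.2.2 h)⟩
      have h1 := card_le_card this
      have h2 := pred_card_le_card_erase (s := O.erase p) (a := p')
      omega
  have := dirac (G := K) (S := O ∪ W') (by omega) ?_
  · rw [hS] at this
    exact hB this
  intro v hv
  rw [hS]
  refine Nat.mul_le_mul_left 2 ?_
  rcases mem_union.1 hv with hv | hv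
  · have hex : ∀ p', (∀ q ∈ O, G.Adj v q → q = p') → n ≤ #{w ∈ O ∪ W' | K.Adj v w} := by
      intro p' hp'
      obtain ⟨w, hw, hvw⟩ := hspecial v hv p' hp'
      have : insert w ((O.erase v).erase p') ⊆ {w ∈ O ∪ W' | K.Adj v w} := by
        intro u hu
        rw [mem_insert, mem_erase, mem_erase] at hu
        rw [mem_filter, mem_union]
        rcases hu with rfl | hu
        · refine ⟨Or.inr hw, adj_of_eq_compl hK ?_ hvw⟩
          rintro rfl
          exact (hW'W _ hw).2 hv
        · exact ⟨Or.inl hu.2.2, adj_of_eq_compl hK hu.2.1.symm fun h => hu.1 (hp' u hu.2.2 h)⟩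
      have h1 := card_le_card this
      rw [card_insert_of_notMem] at h1
      · have h2 := pred_card_le_card_erase (s := O.erase v) (a := p')
        rw [card_erase_of_mem hv] at h2
        omega
      · rw [mem_erase, mem_erase]
        exact fun h => (hW'W w hw).2 h.2.2
    by_cases h1 : v = f z
    · refine hex (f (z - 1)) fun q hq hvq => ?_
      rcases hOind v hv q hq hvq with h | h
      · exact h.2
      · exact absurd (hf.1 (h1.symm.trans h.1)) hzz
    · refine hex (f z) fun q hq hvq => ?_
      rcases hOind v hv q hq hvq with h | h
      · exact absurd h.1 h1
      · exact h.2
  · have h1 : {u ∈ O | ¬ G.Adj v u} ⊆ {w ∈ O ∪ W' | K.Adj v w} := by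
      intro u hu
      rw [mem_filter] at hu
      rw [mem_filter, mem_union]
      refine ⟨Or.inl hu.1, adj_of_eq_compl hK ?_ hu.2⟩
      rintro rfl
      exact (hW'W _ hv).2 hu.1
    have h2 := card_le_card h1
    have h3 := card_filter_add_card_filter_not (s := O) (fun u => G.Adj v u)
    have h4 : #{u ∈ O | G.Adj v u} ≤ 1 := by
      rw [card_le_one]
      intro p hp q hq
      rw [mem_filter] at hp hq
      exact hOone v (hW'W v hv).1 (hW'W v hv).2 p hp.1 q hq.1 hp.2 hq.2
    omega

lemma exists_long_mono [Fintype V] (h8 : 8 ≤ Fintype.card V) (hn : 2 ≤ n)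
    (hV : 3 * n - 1 ≤ Fintype.card V) : ∃ m, 2 * n ≤ m ∧ (HasCyc G m ∨ HasCyc Gᶜ m) := by
  induction n, hn using Nat.le_induction with
  | base => exact ⟨4, le_rfl, exists_mono_four h8⟩
  | succ n hn ih =>
    obtain ⟨m, hm, h⟩ := ih (by omega)
    by_contra! hno
    have hG : ∀ m, 2 * (n + 1) ≤ m → ¬ HasCyc G m := fun m hm => (hno m hm).1
    have hB : ∀ m, 2 * (n + 1) ≤ m → ¬ HasCyc Gᶜ m := fun m hm => (hno m hm).2
    have hodd : ∀ K : SimpleGraph V, (∀ m, 2 * (n + 1) ≤ m → ¬ HasCyc K m) →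
        (∀ m, 2 * (n + 1) ≤ m → ¬ HasCyc Kᶜ m) → ¬ HasCyc K (2 * (n + 1) - 1) := by
      rintro K h1 h2 ⟨f, hf⟩
      exact hf.false_of_length_odd rfl (by omega) hV h1 (h2 _ le_rfl)
    have heven : ∀ K : SimpleGraph V, (∀ m, 2 * (n + 1) ≤ m → ¬ HasCyc K m) →
        (∀ m, 2 * (n + 1) ≤ m → ¬ HasCyc Kᶜ m) → ¬ HasCyc K (2 * (n + 1) - 2) := by
      rintro K h1 h2 ⟨f, hf⟩
      refine hf.false_of_length_even rfl (by omega) hV (fun m hm => ?_) (h2 _ le_rfl)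
      rcases hm.eq_or_lt with rfl | hm
      · exact hodd K h1 h2
      · exact h1 m (by omega)
    have key : ∀ K : SimpleGraph V, (∀ m, 2 * (n + 1) ≤ m → ¬ HasCyc K m) →
        (∀ m, 2 * (n + 1) ≤ m → ¬ HasCyc Kᶜ m) → ¬ HasCyc K m := by
      intro K h1 h2 h3
      have : m = 2 * (n + 1) - 2 ∨ m = 2 * (n + 1) - 1 := by
        by_contra! hc
        exact h1 m (by omega) h3
      rcases this with rfl | rfl
      · exact heven K h1 h2 h3
      · exact hodd K h1 h2 h3
    rcases h with h | h
    · exact key G hG hB h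
    · exact key Gᶜ hB (by rwa [compl_compl]) h

/-- The upper bound in the Ramsey theorem for even cycles. -/
theorem exists_mono_cycle [Fintype V] (hn : 3 ≤ n) (hV : 3 * n - 1 ≤ Fintype.card V) :
    HasCyc G (2 * n) ∨ HasCyc Gᶜ (2 * n) :=
  let ⟨m, hm, h⟩ := exists_long_mono (by omega) (by omega) hV
  hasCyc_of_le hn m hm h

end

/-- `L` lists the vertices of a cycle in `G` in cyclic order. -/
def ClosedList {V : Type*} (G : SimpleGraph V) (L : List V) : Prop :=
  ∃ a b, PathList G L a b ∧ G.Adj b a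

/-- The number of rooted and oriented cycles with `m` vertices in `G`. -/
def cycNum {V : Type*} (G : SimpleGraph V) (m : ℕ) : ℕ :=
  Nat.card {f : ZMod m → V // IsCyc G m f}

section
open scoped Classical
variable {V : Type*} {G : SimpleGraph V} {m n : ℕ}

lemma card_le_cycNum [Finite V] [NeZero m] (S : Finset (List V))
    (hS : ∀ L ∈ S, ClosedList G L ∧ L.length = m) : #S ≤ cycNum G m := by
  have key : ∀ L : S, IsCyc G m (cycOfList L.1 m (hS L.1 L.2).2) := by
    rintro ⟨L, hL⟩
    obtain ⟨⟨a, b, h, hba⟩, hm⟩ := hS L hL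
    exact h.isCyc hba hm
  have : Nat.card S ≤ cycNum G m := by
    refine Nat.card_le_card_of_injective
      (fun L : S => (⟨_, key L⟩ : {f : ZMod m → V // IsCyc G m f})) ?_
    rintro ⟨L, hL⟩ ⟨L', hL'⟩ h
    have h1 : cycOfList L m (hS L hL).2 = cycOfList L' m (hS L' hL').2 := congrArg Subtype.val h
    have e1 := (hS L hL).2
    have e2 := (hS L' hL').2
    refine Subtype.ext (List.ext_getElem (by rw [e1, e2]) ?_)
    intro i hi hi'
    have := congrFun h1 (i : ZMod m)
    have hv : (i : ZMod m).val = i := ZMod.val_cast_of_lt (by dsimp only at hi; omega)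
    simpa [cycOfList, hv] using this
  simpa using this

lemma HasCyc.two_mul_le_cycNum [Finite V] (hm : 3 ≤ m) (h : HasCyc G m) :
    2 * m ≤ cycNum G m := by
  obtain ⟨f, hf⟩ := h
  have : NeZero m := ⟨by omega⟩
  have key : ∀ p : Bool × ZMod m,
      IsCyc G m (fun i => f (p.2 + if p.1 then i else -i)) := by
    rintro ⟨s, a⟩
    refine ⟨?_, ?_⟩
    · intro i j hij
      have := add_left_cancel (hf.1 hij)
      cases s <;> simpa using this
    · intro i
      cases s
      · have := (hf.2 (a - (i + 1))).symm
        have e : a - (i + 1) + 1 = a - i := by ring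
        rw [e] at this
        simpa [sub_eq_add_neg] using this
      · have := hf.2 (a + i)
        simpa [add_assoc] using this
  have : Nat.card (Bool × ZMod m) ≤ cycNum G m := by
    refine Nat.card_le_card_of_injective
      (fun p => (⟨_, key p⟩ : {f : ZMod m → V // IsCyc G m f})) ?_
    rintro ⟨s, a⟩ ⟨s', a'⟩ h
    have h1 := congrArg Subtype.val h
    have h2 : a = a' := by
      have := congrFun h1 0
      simpa using hf.1 this
    subst h2
    have h3 := add_left_cancel (hf.1 (congrFun h1 1))
    have h4 : (1 : ZMod m) ≠ -1 := by
      intro h5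
      have h6 : ((2 : ℕ) : ZMod m) = (0 : ℕ) := by
        push_cast
        have : (1 : ZMod m) + 1 = 0 := by nth_rewrite 1 [h5]; ring
        rw [← this]; norm_num
      have := natCast_inj_of_lt (by omega) (by omega) h6
      omega
    cases s <;> cases s' <;> simp_all [eq_comm]
  simpa [Nat.card_prod, Nat.card_zmod] using this

lemma exists_finset_of_branching {α : Type*} (P : List α → Prop) (h0 : P []) (q : ℕ → ℕ) (m : ℕ)
    (h : ∀ L, L.length < m → P L → ∃ T : Finset α, q L.length ≤ #T ∧ ∀ a ∈ T, P (a :: L)) :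
    ∃ S : Finset (List α), (∀ L ∈ S, P L ∧ L.length = m) ∧ ∏ t ∈ range m, q t ≤ #S := by
  induction m with
  | zero => exact ⟨{[]}, by simp [h0], by simp⟩
  | succ m ih =>
    obtain ⟨S, hS, hc⟩ := ih fun L hL => h L (by omega)
    have hex : ∀ L : S, ∃ T : Finset α, q m ≤ #T ∧ ∀ a ∈ T, P (a :: L.1) := by
      rintro ⟨L, hL⟩
      have := h L (by rw [(hS L hL).2]; omega) (hS L hL).1
      rwa [(hS L hL).2] at this
    choose T hT hT' using hex
    refine ⟨(univ.sigma T).image fun p => p.2 :: p.1.1, ?_, ?_⟩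
    · intro L hL
      simp only [mem_image, mem_sigma, mem_univ, true_and] at hL
      obtain ⟨⟨L', a⟩, ha, rfl⟩ := hL
      exact ⟨hT' _ _ ha, by simp [(hS L'.1 L'.2).2]⟩
    · rw [card_image_of_injective, card_sigma, prod_range_succ]
      · calc _ ≤ #S * q m := Nat.mul_le_mul_right _ hc
          _ = ∑ L : S, q m := by simp
          _ ≤ _ := sum_le_sum fun L _ => hT L
      · rintro ⟨L, a⟩ ⟨L', a'⟩ h
        simp only [List.cons.injEq] at h
        obtain ⟨rfl, h⟩ := h
        have := Subtype.ext h
        subst this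
        rfl

lemma exists_finset_injective (A : ℕ → Finset V) (q m : ℕ) (h : ∀ i < m, i + q ≤ #(A i)) :
    ∃ S : Finset (Fin m → V), (∀ g ∈ S, Function.Injective g ∧ ∀ i : Fin m, g i ∈ A i) ∧
      q ^ m ≤ #S := by
  induction m with
  | zero => exact ⟨{Fin.elim0}, by simp [Function.injective_of_subsingleton], by simp⟩
  | succ m ih =>
    obtain ⟨S, hS, hc⟩ := ih fun i hi => h i (by omega)
    refine ⟨(S.sigma fun g => A m \ univ.image g).image
      fun p => (Fin.snoc p.1 p.2 : Fin (m + 1) → V), ?_, ?_⟩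
    · intro g hg
      simp only [mem_image, mem_sigma, mem_sdiff, mem_univ, true_and] at hg
      obtain ⟨⟨g, a⟩, ⟨hg, ha, hag⟩, rfl⟩ := hg
      refine ⟨Fin.snoc_injective_iff.2 ⟨(hS g hg).1, by simpa using hag⟩, ?_⟩
      intro i
      refine Fin.lastCases ?_ (fun j => ?_) i
      · simpa using ha
      · simpa using (hS g hg).2 j
    · rw [card_image_of_injective, card_sigma, pow_succ]
      · calc _ ≤ #S * q := Nat.mul_le_mul_right _ hc
          _ = ∑ g ∈ S, q := by simp
          _ ≤ _ := by
            refine sum_le_sum fun g hg => ?_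
            have h1 := le_card_sdiff (univ.image g) (A m)
            have h2 : #(univ.image g) ≤ m := card_image_le.trans (by simp)
            have := h m (by omega)
            omega
      · rintro ⟨g, a⟩ ⟨g', a'⟩ h
        obtain ⟨rfl, rfl⟩ := Fin.snoc_injective2 h
        rfl

/-- The list `y 0, h 0, y 1, h 1, …`. -/
def interleave (y h : Fin m → V) : List V :=
  List.ofFn fun j : Fin (2 * m) =>
    if j.1 % 2 = 0 then y ⟨j.1 / 2, by omega⟩ else h ⟨j.1 / 2, by omega⟩

@[simp] lemma length_interleave (y h : Fin m → V) : (interleave y h).length = 2 * m := by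
  simp [interleave]

lemma getElem_interleave_even (y h : Fin m → V) (i : Fin m) :
    (interleave y h)[2 * i.1]'(by rw [length_interleave]; omega) = y i := by
  simp [interleave]

lemma getElem_interleave_odd (y h : Fin m → V) (i : Fin m) :
    (interleave y h)[2 * i.1 + 1]'(by rw [length_interleave]; omega) = h i := by
  have : (2 * i.1 + 1) / 2 = i.1 := by omega
  simp [interleave, Nat.add_mod, this]

lemma interleave_inj {y h y' h' : Fin m → V} (he : interleave y h = interleave y' h') :
    y = y' ∧ h = h' := by
  refine ⟨funext fun i => ?_, funext fun i => ?_⟩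
  · rw [← getElem_interleave_even y h i, ← getElem_interleave_even y' h' i]
    simp only [he]
  · rw [← getElem_interleave_odd y h i, ← getElem_interleave_odd y' h' i]
    simp only [he]

lemma mem_interleave {y h : Fin m → V} {v : V} :
    v ∈ interleave y h ↔ (∃ i, y i = v) ∨ ∃ i, h i = v := by
  constructor
  · intro hv
    rw [interleave, List.mem_ofFn] at hv
    obtain ⟨j, rfl⟩ := hv
    split_ifs
    · exact Or.inl ⟨_, rfl⟩
    · exact Or.inr ⟨_, rfl⟩
  · rintro (⟨i, rfl⟩ | ⟨i, rfl⟩)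
    · rw [← getElem_interleave_even y h i]; exact List.getElem_mem _
    · rw [← getElem_interleave_odd y h i]; exact List.getElem_mem _

lemma closedList_interleave (hm : 0 < m) {y h : Fin m → V} (hy : Function.Injective y)
    (hh : Function.Injective h) (hyh : ∀ i j, y i ≠ h j) (h1 : ∀ i, G.Adj (y i) (h i))
    (h2 : ∀ i : Fin m, G.Adj (h i) (y ⟨(i + 1) % m, Nat.mod_lt _ hm⟩)) :
    ClosedList G (interleave y h) := by
  refine ⟨y ⟨0, hm⟩, h ⟨m - 1, by omega⟩, ⟨?_, ?_, ?_, ?_⟩, ?_⟩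
  · rw [interleave, List.nodup_ofFn]
    intro i j hij
    dsimp only at hij
    split_ifs at hij
    · have := hy hij
      simp only [Fin.mk.injEq] at this
      ext; omega
    · exact (hyh _ _ hij).elim
    · exact (hyh _ _ hij.symm).elim
    · have := hh hij
      simp only [Fin.mk.injEq] at this
      ext; omega
  · rw [List.isChain_iff_getElem]
    intro i hi
    rw [length_interleave] at hi
    obtain ⟨j, rfl | rfl⟩ := Nat.even_or_odd' i
    · have := h1 ⟨j, by omega⟩
      rwa [← getElem_interleave_even y h, ← getElem_interleave_odd y h] at this
    · have := h2 ⟨j, by omega⟩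
      have e : (j + 1) % m = j + 1 := Nat.mod_eq_of_lt (by omega)
      rw [← getElem_interleave_even y h, ← getElem_interleave_odd y h] at this
      simp only [e] at this
      exact this
  · rw [List.head?_eq_getElem?, List.getElem?_eq_getElem (by simp; omega)]
    rw [← getElem_interleave_even y h]
    simp
  · rw [List.getLast?_eq_getElem?, List.getElem?_eq_getElem (by simp; omega)]
    rw [← getElem_interleave_odd y h]
    simp only [length_interleave]
    congr 2
    omega
  · have := h2 ⟨m - 1, by omega⟩
    have e : (m - 1 + 1) % m = 0 := by rw [Nat.sub_add_cancel hm]; simp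
    simp only [e] at this
    exact this

lemma exists_alternating (hm : 0 < m) (T : Finset (Fin m → V)) (H : Finset V) (q : ℕ)
    (hT : ∀ y ∈ T, Function.Injective y ∧ (∀ i, y i ∉ H) ∧ ∀ i : Fin m,
      i + q ≤ #({v ∈ H | G.Adj (y i) v ∧ G.Adj v (y ⟨(i + 1) % m, Nat.mod_lt _ hm⟩)})) :
    ∃ S : Finset (List V), (∀ L ∈ S, ClosedList G L ∧ L.length = 2 * m ∧
      ∃ y ∈ T, (∀ i, y i ∈ L) ∧ ∀ v ∈ L, v ∈ H ∨ ∃ i, y i = v) ∧ #T * q ^ m ≤ #S := by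
  have hex : ∀ y : T, ∃ S : Finset (Fin m → V), (∀ g ∈ S, Function.Injective g ∧ ∀ i : Fin m,
      g i ∈ H ∧ G.Adj (y.1 i) (g i) ∧ G.Adj (g i) (y.1 ⟨(i + 1) % m, Nat.mod_lt _ hm⟩)) ∧
        q ^ m ≤ #S := by
    rintro ⟨y, hy⟩
    obtain ⟨-, -, h3⟩ := hT y hy
    obtain ⟨S, hS, hc⟩ := exists_finset_injective
      (fun i => if hi : i < m then ({v ∈ H | G.Adj (y ⟨i, hi⟩) v ∧
        G.Adj v (y ⟨(i + 1) % m, Nat.mod_lt _ hm⟩)} : Finset V) else ∅) q m (by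
          intro i hi
          rw [dif_pos hi]
          exact h3 ⟨i, hi⟩)
    refine ⟨S, fun g hg => ⟨(hS g hg).1, fun i => ?_⟩, hc⟩
    have := (hS g hg).2 i
    rw [dif_pos i.2, mem_filter] at this
    exact this
  choose S hS hc using hex
  refine ⟨(univ.sigma S).image fun p => interleave p.1.1 p.2, ?_, ?_⟩
  · intro L hL
    simp only [mem_image, mem_sigma, mem_univ, true_and] at hL
    obtain ⟨⟨⟨y, hy⟩, g⟩, hg, rfl⟩ := hL
    obtain ⟨h1, h2⟩ := hS _ _ hg
    obtain ⟨h3, h4, -⟩ := hT y hy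
    refine ⟨closedList_interleave hm h3 h1 ?_ (fun i => (h2 i).2.1) (fun i => (h2 i).2.2),
      by simp, y, hy, fun i => mem_interleave.2 (Or.inl ⟨i, rfl⟩), ?_⟩
    · intro i j hij
      dsimp only at hij
      exact h4 i (hij ▸ (h2 j).1)
    · intro v hv
      rcases mem_interleave.1 hv with ⟨i, rfl⟩ | ⟨i, rfl⟩
      · exact Or.inr ⟨i, rfl⟩
      · exact Or.inl (h2 i).1
  · rw [card_image_of_injective, card_sigma]
    · calc #T * q ^ m = ∑ y : T, q ^ m := by simp
        _ ≤ _ := sum_le_sum fun y _ => hc y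
    · rintro ⟨y, g⟩ ⟨y', g'⟩ h
      obtain ⟨h1, h2⟩ := interleave_inj h
      have := Subtype.ext h1
      subst this
      dsimp only at h2
      rw [h2]

end

section
open scoped Classical
variable {V : Type*} {G : SimpleGraph V} {m n q t d : ℕ}

lemma pow_self_le_factorial_mul (n : ℕ) : n ^ n ≤ n.factorial * 4 ^ n := by
  have h1 := Real.pow_div_factorial_le_exp (n : ℝ) (by positivity) n
  have h2 : Real.exp (n : ℝ) ≤ 4 ^ n := by
    rw [← Real.exp_one_pow]
    gcongr
    linarith [Real.exp_one_lt_d9]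
  have h3 : (n : ℝ) ^ n ≤ n.factorial * 4 ^ n := by
    rw [div_le_iff₀ (by positivity)] at h1
    nlinarith [h1, h2, (by positivity : (0 : ℝ) < n.factorial)]
  exact_mod_cast h3

lemma factorial_le_two_pow_mul (h : t ≤ m) :
    m.factorial ≤ 2 ^ m * (t.factorial * (m - t).factorial) := by
  rw [← Nat.choose_mul_factorial_mul_factorial h, mul_assoc]
  exact Nat.mul_le_mul_right _ (Nat.choose_le_two_pow _ _)

lemma card_filter_le_add (H : Finset V) (P Q : V → Prop) :
    #{v ∈ H | P v} ≤ #{v ∈ H | P v ∧ Q v} + #{v ∈ H | ¬ Q v} := by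
  refine (card_le_card ?_).trans (card_union_le _ _)
  intro v hv
  simp only [mem_union, mem_filter] at hv ⊢
  tauto

lemma card_odd_lt (h : 2 * t < m) :
    Fintype.card {i : Fin m // i.1 % 2 = 1 ∧ i.1 < 2 * t} = t := by
  refine (Fintype.card_of_bijective
    (f := fun j : Fin t => ⟨⟨2 * j.1 + 1, by omega⟩, by dsimp only; omega⟩)
    ⟨?_, ?_⟩).symm.trans (Fintype.card_fin t)
  · intro i j hij
    simp only [Subtype.mk.injEq, Fin.mk.injEq] at hij
    ext; omega
  · rintro ⟨⟨i, hi⟩, h1, h2⟩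
    dsimp only at h1 h2
    refine ⟨⟨i / 2, by omega⟩, ?_⟩
    simp only [Subtype.mk.injEq, Fin.mk.injEq]
    omega

lemma exists_orderings {Y E : Finset V} (hYE : Disjoint Y E) (hE : #E = t)
    (hY : #Y + t = m) (ht : 2 * t < m) : ∃ T : Finset (Fin m → V), (∀ y ∈ T,
      Function.Injective y ∧ (∀ i : Fin m, i.1 % 2 = 1 ∧ i.1 < 2 * t → y i ∈ E) ∧
      (∀ i : Fin m, ¬ (i.1 % 2 = 1 ∧ i.1 < 2 * t) → y i ∈ Y) ∧ ∀ e ∈ E, ∃ i, y i = e) ∧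
      t.factorial * (m - t).factorial ≤ #T := by
  let p : Fin m → Prop := fun i => i.1 % 2 = 1 ∧ i.1 < 2 * t
  have hp : Fintype.card {i // p i} = t := card_odd_lt ht
  have hp' : Fintype.card {i // ¬ p i} = m - t := by
    rw [Fintype.card_subtype_compl, hp, Fintype.card_fin]
  let e1 : {i // p i} ≃ E := Fintype.equivOfCardEq (by rw [hp]; simp [hE])
  let e2 : {i // ¬ p i} ≃ Y := Fintype.equivOfCardEq (by rw [hp']; simp; omega)
  let F : ({i // p i} ≃ E) × ({i // ¬ p i} ≃ Y) → Fin m → V := fun e i =>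
    if h : p i then (e.1 ⟨i, h⟩).1 else (e.2 ⟨i, h⟩).1
  refine ⟨univ.image F, ?_, ?_⟩
  · intro y hy
    simp only [mem_image, mem_univ, true_and] at hy
    obtain ⟨⟨a, b⟩, rfl⟩ := hy
    have hF1 : ∀ i (h : p i), F (a, b) i = (a ⟨i, h⟩).1 := fun i h => dif_pos h
    have hF2 : ∀ i (h : ¬ p i), F (a, b) i = (b ⟨i, h⟩).1 := fun i h => dif_neg h
    have hne : ∀ i j, p i → ¬ p j → F (a, b) i ≠ F (a, b) j := by
      intro i j hi hj
      rw [hF1 i hi, hF2 j hj]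
      exact fun h => Finset.disjoint_left.1 hYE (b ⟨j, hj⟩).2 (h ▸ (a ⟨i, hi⟩).2)
    refine ⟨?_, ?_, ?_, ?_⟩
    · intro i j hij
      by_cases hi : p i <;> by_cases hj : p j
      · rw [hF1 i hi, hF1 j hj] at hij
        simpa using a.injective (Subtype.ext hij)
      · exact (hne i j hi hj hij).elim
      · exact (hne j i hj hi hij.symm).elim
      · rw [hF2 i hi, hF2 j hj] at hij
        simpa using b.injective (Subtype.ext hij)
    · intro i hi
      rw [hF1 i hi]
      exact (a ⟨i, hi⟩).2
    · intro i hi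
      rw [hF2 i hi]
      exact (b ⟨i, hi⟩).2
    · intro e he
      refine ⟨(a.symm ⟨e, he⟩).1, ?_⟩
      rw [hF1 _ (a.symm ⟨e, he⟩).2]
      simp
  · rw [card_image_of_injective]
    · rw [card_univ, Fintype.card_prod, Fintype.card_equiv e1, Fintype.card_equiv e2, hp, hp']
    · rintro ⟨a, b⟩ ⟨a', b'⟩ h
      refine Prod.ext (Equiv.ext ?_) (Equiv.ext ?_)
      · rintro ⟨i, hi⟩
        have := congrFun h i
        simp only [F, dif_pos hi] at this
        exact Subtype.ext this
      · rintro ⟨i, hi⟩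
        have := congrFun h i
        simp only [F, dif_neg hi] at this
        exact Subtype.ext this

lemma exists_alternating_of_core {Y E H : Finset V} {r : ℕ} (hYE : Disjoint Y E)
    (hYH : Disjoint Y H) (hEH : Disjoint E H) (hd : ∀ y ∈ Y, #{v ∈ H | ¬ G.Adj y v} ≤ d)
    (hr : ∀ e ∈ E, r ≤ #{v ∈ H | G.Adj e v}) (hE : #E = t) (hY : #Y + t = m) (ht : 2 * t < m)
    (hdr : d + 2 * t + q ≤ r) (hH : 2 * d + m + q ≤ #H) :
    ∃ S : Finset (List V), (∀ L ∈ S, ClosedList G L ∧ L.length = 2 * m ∧ (∀ e ∈ E, e ∈ L) ∧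
      ∀ v ∈ L, v ∈ H ∨ v ∈ Y ∨ v ∈ E) ∧
      t.factorial * (m - t).factorial * q ^ m ≤ #S := by
  obtain ⟨T, hT, hTc⟩ := exists_orderings hYE hE hY ht
  have hm : 0 < m := by omega
  have hmem : ∀ y ∈ T, ∀ i, y i ∈ Y ∨ y i ∈ E := by
    intro y hy i
    obtain ⟨-, h2, h3, -⟩ := hT y hy
    by_cases h : i.1 % 2 = 1 ∧ i.1 < 2 * t
    · exact Or.inr (h2 i h)
    · exact Or.inl (h3 i h)
  obtain ⟨S, hS, hSc⟩ := exists_alternating (G := G) hm T H q (by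
    intro y hy
    obtain ⟨h1, h2, h3, h4⟩ := hT y hy
    refine ⟨h1, ?_, ?_⟩
    · intro i hi
      rcases hmem y hy i with h | h
      · exact Finset.disjoint_left.1 hYH h hi
      · exact Finset.disjoint_left.1 hEH h hi
    · intro i
      set i' : Fin m := ⟨(i + 1) % m, Nat.mod_lt _ hm⟩ with hi'
      have hcase : i.1 + 1 < m ∧ i'.1 = i.1 + 1 ∨ i.1 + 1 = m ∧ i'.1 = 0 := by
        by_cases h : i.1 + 1 < m
        · exact Or.inl ⟨h, Nat.mod_eq_of_lt h⟩
        · have : i.1 + 1 = m := by omega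
          exact Or.inr ⟨this, by simp [hi', this]⟩
      have k1 := card_filter_le_add H (fun v => G.Adj (y i) v) (fun v => G.Adj v (y i'))
      have k2 := card_filter_le_add H (fun v => G.Adj v (y i')) (fun v => G.Adj (y i) v)
      have k3 : #{v ∈ H | G.Adj (y i) v} + #{v ∈ H | ¬ G.Adj (y i) v} = #H :=
        card_filter_add_card_filter_not _
      have s1 : #{v ∈ H | ¬ G.Adj v (y i')} = #{v ∈ H | ¬ G.Adj (y i') v} := by
        simp only [G.adj_comm]
      have s2 : #{v ∈ H | G.Adj v (y i')} = #{v ∈ H | G.Adj (y i') v} := by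
        simp only [G.adj_comm]
      have s3 : #{v ∈ H | G.Adj v (y i') ∧ G.Adj (y i) v} =
          #{v ∈ H | G.Adj (y i) v ∧ G.Adj v (y i')} := by
        simp only [and_comm]
      by_cases hi : i.1 % 2 = 1 ∧ i.1 < 2 * t
      · have j1 := hr _ (h2 i hi)
        have j2 := hd _ (h3 i' (by omega))
        omega
      · have j1 := hd _ (h3 i hi)
        by_cases hj : i'.1 % 2 = 1 ∧ i'.1 < 2 * t
        · have j2 := hr _ (h2 i' hj)
          omega
        · have j2 := hd _ (h3 i' hj)
          omega)
  refine ⟨S, ?_, (Nat.mul_le_mul_right _ hTc).trans hSc⟩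
  intro L hL
  obtain ⟨h1, h2, y, hy, h3, h4⟩ := hS L hL
  refine ⟨h1, h2, ?_, ?_⟩
  · intro e he
    obtain ⟨i, rfl⟩ := (hT y hy).2.2.2 e he
    exact h3 i
  · intro v hv
    rcases h4 v hv with h | ⟨i, rfl⟩
    · exact Or.inl h
    · exact Or.inr (hmem y hy i)

/-- Insert `v` after position `i`. -/
def insertAfter (L : List V) (v : V) (i : ℕ) : List V := L.take (i + 1) ++ v :: L.drop (i + 1)

lemma insertAfter_perm (L : List V) (v : V) (i : ℕ) : (insertAfter L v i).Perm (v :: L) := by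
  refine List.perm_middle.trans ?_
  rw [List.take_append_drop]

lemma ClosedList.insertAfter {L : List V} (h : ClosedList G L) {v : V} {i : ℕ} (hv : v ∉ L)
    (hi : i + 1 < L.length) (h1 : G.Adj L[i] v) (h2 : G.Adj v L[i + 1]) :
    ClosedList G (insertAfter L v i) := by
  obtain ⟨a, b, hp, hba⟩ := h
  refine ⟨a, b, ⟨?_, ?_, ?_, ?_⟩, hba⟩
  · rw [(insertAfter_perm L v i).nodup_iff]
    exact List.nodup_cons.2 ⟨hv, hp.nodup⟩
  · have hc := hp.chain
    rw [← List.take_append_drop (i + 1) L, List.isChain_append] at hc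
    refine List.isChain_append.2 ⟨hc.1, List.isChain_cons.2 ⟨?_, hc.2.1⟩, ?_⟩
    · intro y hy
      rw [List.head?_drop, List.getElem?_eq_getElem hi] at hy
      simp only [Option.mem_def, Option.some.injEq] at hy
      rwa [← hy]
    · intro x hx y hy
      rw [List.getLast?_take] at hx
      simp only [List.head?_cons, Option.mem_def, Option.some.injEq] at hy
      subst hy
      rw [if_neg (by omega), Nat.add_sub_cancel,
        List.getElem?_eq_getElem (by omega)] at hx
      simp only [Option.some_or, Option.mem_def, Option.some.injEq] at hx
      rwa [← hx]
  · have := hp.head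
    rw [CycleRamsey.insertAfter, List.head?_append, List.head?_take]
    simp [this]
  · have := hp.last
    rw [CycleRamsey.insertAfter, List.getLast?_append, List.getLast?_cons, List.getLast?_drop,
      if_neg (by omega), this]
    simp

lemma card_le_card_slots {Z : Finset V} {L : List V} {v : V} {b j : ℕ} (hL : L.Nodup)
    (hLZ : ∀ u ∈ L, u ∈ Z) (hj : L.length = j) (hb : #{u ∈ Z | ¬ G.Adj v u} ≤ b)
    (hq : 2 * b + q + 1 ≤ j) :
    q ≤ #{i ∈ range (j - 1) | ∀ h : i + 1 < L.length, G.Adj L[i] v ∧ G.Adj v L[i + 1]} := by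
  have key : ∀ s, s ≤ 1 →
      #{i ∈ range (j - 1) | ∃ h : i + s < L.length, ¬ G.Adj v L[i + s]} ≤ b := by
    intro s hs
    refine (card_le_card_of_injOn
      (fun i => if h : i + s < L.length then L[i + s] else v) ?_ ?_).trans hb
    · intro i hi
      simp only [coe_filter, Set.mem_ofPred_eq] at hi ⊢
      obtain ⟨-, h, h'⟩ := hi
      rw [dif_pos h]
      exact ⟨hLZ _ (List.getElem_mem _), h'⟩
    · intro i hi i' hi' he
      simp only [coe_filter, Set.mem_ofPred_eq] at hi hi'
      obtain ⟨-, h, -⟩ := hi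
      obtain ⟨-, h', -⟩ := hi'
      simp only [dif_pos h, dif_pos h'] at he
      have := (List.Nodup.getElem_inj_iff hL).1 he
      omega
  have h0 := key 0 (by omega)
  have h1 := key 1 le_rfl
  have hsub : range (j - 1) ⊆
      ({i ∈ range (j - 1) | ∀ h : i + 1 < L.length, G.Adj L[i] v ∧ G.Adj v L[i + 1]} :
        Finset ℕ) ∪ (({i ∈ range (j - 1) | ∃ h : i + 0 < L.length, ¬ G.Adj v L[i + 0]} :
        Finset ℕ) ∪ ({i ∈ range (j - 1) | ∃ h : i + 1 < L.length, ¬ G.Adj v L[i + 1]} :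
        Finset ℕ)) := by
    intro i hi
    have hi2 := mem_range.1 hi
    simp only [mem_union, mem_filter, hi, true_and]
    by_contra hcon
    push Not at hcon
    obtain ⟨⟨h, ha⟩, hb, hc⟩ := hcon
    exact ha (hb (by omega)).symm (hc h)
  have := (card_le_card hsub).trans ((card_union_le _ _).trans
    (Nat.add_le_add_left (card_union_le _ _) _))
  rw [card_range] at this
  omega

lemma exists_insertions {Z E : Finset V} {j b : ℕ} (S : Finset (List V))
    (hS : ∀ L ∈ S, ClosedList G L ∧ L.length = j ∧ (∀ e ∈ E, e ∈ L) ∧ ∀ v ∈ L, v ∈ Z)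
    (hb : ∀ v ∈ Z, v ∉ E → #{u ∈ Z | ¬ G.Adj v u} ≤ b) (hq : 2 * b + q + 1 ≤ j) :
    ∃ S' : Finset (List V),
      (∀ L ∈ S', ClosedList G L ∧ L.length = j + 1 ∧ (∀ e ∈ E, e ∈ L) ∧ ∀ v ∈ L, v ∈ Z) ∧
      #S * ((#Z - j) * q) ≤ #S' * j := by
  let I : List V → V → Finset ℕ := fun L v =>
    {i ∈ range (j - 1) | ∀ h : i + 1 < L.length, G.Adj L[i] v ∧ G.Adj v L[i + 1]}
  let T : Finset (Σ _ : List V, Σ _ : V, ℕ) :=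
    S.sigma fun L => (Z \ L.toFinset).sigma fun v => I L v
  have hT : ∀ p ∈ T, p.1 ∈ S ∧ p.2.1 ∈ Z ∧ p.2.1 ∉ p.1 ∧ p.2.2 + 1 < j ∧
      ∀ h : p.2.2 + 1 < p.1.length, G.Adj p.1[p.2.2] p.2.1 ∧ G.Adj p.2.1 p.1[p.2.2 + 1] := by
    intro p hp
    simp only [T, I, mem_sigma, mem_sdiff, List.mem_toFinset, mem_filter, mem_range] at hp
    obtain ⟨h1, ⟨h2, h3⟩, h4, h5⟩ := hp
    exact ⟨h1, h2, h3, by omega, h5⟩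
  refine ⟨T.image fun p => insertAfter p.1 p.2.1 p.2.2, ?_, ?_⟩
  · intro L hL
    obtain ⟨⟨L, v, i⟩, hp, rfl⟩ := mem_image.1 hL
    obtain ⟨h1, h2, h3, h4, h5⟩ := hT _ hp
    dsimp only at h1 h2 h3 h4 h5 ⊢
    obtain ⟨g1, g2, g3, g4⟩ := hS L h1
    have hperm := insertAfter_perm L v i
    obtain ⟨h5, h6⟩ := h5 (by omega)
    refine ⟨g1.insertAfter h3 (by omega) h5 h6, ?_, ?_, ?_⟩
    · rw [hperm.length_eq, List.length_cons, g2]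
    · intro e he
      rw [hperm.mem_iff]
      exact List.mem_cons_of_mem _ (g3 e he)
    · intro u hu
      rw [hperm.mem_iff, List.mem_cons] at hu
      rcases hu with rfl | hu
      · exact h2
      · exact g4 u hu
  · have hTc : #S * ((#Z - j) * q) ≤ #T := by
      rw [card_sigma, ← smul_eq_mul, ← sum_const]
      refine sum_le_sum fun L hL => ?_
      obtain ⟨⟨a, b', g1, -⟩, g2, g3, g4⟩ := hS L hL
      rw [card_sigma]
      have hc : #L.toFinset = j := by rw [List.toFinset_card_of_nodup g1.nodup, g2]
      have hc' : #Z - j ≤ #(Z \ L.toFinset) := by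
        have := le_card_sdiff L.toFinset Z
        omega
      refine (Nat.mul_le_mul_right _ hc').trans ?_
      rw [← smul_eq_mul, ← sum_const]
      refine sum_le_sum fun v hv => ?_
      simp only [mem_sdiff, List.mem_toFinset] at hv
      exact card_le_card_slots g1.nodup g4 g2 (hb v hv.1 fun he => hv.2 (g3 v he)) hq
    refine hTc.trans ?_
    rw [← card_range j, ← card_product]
    refine card_le_card_of_injOn (fun p => (insertAfter p.1 p.2.1 p.2.2, p.2.2)) ?_ ?_
    · intro p hp
      simp only [coe_product, Set.mem_prod, mem_coe, mem_range]
      exact ⟨mem_image_of_mem _ hp, by have := (hT p hp).2.2.2.1; omega⟩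
    · rintro ⟨L, v, i⟩ hp ⟨L', v', i'⟩ hp' h
      simp only [Prod.mk.injEq] at h
      obtain ⟨h, rfl⟩ := h
      have e1 := (hT _ hp)
      have e2 := (hT _ hp')
      dsimp only at e1 e2
      have l1 := (hS _ e1.1).2.1
      have l2 := (hS _ e2.1).2.1
      unfold CycleRamsey.insertAfter at h
      obtain ⟨h1, h2⟩ := List.append_inj h (by simp; omega)
      simp only [List.cons.injEq] at h2
      obtain ⟨rfl, h2⟩ := h2
      have : L = L' := by
        rw [← List.take_append_drop (i + 1) L, h1, h2, List.take_append_drop]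
      subst this
      rfl

lemma exists_iterated_insertions {Z E : Finset V} {j b : ℕ} (S : Finset (List V))
    (hS : ∀ L ∈ S, ClosedList G L ∧ L.length = j ∧ (∀ e ∈ E, e ∈ L) ∧ ∀ v ∈ L, v ∈ Z)
    (hb : ∀ v ∈ Z, v ∉ E → #{u ∈ Z | ¬ G.Adj v u} ≤ b) (hq : 2 * b + q + 1 ≤ j) (k : ℕ)
    (hk : j + k ≤ #Z) :
    ∃ S' : Finset (List V),
      (∀ L ∈ S', ClosedList G L ∧ L.length = j + k ∧ (∀ e ∈ E, e ∈ L) ∧ ∀ v ∈ L, v ∈ Z) ∧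
      #S * ((#Z - j).descFactorial k * q ^ k) ≤ #S' * #Z ^ k := by
  induction k with
  | zero => exact ⟨S, hS, by simp⟩
  | succ k ih =>
    obtain ⟨S₁, hS₁, hc₁⟩ := ih (by omega)
    obtain ⟨S₂, hS₂, hc₂⟩ := exists_insertions S₁ hS₁ hb (q := q) (by omega)
    refine ⟨S₂, hS₂, ?_⟩
    rw [Nat.descFactorial_succ, Nat.sub_sub, pow_succ, pow_succ]
    calc #S * ((#Z - (j + k)) * (#Z - j).descFactorial k * (q ^ k * q))
        = #S * ((#Z - j).descFactorial k * q ^ k) * ((#Z - (j + k)) * q) := by ring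
      _ ≤ #S₁ * #Z ^ k * ((#Z - (j + k)) * q) := Nat.mul_le_mul_right _ hc₁
      _ = #S₁ * ((#Z - (j + k)) * q) * #Z ^ k := by ring
      _ ≤ #S₂ * (j + k) * #Z ^ k := Nat.mul_le_mul_right _ hc₂
      _ ≤ #S₂ * #Z * #Z ^ k := by gcongr; omega
      _ = _ := by ring

end

section
open scoped Classical
variable {V : Type*} [Finite V] {G F F' : SimpleGraph V} {m n q t d : ℕ}

lemma pow_le_factorial (h : 4 * q ≤ n) : q ^ n ≤ n.factorial := by
  have h1 := pow_self_le_factorial_mul n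
  have h2 : (4 * q) ^ n ≤ n ^ n := Nat.pow_le_pow_left h n
  rw [mul_pow, mul_comm] at h2
  exact Nat.le_of_mul_le_mul_right (h2.trans h1) (by positivity)

lemma pow_le_cycNum_of_clique {A E : Finset V} (hAE : Disjoint A E) (hA : #A + t = 2 * n)
    (hE : #E = t) (hd : ∀ a ∈ A, #{v ∈ A | ¬ G.Adj a v} ≤ q)
    (hr : ∀ e ∈ E, 20 * q ≤ #{v ∈ A | G.Adj e v}) (ht : t ≤ q) (hq : 1 ≤ q)
    (hn : 20 * q ≤ n) : q ^ (4 * n) ≤ cycNum G (2 * n) * (2 * n) ^ (2 * n) := by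
  obtain ⟨A₁, hA₁, hc₁⟩ := exists_subset_card_eq (s := A) (n := 4 * q - t) (by omega)
  have hH : #(A \ A₁) + (4 * q - t) = #A := by
    rw [← hc₁]
    exact card_sdiff_add_card_eq_card hA₁
  obtain ⟨S, hS, hSc⟩ := exists_alternating_of_core (G := G) (Y := A₁) (E := E) (H := A \ A₁)
    (d := q) (q := q) (t := t) (m := 4 * q) (r := 16 * q)
    (disjoint_of_subset_left hA₁ hAE) disjoint_sdiff
    (disjoint_of_subset_right sdiff_subset hAE.symm)
    (fun y hy => (card_le_card (filter_subset_filter _ sdiff_subset)).trans (hd y (hA₁ hy)))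
    (fun e he => by
      have h1 := hr e he
      have h2 : #{v ∈ A | G.Adj e v} ≤ #{v ∈ A \ A₁ | G.Adj e v} + #A₁ := by
        refine (card_le_card ?_).trans (card_union_le _ _)
        intro v hv
        simp only [mem_union, mem_filter, mem_sdiff] at hv ⊢
        tauto
      omega) hE (by omega) (by omega) (by omega) (by omega)
  have hZ : #(A ∪ E) = 2 * n := by rw [card_union_of_disjoint hAE]; omega
  obtain ⟨S', hS', hSc'⟩ := exists_iterated_insertions (G := G) (Z := A ∪ E) (E := E) (j := 8 * q)
    (b := 2 * q) (q := q) S (by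
      intro L hL
      obtain ⟨h1, h2, h3, h4⟩ := hS L hL
      refine ⟨h1, by omega, h3, fun v hv => ?_⟩
      rcases h4 v hv with h | h | h
      · exact mem_union_left _ (mem_sdiff.1 h).1
      · exact mem_union_left _ (hA₁ h)
      · exact mem_union_right _ h) (by
      intro v hv hvE
      have hvA : v ∈ A := by simpa [hvE] using hv
      have h1 := hd v hvA
      have h2 : #{u ∈ A ∪ E | ¬ G.Adj v u} ≤ #{u ∈ A | ¬ G.Adj v u} + #E := by
        refine (card_le_card ?_).trans (card_union_le _ _)
        intro v hv
        simp only [mem_union, mem_filter] at hv ⊢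
        tauto
      omega) (by omega) (2 * n - 8 * q) (by omega)
  have : NeZero (2 * n) := ⟨by omega⟩
  have hC : #S' ≤ cycNum G (2 * n) := card_le_cycNum S' fun L hL => by
    obtain ⟨h1, h2, -⟩ := hS' L hL
    exact ⟨h1, by omega⟩
  rw [hZ, Nat.descFactorial_self] at hSc'
  set k := 2 * n - 8 * q with hk
  have e1 : (4 * q).factorial ≤ 2 ^ (4 * q) * (t.factorial * (4 * q - t).factorial) :=
    factorial_le_two_pow_mul (by omega)
  have e2 : q ^ (4 * q) ≤ (4 * q).factorial := pow_le_factorial le_rfl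
  have e3 : q ^ k ≤ k.factorial := pow_le_factorial (by omega)
  set a := t.factorial * (4 * q - t).factorial
  calc q ^ (4 * n) = q ^ (4 * q) * q ^ (4 * q) * q ^ (8 * q) * (q ^ k * q ^ k) := by
        rw [← pow_add, ← pow_add, ← pow_add, ← pow_add]; congr 1; omega
    _ ≤ (2 ^ (4 * q) * a) * q ^ (4 * q) * q ^ (8 * q) * (k.factorial * q ^ k) := by
        gcongr
        exact e2.trans e1
    _ = 2 ^ (4 * q) * q ^ (8 * q) * (a * q ^ (4 * q) * (k.factorial * q ^ k)) := by ring
    _ ≤ 2 ^ (4 * q) * q ^ (8 * q) * (cycNum G (2 * n) * (2 * n) ^ k) := by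
        refine Nat.mul_le_mul_left _ ?_
        refine (Nat.mul_le_mul_right _ hSc).trans (hSc'.trans ?_)
        exact Nat.mul_le_mul_right _ hC
    _ ≤ (2 * n) ^ (8 * q) * (cycNum G (2 * n) * (2 * n) ^ k) := by
        refine Nat.mul_le_mul_right _ ?_
        calc 2 ^ (4 * q) * q ^ (8 * q) ≤ 2 ^ (8 * q) * q ^ (8 * q) := by
              gcongr
              · norm_num
              · omega
          _ = (2 * q) ^ (8 * q) := (mul_pow _ _ _).symm
          _ ≤ _ := by gcongr; omega
    _ = cycNum G (2 * n) * (2 * n) ^ (2 * n) := by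
        rw [mul_left_comm, ← pow_add]; congr 2; omega

lemma pow_le_cycNum_of_bipartite {Y E H : Finset V} {r : ℕ} (hYE : Disjoint Y E)
    (hYH : Disjoint Y H) (hEH : Disjoint E H) (hd : ∀ y ∈ Y, #{v ∈ H | ¬ G.Adj y v} ≤ d)
    (hr : ∀ e ∈ E, r ≤ #{v ∈ H | G.Adj e v}) (hE : #E = t) (hY : #Y + t = n) (ht : 2 * t < n)
    (hdr : d + 2 * t + q ≤ r) (hH : 2 * d + n + q ≤ #H) (hn : 4 * q ≤ n) :
    q ^ (4 * n) ≤ cycNum G (2 * n) * (2 * n) ^ (2 * n) := by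
  obtain ⟨S, hS, hSc⟩ := exists_alternating_of_core hYE hYH hEH hd hr hE hY ht hdr hH
  have : NeZero (2 * n) := ⟨by omega⟩
  have hC : #S ≤ cycNum G (2 * n) := card_le_cycNum S fun L hL => by
    obtain ⟨h1, h2, -⟩ := hS L hL
    exact ⟨h1, by omega⟩
  have e1 : n.factorial ≤ 2 ^ n * (t.factorial * (n - t).factorial) :=
    factorial_le_two_pow_mul (by omega)
  have e2 : q ^ n ≤ n.factorial := pow_le_factorial hn
  set a := t.factorial * (n - t).factorial
  calc q ^ (4 * n) = q ^ n * q ^ n * q ^ (2 * n) := by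
        rw [← pow_add, ← pow_add]; congr 1; omega
    _ ≤ (2 ^ n * a) * q ^ n * q ^ (2 * n) := by
        gcongr
        exact e2.trans e1
    _ = (a * q ^ n) * (2 ^ n * q ^ (2 * n)) := by ring
    _ ≤ cycNum G (2 * n) * (2 * n) ^ (2 * n) := by
        refine Nat.mul_le_mul (hSc.trans hC) ?_
        rw [mul_pow]
        gcongr
        · norm_num
        · omega
        · omega

lemma pow_le_cycNum_of_large_almost_clique [Fintype V] (hF : ∀ u v, u ≠ v → F.Adj u v ∨ F'.Adj u v)
    (hV : 3 * n - 1 = Fintype.card V) {A : Finset V} (hA : #A + t = 2 * n) (ht : t ≤ q)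
    (hd : ∀ a ∈ A, #{v ∈ A | ¬ F.Adj a v} ≤ q) (hq : 1 ≤ q) (hn : 100 * q ≤ n) :
    q ^ (4 * n) ≤ cycNum F (2 * n) * (2 * n) ^ (2 * n) ∨
      q ^ (4 * n) ≤ cycNum F' (2 * n) * (2 * n) ^ (2 * n) := by
  let Y : Finset V := {v | v ∉ A ∧ #{u ∈ A | ¬ F'.Adj v u} ≤ 20 * q}
  have hYA : Disjoint Y A := by
    rw [Finset.disjoint_left]
    intro v hv
    exact (mem_filter.1 hv).2.1
  by_cases hY : n ≤ #Y
  · right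
    obtain ⟨Y', hY', hc⟩ := exists_subset_card_eq hY
    exact pow_le_cycNum_of_bipartite (G := F') (Y := Y') (E := ∅) (H := A) (d := 20 * q) (t := 0)
      (r := 22 * q) (disjoint_empty_right _) (disjoint_of_subset_left hY' hYA)
      (disjoint_empty_left _) (fun y hy => (mem_filter.1 (hY' hy)).2.2) (by simp) rfl (by omega)
      (by omega) (by omega) (by omega) (by omega)
  · left
    have hc : t ≤ #((univ \ A) \ Y) := by
      have h1 := le_card_sdiff Y (univ \ A)
      have h2 := le_card_sdiff A univ
      rw [card_univ] at h2
      omega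
    obtain ⟨E, hE, hEc⟩ := exists_subset_card_eq hc
    refine pow_le_cycNum_of_clique (A := A) (E := E) ?_ hA hEc hd ?_ ht hq (by omega)
    · rw [Finset.disjoint_right]
      intro v hv
      have := hE hv
      simp only [mem_sdiff] at this
      exact this.1.2
    · intro e he
      have h1 := hE he
      simp only [mem_sdiff, mem_univ, true_and, Y, mem_filter, not_and, not_le] at h1
      refine (h1.2 h1.1).le.trans (card_le_card ?_)
      intro v hv
      simp only [mem_filter] at hv ⊢
      refine ⟨hv.1, (hF e v ?_).resolve_right hv.2⟩
      rintro rfl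
      exact h1.1 hv.1

lemma pow_le_cycNum_of_large_almost_biclique [Fintype V]
    (hF : ∀ u v, u ≠ v → F.Adj u v ∨ F'.Adj u v) (hV : 3 * n - 1 = Fintype.card V)
    {X H : Finset V} (hXH : Disjoint X H) (hX : #X + t = n) (hH : 2 * n ≤ #H + t) (ht : t ≤ q)
    (hd : ∀ x ∈ X, #{v ∈ H | ¬ F.Adj x v} ≤ q) (hq : 1 ≤ q) (hn : 1000 * q ≤ n) :
    q ^ (4 * n) ≤ cycNum F (2 * n) * (2 * n) ^ (2 * n) ∨
      q ^ (4 * n) ≤ cycNum F' (2 * n) * (2 * n) ^ (2 * n) := by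
  let Y : Finset V := {v | 20 * q ≤ #{u ∈ H | F.Adj v u}}
  have hXY : X ⊆ Y := by
    intro x hx
    simp only [Y, mem_filter, mem_univ, true_and]
    have h1 := hd x hx
    have h2 : #{v ∈ H | F.Adj x v} + #{v ∈ H | ¬ F.Adj x v} = #H :=
      card_filter_add_card_filter_not _
    omega
  by_cases hY : n ≤ #Y
  · left
    have hc : t ≤ #(Y \ X) := by
      have := le_card_sdiff X Y
      omega
    obtain ⟨E, hE, hEc⟩ := exists_subset_card_eq hc
    have hH' := le_card_sdiff E H
    refine pow_le_cycNum_of_bipartite (G := F) (Y := X) (E := E) (H := H \ E) (d := q) (q := q)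
      (r := 19 * q) (disjoint_of_subset_right hE disjoint_sdiff)
      (disjoint_of_subset_right sdiff_subset hXH) disjoint_sdiff
      (fun y hy => (card_le_card (filter_subset_filter _ sdiff_subset)).trans (hd y hy)) ?_
      hEc hX (by omega) (by omega) (by omega) (by omega)
    intro e he
    have h1 := (mem_filter.1 (mem_sdiff.1 (hE he)).1).2
    have h2 : #{v ∈ H | F.Adj e v} ≤ #{v ∈ H \ E | F.Adj e v} + #E := by
      refine (card_le_card ?_).trans (card_union_le _ _)
      intro v hv
      simp only [mem_union, mem_filter, mem_sdiff] at hv ⊢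
      tauto
    omega
  · right
    have h1 : #(Y \ X) + #X = #Y := card_sdiff_add_card_eq_card hXY
    have h2 : 2 * n - 2 * t ≤ #(H \ Y) := by
      have h3 : H \ (Y \ X) ⊆ H \ Y := by
        intro v hv
        simp only [mem_sdiff, not_and, not_not] at hv ⊢
        exact ⟨hv.1, fun h => Finset.disjoint_left.1 hXH (hv.2 h) hv.1⟩
      have h4 := le_card_sdiff (Y \ X) H
      have := card_le_card h3
      omega
    obtain ⟨H₀, hH₀, hc₀⟩ := exists_subset_card_eq h2
    obtain ⟨Z, hZ₁, hZ₂, hZc⟩ := exists_subsuperset_card_eq (s := H₀) (t := univ \ Y) (n := 2 * n)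
      (hH₀.trans (sdiff_subset_sdiff (subset_univ _) le_rfl)) (by omega) (by
        have := le_card_sdiff Y univ
        rw [card_univ] at this
        omega)
    have key := pow_le_cycNum_of_clique (G := F') (A := Z) (E := ∅) (t := 0) (q := 25 * q)
      (disjoint_empty_right _) (by omega) rfl (by
        intro z hz
        have hzY : ¬ 20 * q ≤ #{u ∈ H | F.Adj z u} := by
          have := hZ₂ hz
          simpa [Y] using this
        have h3 : ({v ∈ Z | ¬ F'.Adj z v} : Finset V) ⊆
            (Z \ H₀) ∪ (({u ∈ H | F.Adj z u} : Finset V) ∪ {z}) := by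
          intro v hv
          simp only [mem_union, mem_filter, mem_sdiff, mem_singleton] at hv ⊢
          by_cases hvz : v = z
          · exact Or.inr (Or.inr hvz)
          · by_cases hvH : v ∈ H₀
            · exact Or.inr (Or.inl ⟨(mem_sdiff.1 (hH₀ hvH)).1,
                (hF z v (Ne.symm hvz)).resolve_right hv.2⟩)
            · exact Or.inl ⟨hv.1, hvH⟩
        have h4 := (card_le_card h3).trans ((card_union_le _ _).trans
          (Nat.add_le_add_left (card_union_le _ _) _))
        have h5 : #(Z \ H₀) + #H₀ = #Z := card_sdiff_add_card_eq_card hZ₁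
        rw [card_singleton] at h4
        omega) (by simp) (by omega) (by omega) (by omega)
    exact (Nat.pow_le_pow_left (by omega) _).trans key

end

/-- In one connected component of `R`, there is an injection moving every vertex to a neighbour,
defined on at least `D` vertices. -/
def HasConnectedMatching {ι : Type*} (R : SimpleGraph ι) (D : ℕ) : Prop :=
  ∃ (r : ι) (S : Finset ι) (σ : ι → ι), Set.InjOn σ S ∧
    (∀ i ∈ S, R.Adj i (σ i) ∧ R.Reachable r i) ∧ D ≤ #S

section
open scoped Classical

lemma exists_partial_injection {ι κ : Type*} [Nonempty κ] (N : ι → Finset κ) (J : Finset ι) (k : ℕ)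
    (h : ∀ S ⊆ J, #S ≤ #(S.biUnion N) + k) :
    ∃ S ⊆ J, ∃ σ : ι → κ, Set.InjOn σ S ∧ (∀ i ∈ S, σ i ∈ N i) ∧ #J ≤ #S + k := by
  let t : J → Finset (κ ⊕ Fin k) := fun i => (N i).image Sum.inl ∪ univ.image Sum.inr
  have hall : ∀ s : Finset J, #s ≤ #(s.biUnion t) := by
    intro s
    rcases s.eq_empty_or_nonempty with rfl | ⟨i₀, hi₀⟩
    · simp
    have h1 := h (s.image Subtype.val) (by
      intro i hi
      obtain ⟨j, -, rfl⟩ := mem_image.1 hi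
      exact j.2)
    rw [card_image_of_injective _ Subtype.val_injective] at h1
    have h2 : (((s.image Subtype.val).biUnion N).image Sum.inl ∪ univ.image Sum.inr :
        Finset (κ ⊕ Fin k)) ⊆ s.biUnion t := by
      intro v hv
      simp only [mem_union, mem_image, mem_biUnion, mem_univ, true_and, t] at hv ⊢
      rcases hv with ⟨a, ⟨i, ⟨j, hj, rfl⟩, ha⟩, rfl⟩ | ⟨b, rfl⟩
      · exact ⟨j, hj, Or.inl ⟨a, ha, rfl⟩⟩
      · exact ⟨i₀, hi₀, Or.inr ⟨b, rfl⟩⟩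
    refine le_trans ?_ (card_le_card h2)
    rw [card_union_of_disjoint, card_image_of_injective _ Sum.inl_injective,
      card_image_of_injective _ Sum.inr_injective]
    · simpa using h1
    · rw [Finset.disjoint_left]
      intro v hv hv'
      simp only [mem_image] at hv hv'
      obtain ⟨a, -, rfl⟩ := hv
      obtain ⟨b, -, h⟩ := hv'
      cases h
  obtain ⟨f, hf, hft⟩ := (all_card_le_biUnion_card_iff_exists_injective t).1 hall
  have hget : ∀ i (hi : i ∈ J) (a : κ), f ⟨i, hi⟩ = Sum.inl a → a ∈ N i := by
    intro i hi a ha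
    have := hft ⟨i, hi⟩
    rw [ha] at this
    simpa [t] using this
  refine ⟨{i ∈ J | ∃ (hi : i ∈ J) (a : κ), f ⟨i, hi⟩ = Sum.inl a}, filter_subset _ _,
    fun i => if h : ∃ (hi : i ∈ J) (a : κ), f ⟨i, hi⟩ = Sum.inl a then h.choose_spec.choose
      else Classical.arbitrary κ, ?_, ?_, ?_⟩
  · intro i hi i' hi' he
    have h1 := (mem_filter.1 hi).2
    have h2 := (mem_filter.1 hi').2
    simp only [dif_pos h1, dif_pos h2] at he
    have e1 := h1.choose_spec.choose_spec
    have e2 := h2.choose_spec.choose_spec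
    rw [he, ← e2] at e1
    simpa using hf e1
  · intro i hi
    have h1 := (mem_filter.1 hi).2
    simp only [dif_pos h1]
    exact hget i _ _ h1.choose_spec.choose_spec
  · rw [← card_filter_add_card_filter_not (s := J)
      (fun i => ∃ (hi : i ∈ J) (a : κ), f ⟨i, hi⟩ = Sum.inl a)]
    gcongr
    have : #({i ∈ J | ¬ ∃ (hi : i ∈ J) (a : κ), f ⟨i, hi⟩ = Sum.inl a}.attach) ≤
        #(univ : Finset (Fin k)) := by
      have hB : ∀ i : {i // i ∈ ({i ∈ J | ¬ ∃ (hi : i ∈ J) (a : κ), f ⟨i, hi⟩ = Sum.inl a} :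
          Finset ι)}, ∃ b, f ⟨i.1, (mem_filter.1 i.2).1⟩ = Sum.inr b := by
        rintro ⟨i, hi⟩
        obtain ⟨hiJ, hno⟩ := mem_filter.1 hi
        rcases hfi : f ⟨i, hiJ⟩ with a | b
        · exact (hno ⟨hiJ, a, hfi⟩).elim
        · exact ⟨b, rfl⟩
      choose b hb using hB
      refine card_le_card_of_injOn b (fun _ _ => mem_coe.2 (mem_univ _)) ?_
      intro i _ j _ hij
      have := hf ((hb i).trans ((congrArg Sum.inr hij).trans (hb j).symm))
      exact Subtype.ext (Subtype.mk.inj this)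
    simpa using this

variable {ι : Type*} [Fintype ι] {R B : SimpleGraph ι} {g D : ℕ}

lemma exists_large_component (hg : ∀ i, #{j | ¬ R.Adj i j ∧ ¬ B.Adj i j} ≤ g)
    (h4 : 4 * g < Fintype.card ι) :
    (∃ r, Fintype.card ι ≤ #{i | R.Reachable r i} + 2 * g) ∨ ∀ i j, B.Reachable i j := by
  by_contra hcon
  push Not at hcon
  obtain ⟨hcomp, i₀, j₀, hij⟩ := hcon
  apply hij
  have hnb : ∀ (i : ι) (W : Finset ι), (∀ v ∈ W, ¬ B.Adj i v) → (∀ v ∈ W, ¬ R.Reachable i v) →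
      #W ≤ g := by
    intro i W h1 h2
    refine (card_le_card ?_).trans (hg i)
    intro v hv
    simp only [mem_filter, mem_univ, true_and]
    exact ⟨fun h => h2 v hv h.reachable, h1 v hv⟩
  have hcommon : ∀ (i j : ι) (W : Finset ι), 2 * g < #W → (∀ v ∈ W, ¬ R.Reachable i v) →
      (∀ v ∈ W, ¬ R.Reachable j v) → B.Reachable i j := by
    intro i j W hW h1 h2
    by_contra hno
    have k1 := hnb i {v ∈ W | ¬ B.Adj i v} (fun v hv => (mem_filter.1 hv).2)
      (fun v hv => h1 v (mem_filter.1 hv).1)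
    have k2 := hnb j {v ∈ W | B.Adj i v} (fun v hv hb => hno
      (((mem_filter.1 hv).2.reachable).trans hb.symm.reachable))
      (fun v hv => h2 v (mem_filter.1 hv).1)
    have k3 : #{v ∈ W | B.Adj i v} + #{v ∈ W | ¬ B.Adj i v} = #W :=
      card_filter_add_card_filter_not _
    omega
  have hsum : ∀ i, #{v | R.Reachable i v} + #{v | ¬ R.Reachable i v} = Fintype.card ι := by
    intro i
    rw [card_filter_add_card_filter_not, card_univ]
  have hsame : ∀ i j, R.Reachable i j → B.Reachable i j := by
    intro i j hr
    have h1 := hcomp i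
    have h2 := hsum i
    refine hcommon i j {v | ¬ R.Reachable i v} (by omega) (fun v hv => (mem_filter.1 hv).2) ?_
    intro v hv hj
    exact (mem_filter.1 hv).2 (hr.trans hj)
  have hbig : ∀ i j, ¬ R.Reachable i j → g < #{v | R.Reachable j v} → B.Reachable i j := by
    intro i j hr hj
    by_contra hno
    have := hnb i {v | R.Reachable j v} (fun v hv hb => hno
      (hb.reachable.trans (hsame _ _ (mem_filter.1 hv).2.symm)))
      (fun v hv hv' => hr (hv'.trans (mem_filter.1 hv).2.symm))
    omega
  by_cases hr : R.Reachable i₀ j₀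
  · exact hsame _ _ hr
  by_cases hj : g < #{v | R.Reachable j₀ v}
  · exact hbig _ _ hr hj
  by_cases hi : g < #{v | R.Reachable i₀ v}
  · exact (hbig j₀ i₀ (fun h => hr h.symm) hi).symm
  refine hcommon i₀ j₀ {v | ¬ R.Reachable i₀ v ∧ ¬ R.Reachable j₀ v} ?_
    (fun v hv => (mem_filter.1 hv).2.1) (fun v hv => (mem_filter.1 hv).2.2)
  have h1 := hsum i₀
  have h2 : #{v | ¬ R.Reachable i₀ v} ≤
      #{v | ¬ R.Reachable i₀ v ∧ ¬ R.Reachable j₀ v} + #{v | R.Reachable j₀ v} := by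
    refine (card_le_card ?_).trans (card_union_le _ _)
    intro v hv
    simp only [mem_union, mem_filter, mem_univ, true_and] at hv ⊢
    tauto
  omega

lemma stability_of_large_component (hg : ∀ i, #{j | ¬ R.Adj i j ∧ ¬ B.Adj i j} ≤ g)
    (hD : D + 4 * g + 2 < Fintype.card ι) {r : ι}
    (hr : Fintype.card ι ≤ #{i | R.Reachable r i} + 2 * g) :
    HasConnectedMatching R D ∨ HasConnectedMatching B D ∨
    (∃ X : Finset ι, 2 * Fintype.card ι ≤ #X + 5 * g + 2 * D ∧
      ∀ x ∈ X, ∀ y ∈ X, ¬ R.Adj x y) ∨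
    ∃ X H : Finset ι, Disjoint X H ∧ Fintype.card ι ≤ #X + 2 * g + D ∧
      2 * Fintype.card ι ≤ #H + 5 * g + 2 * D ∧ ∀ x ∈ X, ∀ y ∈ H, ¬ R.Adj x y := by
  have : Nonempty ι := ⟨r⟩
  set J : Finset ι := {i | R.Reachable r i} with hJ
  set M := Fintype.card ι
  let N : ι → Finset ι := fun i => {j | R.Adj i j}
  let N' : ι → Finset ι := fun i => {j | B.Adj i j}
  by_cases hdef : ∀ S ⊆ J, #S ≤ #(S.biUnion N) + (#J - D)
  · left
    obtain ⟨S, hSJ, σ, h1, h2, h3⟩ := exists_partial_injection N J _ hdef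
    refine ⟨r, S, σ, h1, fun i hi => ⟨?_, ?_⟩, by omega⟩
    · simpa [N] using h2 i hi
    · simpa [J] using hSJ hi
  right
  push Not at hdef
  obtain ⟨S, hSJ, hS⟩ := hdef
  set NS := S.biUnion N with hNS
  have hNSJ : NS ⊆ J := by
    intro v hv
    obtain ⟨u, hu, huv⟩ := mem_biUnion.1 hv
    have h1 : R.Adj u v := by simpa [N] using huv
    have h2 : R.Reachable r u := by simpa [J] using hSJ hu
    simpa [J] using h2.trans h1.reachable
  have hmemNS : ∀ u ∈ S, ∀ v, R.Adj u v → v ∈ NS := fun u hu v huv =>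
    mem_biUnion.2 ⟨u, hu, by simpa [N] using huv⟩
  set X := S \ NS
  set Z := NS \ S
  set H := J \ (X ∪ Z)
  have hXZ : Disjoint X Z := by
    rw [Finset.disjoint_left]
    intro v hv hv'
    exact (mem_sdiff.1 hv').2 (mem_sdiff.1 hv).1
  have hXZJ : X ∪ Z ⊆ J := union_subset (sdiff_subset.trans hSJ) (sdiff_subset.trans hNSJ)
  have hXH : Disjoint X H := by
    rw [Finset.disjoint_left]
    intro v hv hv'
    exact (mem_sdiff.1 hv').2 (mem_union_left _ hv)
  have hxz : #X + #NS = #Z + #S := by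
    have h1 : #X + #(S ∩ NS) = #S := card_sdiff_add_card_inter _ _
    have h2 : #Z + #(NS ∩ S) = #NS := card_sdiff_add_card_inter _ _
    rw [inter_comm] at h2
    omega
  have hxzh : #H + (#X + #Z) = #J := by
    rw [← card_union_of_disjoint hXZ]
    exact card_sdiff_add_card_eq_card hXZJ
  have hXX : ∀ x ∈ X, ∀ y ∈ X, ¬ R.Adj x y := by
    intro x hx y hy h
    exact (mem_sdiff.1 hy).2 (hmemNS x (mem_sdiff.1 hx).1 y h)
  have hXHR : ∀ x ∈ X, ∀ y ∈ H, ¬ R.Adj x y := by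
    intro x hx y hy h
    have h1 := hmemNS x (mem_sdiff.1 hx).1 y h
    by_cases hyS : y ∈ S
    · exact (mem_sdiff.1 hx).2 (hmemNS y hyS x h.symm)
    · exact (mem_sdiff.1 hy).2 (mem_union_right _ (mem_sdiff.2 ⟨h1, hyS⟩))
  have hJM : #J ≤ M := card_le_univ _
  have hxbig : M ≤ #X + 2 * g + D := by omega
  set U := X ∪ H
  have hU : #U = #X + #H := card_union_of_disjoint hXH
  have hBX : ∀ u ∈ U, #{x ∈ X | ¬ B.Adj u x} ≤ g := by
    intro u hu
    refine (card_le_card ?_).trans (hg u)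
    intro v hv
    obtain ⟨hv1, hv2⟩ := mem_filter.1 hv
    simp only [mem_filter, mem_univ, true_and]
    refine ⟨?_, hv2⟩
    rcases mem_union.1 hu with h | h
    · exact hXX u h v hv1
    · exact fun h' => hXHR v hv1 u h h'.symm
  have hreach : ∀ u ∈ U, ∀ v ∈ U, B.Reachable u v := by
    intro u hu v hv
    by_contra hno
    have k1 := hBX u hu
    have k2 := hBX v hv
    have k3 : #X ≤ #{x ∈ X | ¬ B.Adj u x} + #{x ∈ X | ¬ B.Adj v x} := by
      refine (card_le_card ?_).trans (card_union_le _ _)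
      intro x hx
      simp only [mem_union, mem_filter, hx, true_and]
      by_contra hcon
      push Not at hcon
      exact hno (hcon.1.reachable.trans hcon.2.symm.reachable)
    omega
  have hsplit : #U ≤ D + g →
      ∃ X : Finset ι, 2 * M ≤ #X + 5 * g + 2 * D ∧ ∀ x ∈ X, ∀ y ∈ X, ¬ R.Adj x y :=
    fun hsmall => ⟨X, by omega, hXX⟩
  by_cases hdef' : ∀ S ⊆ U, #S ≤ #(S.biUnion N') + (#U - D)
  · by_cases hUD : #U < D
    · exact Or.inr (Or.inl (hsplit (by omega)))
    left
    obtain ⟨S', hSU, σ, h1, h2, h3⟩ := exists_partial_injection N' U _ hdef'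
    obtain ⟨x, hx⟩ : X.Nonempty := card_pos.1 (by omega)
    refine ⟨x, S', σ, h1, fun i hi => ⟨?_, ?_⟩, by omega⟩
    · simpa [N'] using h2 i hi
    · exact hreach _ (mem_union_left _ hx) _ (hSU hi)
  right
  push Not at hdef'
  obtain ⟨S', hSU, hS'⟩ := hdef'
  have hS'U := card_le_card hSU
  by_cases hmeet : ∃ x ∈ S', x ∈ X
  · left
    obtain ⟨x, hxS, hxX⟩ := hmeet
    apply hsplit
    have h1 : #U ≤ #(S'.biUnion N') + g := by
      have h2 : U ⊆ S'.biUnion N' ∪ ({j | ¬ R.Adj x j ∧ ¬ B.Adj x j} : Finset ι) := by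
        intro v hv
        by_cases hb : B.Adj x v
        · exact mem_union_left _ (mem_biUnion.2 ⟨x, hxS, by simpa [N'] using hb⟩)
        · refine mem_union_right _ ?_
          simp only [mem_filter, mem_univ, true_and]
          refine ⟨?_, hb⟩
          rcases mem_union.1 hv with h | h
          · exact hXX x hxX v h
          · exact hXHR x hxX v h
      have := (card_le_card h2).trans (card_union_le _ _)
      have := hg x
      omega
    omega
  · right
    push Not at hmeet
    obtain ⟨y, hy⟩ : S'.Nonempty := card_pos.1 (by omega)
    have hS'H : S' ⊆ H := fun v hv => (mem_union.1 (hSU hv)).resolve_left (hmeet v hv)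
    have h1 : #X ≤ #(S'.biUnion N') + g := by
      have h2 : X ⊆ S'.biUnion N' ∪ ({x ∈ X | ¬ B.Adj y x} : Finset ι) := by
        intro v hv
        by_cases hb : B.Adj y v
        · exact mem_union_left _ (mem_biUnion.2 ⟨y, hy, by simpa [N'] using hb⟩)
        · exact mem_union_right _ (mem_filter.2 ⟨hv, hb⟩)
      have := (card_le_card h2).trans (card_union_le _ _)
      have := hBX y (hSU hy)
      omega
    have h2 := card_le_card hS'H
    have h3 : 2 * M ≤ #H + 5 * g + 2 * D := by lia
    exact ⟨X, H, hXH, hxbig, h3, hXHR⟩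

theorem stability (hg : ∀ i, #{j | ¬ R.Adj i j ∧ ¬ B.Adj i j} ≤ g)
    (hD : D + 4 * g + 2 < Fintype.card ι) :
    ∃ F ∈ ({R, B} : Set (SimpleGraph ι)), HasConnectedMatching F D ∨
    (∃ X : Finset ι, 2 * Fintype.card ι ≤ #X + 5 * g + 2 * D ∧
      ∀ x ∈ X, ∀ y ∈ X, ¬ F.Adj x y) ∨
    ∃ X H : Finset ι, Disjoint X H ∧ Fintype.card ι ≤ #X + 2 * g + D ∧
      2 * Fintype.card ι ≤ #H + 5 * g + 2 * D ∧ ∀ x ∈ X, ∀ y ∈ H, ¬ F.Adj x y := by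
  have hR : R ∈ ({R, B} : Set (SimpleGraph ι)) := by simp
  have hB : B ∈ ({R, B} : Set (SimpleGraph ι)) := by simp
  rcases exists_large_component hg (by omega) with ⟨r, hr⟩ | hconn
  · rcases stability_of_large_component hg hD hr with h | h | h
    · exact ⟨R, hR, Or.inl h⟩
    · exact ⟨B, hB, Or.inl h⟩
    · exact ⟨R, hR, Or.inr h⟩
  · obtain ⟨r⟩ : Nonempty ι := Fintype.card_pos_iff.1 (by omega)
    have hr : Fintype.card ι ≤ #{i | B.Reachable r i} + 2 * g := by
      rw [filter_true_of_mem fun i _ => hconn r i, card_univ]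
      omega
    have hg' : ∀ i, #{j | ¬ B.Adj i j ∧ ¬ R.Adj i j} ≤ g := by
      intro i
      simpa only [and_comm] using hg i
    rcases stability_of_large_component hg' hD hr with h | h | h
    · exact ⟨B, hB, Or.inl h⟩
    · exact ⟨R, hR, Or.inl h⟩
    · exact ⟨B, hB, Or.inr h⟩

end

section
open scoped Classical

/-- Every set of at least `r` vertices of `B` is such that all but at most `b` vertices of `A` are
adjacent to at least a proportion `1 / w` of it. -/
def GoodPair {V : Type*} (G : SimpleGraph V) (r w b : ℕ) (A B : Finset V) : Prop :=
  ∀ Y ⊆ B, r ≤ #Y → #{x ∈ A | w * #{y ∈ Y | G.Adj x y} < #Y} ≤ b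

variable {V : Type*} {G : SimpleGraph V} {ι : Type*} {A : ι → Finset V} {c : ℕ → ι}
  {k q r w b : ℕ}

/-- The vertices available for extending the partial path `L` (listed backwards) along the clusters
`A (c t)`, the last vertex being chosen in `Q`. -/
def available (A : ι → Finset V) (c : ℕ → ι) (k : ℕ) (Q : Finset V) (L : List V) : Finset V :=
  if L.length < k - 1 then A (c L.length) \ (Q ∪ L.toFinset) else Q

/-- `L` is a partial path (listed backwards) along the clusters `A (c t)` which avoids `Q` and can
be extended in at least `p` ways. -/
structure PartialPath (G : SimpleGraph V) (A : ι → Finset V) (c : ℕ → ι) (k : ℕ) (Q : Finset V)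
    (p : ℕ) (L : List V) : Prop where
  nodup : L.Nodup
  chain : L.IsChain G.Adj
  avoid : ∀ u ∈ L, u ∉ Q
  count : ∀ i, #(L.toFinset ∩ A i) ≤ #{t ∈ range L.length | c t = i}
  ext : ∃ h, L.head? = some h ∧ p ≤ #{y ∈ available A c k Q L | G.Adj h y}

lemma PartialPath.exists_extensions {Q : Finset V} {L : List V}
    (hL : PartialPath G A c k Q (q + b) L) (hlen : L.length < k - 1)
    (hdisj : ∀ i j, i ≠ j → Disjoint (A i) (A j))
    (hne : ∀ t, t + 1 < k → c t ≠ c (t + 1))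
    (hgood : ∀ t, t + 1 < k → GoodPair G r w b (A (c t)) (A (c (t + 1))))
    (hvis : ∀ i, #{t ∈ range k | c t = i} + 2 * r ≤ #(A i)) (hr : w * (q + b) ≤ r) (hw : 0 < w)
    (hQ : #Q = r) (hQA : Q ⊆ A (c (k - 1))) :
    ∃ T : Finset V, q ≤ #T ∧ ∀ a ∈ T, PartialPath G A c k Q (q + b) (a :: L) := by
  obtain ⟨h, hh, hext⟩ := hL.ext
  have hav : available A c k Q L = A (c L.length) \ (Q ∪ L.toFinset) := if_pos hlen
  set t := L.length with ht
  let Y : Finset V := if t + 1 < k - 1 then A (c (t + 1)) \ (Q ∪ L.toFinset) else Q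
  have hYA : Y ⊆ A (c (t + 1)) := by
    by_cases h1 : t + 1 < k - 1
    · simp only [Y, if_pos h1]
      exact sdiff_subset
    · simp only [Y, if_neg h1]
      have : t + 1 = k - 1 := by omega
      rwa [this]
  have hYr : r ≤ #Y := by
    by_cases h1 : t + 1 < k - 1
    · simp only [Y, if_pos h1]
      have h2 : #(A (c (t + 1))) ≤
          #(A (c (t + 1)) \ (Q ∪ L.toFinset)) + (#Q + #(L.toFinset ∩ A (c (t + 1)))) := by
        refine (card_le_card ?_).trans ((card_union_le _ _).trans
          (Nat.add_le_add_left (card_union_le _ _) _))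
        intro v hv
        simp only [mem_union, mem_sdiff, mem_inter]
        tauto
      have h3 := hL.count (c (t + 1))
      have h4 := hvis (c (t + 1))
      have h5 : #{s ∈ range t | c s = c (t + 1)} ≤ #{s ∈ range k | c s = c (t + 1)} :=
        card_le_card (filter_subset_filter _ (range_subset_range.2 (by omega)))
      rw [← ht] at h3
      omega
    · simp only [Y, if_neg h1]
      exact hQ.ge
  have hbad := hgood t (by omega) Y hYA hYr
  let C : Finset V := {y ∈ available A c k Q L | G.Adj h y}
  let Bd : Finset V := {x ∈ A (c t) | w * #{y ∈ Y | G.Adj x y} < #Y}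
  refine ⟨C \ Bd, ?_, ?_⟩
  · have := le_card_sdiff Bd C
    have h1 : q + b ≤ #C := hext
    have h2 : #Bd ≤ b := hbad
    omega
  · intro a ha
    obtain ⟨haC, haB⟩ := mem_sdiff.1 ha
    obtain ⟨haT, hadj⟩ := mem_filter.1 haC
    rw [hav] at haT
    simp only [mem_sdiff, mem_union, List.mem_toFinset, not_or] at haT
    obtain ⟨haA, haQ, haL⟩ := haT
    refine ⟨List.nodup_cons.2 ⟨haL, hL.nodup⟩, List.isChain_cons.2 ⟨?_, hL.chain⟩, ?_, ?_, ?_⟩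
    · intro y hy
      rw [hh] at hy
      simp only [Option.mem_def, Option.some.injEq] at hy
      subst hy
      exact hadj.symm
    · intro u hu
      rcases List.mem_cons.1 hu with rfl | hu
      · exact haQ
      · exact hL.avoid u hu
    · intro i
      have h1 := hL.count i
      rw [← ht] at h1
      rw [List.length_cons, ← ht, range_add_one, filter_insert]
      by_cases hi : c t = i
      · rw [if_pos hi, card_insert_of_notMem (by simp)]
        have h2 : (a :: L).toFinset ∩ A i ⊆ insert a (L.toFinset ∩ A i) := by
          intro v hv
          simp only [List.toFinset_cons, mem_inter, mem_insert] at hv ⊢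
          tauto
        have h3 := (card_le_card h2).trans (card_insert_le _ _)
        omega
      · rw [if_neg hi]
        refine (card_le_card ?_).trans h1
        intro v hv
        simp only [List.toFinset_cons, mem_inter, mem_insert] at hv ⊢
        rcases hv.1 with rfl | h2
        · exact (Finset.disjoint_left.1 (hdisj _ _ hi) haA hv.2).elim
        · exact ⟨h2, hv.2⟩
    · refine ⟨a, rfl, ?_⟩
      have hYeq : available A c k Q (a :: L) = Y := by
        simp only [available, List.length_cons, ← ht, Y]
        split_ifs with h1
        · ext v
          simp only [mem_sdiff, mem_union, List.toFinset_cons, mem_insert, not_or]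
          constructor
          · rintro ⟨h2, h3, h4, h5⟩
            exact ⟨h2, h3, h5⟩
          · rintro ⟨h2, h3, h5⟩
            refine ⟨h2, h3, ?_, h5⟩
            rintro rfl
            exact Finset.disjoint_left.1 (hdisj _ _ (hne t (by omega))) haA h2
        · rfl
      rw [hYeq]
      have h1 : #Y ≤ w * #{y ∈ Y | G.Adj a y} := by
        by_contra hcon
        exact haB (mem_filter.2 ⟨haA, not_le.1 hcon⟩)
      exact Nat.le_of_mul_le_mul_left (hr.trans (hYr.trans h1)) hw

theorem pow_le_cycNum_of_closed_walk [Finite V] (hdisj : ∀ i j, i ≠ j → Disjoint (A i) (A j))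
    (hk : 3 ≤ k) (hne : ∀ t, t + 1 < k → c t ≠ c (t + 1)) (hne' : c 0 ≠ c (k - 1))
    (hgood : ∀ t, t + 1 < k → GoodPair G r w b (A (c t)) (A (c (t + 1))))
    (hgood' : GoodPair G r w b (A (c 0)) (A (c (k - 1))))
    (hvis : ∀ i, #{t ∈ range k | c t = i} + 2 * r ≤ #(A i)) (hr : w * (q + b) ≤ r) (hw : 0 < w)
    (hq : 0 < q) (hA : ∀ i, w * (2 * r) ≤ #(A i)) :
    q ^ (k - 2) ≤ cycNum G k := by
  have hqr : q + b ≤ r := (Nat.le_mul_of_pos_left _ hw).trans hr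
  have hrA : ∀ i, r ≤ #(A i) := fun i => by have := hvis i; omega
  have hg1 := hgood 0 (by omega) _ subset_rfl (hrA _)
  have hg2 := hgood' _ subset_rfl (hrA _)
  obtain ⟨f₀, hf₀, hn1, hn2⟩ : ∃ f ∈ A (c 0), 2 * r ≤ #{y ∈ A (c (0 + 1)) | G.Adj f y} ∧
      2 * r ≤ #{y ∈ A (c (k - 1)) | G.Adj f y} := by
    by_contra hcon
    push Not at hcon
    have h1 : A (c 0) ⊆
        ({x ∈ A (c 0) | w * #{y ∈ A (c (0 + 1)) | G.Adj x y} < #(A (c (0 + 1)))} : Finset V) ∪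
        ({x ∈ A (c 0) | w * #{y ∈ A (c (k - 1)) | G.Adj x y} < #(A (c (k - 1)))} : Finset V) := by
      intro x hx
      simp only [mem_union, mem_filter, hx, true_and]
      by_contra hno
      push Not at hno
      have h2 := Nat.le_of_mul_le_mul_left ((hA _).trans hno.1) hw
      have h3 := Nat.le_of_mul_le_mul_left ((hA _).trans hno.2) hw
      have := hcon x hx h2
      omega
    have h2 := (card_le_card h1).trans (card_union_le _ _)
    have h3 := hvis (c 0)
    omega
  obtain ⟨Q, hQ, hQr⟩ := exists_subset_card_eq (show r ≤ #{y ∈ A (c (k - 1)) | G.Adj f₀ y} by omega)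
  have hQA : Q ⊆ A (c (k - 1)) := hQ.trans (filter_subset _ _)
  have hstart : PartialPath G A c k Q (q + b) [f₀] := by
    refine ⟨by simp, by simp, ?_, ?_, f₀, rfl, ?_⟩
    · intro u hu huQ
      rw [List.mem_singleton] at hu
      subst hu
      exact Finset.disjoint_left.1 (hdisj _ _ hne') hf₀ (hQA huQ)
    · intro i
      by_cases hi : c 0 = i
      · have h1 : #([f₀].toFinset ∩ A i) ≤ 1 :=
          (card_le_card inter_subset_left).trans (by simp)
        simpa [range_one, filter_singleton, hi] using h1
      · have h1 : [f₀].toFinset ∩ A i = ∅ := by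
          ext v
          simp only [List.toFinset_cons, List.toFinset_nil, mem_inter, mem_insert, notMem_empty,
            or_false, iff_false, not_and]
          rintro rfl h
          exact Finset.disjoint_left.1 (hdisj _ _ hi) hf₀ h
        rw [h1]
        simp
    · rw [available, if_pos (by rw [List.length_singleton]; omega)]
      have h1 : #{y ∈ A (c (0 + 1)) | G.Adj f₀ y} ≤
          #{y ∈ A (c (0 + 1)) \ (Q ∪ [f₀].toFinset) | G.Adj f₀ y} + #Q := by
        refine (card_le_card ?_).trans (card_union_le _ _)
        intro v hv
        simp only [mem_union, mem_filter, mem_sdiff, List.toFinset_cons, List.toFinset_nil,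
          mem_insert, notMem_empty, or_false] at hv ⊢
        by_cases hvQ : v ∈ Q
        · exact Or.inr hvQ
        · refine Or.inl ⟨⟨hv.1, ?_⟩, hv.2⟩
          rintro (h | rfl)
          · exact hvQ h
          · exact G.loopless.irrefl _ hv.2
      simp only [List.length_singleton]
      rw [zero_add] at h1 hn1
      omega
  obtain ⟨S, hS, hSc⟩ := exists_finset_of_branching
    (fun L => PartialPath G A c k Q (q + b) (L ++ [f₀])) hstart (fun _ => q) (k - 2) (by
      intro L hL hp
      exact hp.exists_extensions (by rw [List.length_append, List.length_singleton]; omega)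
        hdisj hne hgood hvis hr hw hQr hQA)
  rw [prod_const, card_range] at hSc
  have hlast : ∀ L : S, ∃ z ∈ Q, ∃ h, (L.1 ++ [f₀]).head? = some h ∧ G.Adj h z := by
    rintro ⟨L, hL⟩
    obtain ⟨hp, hlen⟩ := hS L hL
    obtain ⟨h, hh, hext⟩ := hp.ext
    rw [available, if_neg (by rw [List.length_append, List.length_singleton]; omega)] at hext
    obtain ⟨z, hz⟩ := card_pos.1 (lt_of_lt_of_le (by omega) hext)
    obtain ⟨hzQ, hz⟩ := mem_filter.1 hz
    exact ⟨z, hzQ, h, hh, hz⟩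
  choose z hzQ h hh hz using hlast
  have : NeZero k := ⟨by omega⟩
  have hcard : #(univ.image fun L : S => z L :: (L.1 ++ [f₀])) = #S := by
    rw [card_image_of_injective, card_univ, Fintype.card_coe]
    intro L L' he
    simp only [List.cons.injEq] at he
    exact Subtype.ext (List.append_cancel_right he.2)
  refine hSc.trans (hcard.symm.le.trans (card_le_cycNum _ ?_))
  intro L' hL'
  obtain ⟨L, -, rfl⟩ := mem_image.1 hL'
  obtain ⟨hp, hlen⟩ := hS L.1 L.2
  refine ⟨⟨z L, f₀, ⟨?_, ?_, rfl, ?_⟩, ?_⟩, ?_⟩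
  · exact List.nodup_cons.2 ⟨fun hm => hp.avoid _ hm (hzQ L), hp.nodup⟩
  · refine List.isChain_cons.2 ⟨?_, hp.chain⟩
    intro y hy
    rw [hh L] at hy
    simp only [Option.mem_def, Option.some.injEq] at hy
    rw [← hy]
    exact (hz L).symm
  · rw [← List.cons_append, List.getLast?_append]
    simp
  · exact (mem_filter.1 (hQ (hzQ L))).2
  · simp only [List.length_cons, List.length_append, List.length_nil]
    omega

end

section
open scoped Classical

variable {ι : Type*} {R : SimpleGraph ι}

lemma card_filter_getVert {u v : ι} (w : R.Walk u v) (i : ι) :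
    #{t ∈ range w.length | w.getVert (t + 1) = i} = w.support.tail.count i := by
  rw [card_filter]
  induction w with
  | nil => simp
  | cons h p ih =>
    have h1 : (∑ t ∈ range p.length,
        if (SimpleGraph.Walk.cons h p).getVert (t + 1 + 1) = i then 1 else 0) =
        p.support.tail.count i := ih
    rw [SimpleGraph.Walk.length_cons, sum_range_succ', h1, SimpleGraph.Walk.support_cons,
      List.tail_cons, ← SimpleGraph.Walk.cons_tail_support p, List.count_cons]
    simp

lemma exists_bounce {i j : ι} (h : R.Adj i j) (x : ℕ) :
    ∃ w : R.Walk i i, w.length = 2 * x ∧ ∀ v, w.support.tail.count v =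
      x * ((if v = i then 1 else 0) + if v = j then 1 else 0) := by
  induction x with
  | zero => exact ⟨.nil, by simp, by simp⟩
  | succ x ih =>
    obtain ⟨w, hw, hc⟩ := ih
    refine ⟨.cons h (.cons h.symm w), by simp [hw]; ring, fun v => ?_⟩
    rw [SimpleGraph.Walk.support_cons, List.tail_cons, SimpleGraph.Walk.support_cons,
      ← SimpleGraph.Walk.cons_tail_support w, List.count_cons, List.count_cons, hc]
    simp only [beq_iff_eq, eq_comm (b := v)]
    ring

lemma exists_loop [Fintype ι] {r i j : ι} (hr : R.Reachable r i) (h : R.Adj i j) :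
    ∃ l ≤ Fintype.card ι, ∀ x, ∃ w : R.Walk r r, w.length = 2 * (l + x) ∧
      ∀ v, w.support.tail.count v ≤
        2 + x * ((if v = i then 1 else 0) + if v = j then 1 else 0) := by
  obtain ⟨p, hp⟩ := hr.exists_isPath
  refine ⟨p.length, hp.length_lt.le, fun x => ?_⟩
  obtain ⟨w, hw, hc⟩ := exists_bounce h x
  refine ⟨p.append (w.append p.reverse), by simp [hw]; ring, fun v => ?_⟩
  rw [SimpleGraph.Walk.tail_support_append, SimpleGraph.Walk.tail_support_append,
    List.count_append, List.count_append, hc]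
  have h1 : p.support.tail.count v ≤ 1 := List.nodup_iff_count_le_one.1 hp.support_nodup.tail v
  have h2 : p.reverse.support.tail.count v ≤ 1 :=
    List.nodup_iff_count_le_one.1 hp.reverse.support_nodup.tail v
  omega

lemma exists_closed_walk_aux [Fintype ι] {r : ι} {σ : ι → ι} (X : ℕ) (S : Finset ι)
    (hS : ∀ i ∈ S, R.Adj i (σ i) ∧ R.Reachable r i) :
    ∃ l ≤ #S * Fintype.card ι, ∀ N ≤ #S * X, ∃ w : R.Walk r r, w.length = 2 * (l + N) ∧
      ∀ v, w.support.tail.count v ≤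
        2 * #S + X * ∑ i ∈ S, ((if v = i then 1 else 0) + if v = σ i then 1 else 0) := by
  induction S using Finset.induction_on with
  | empty =>
    refine ⟨0, by simp, fun N hN => ⟨.nil, ?_, by simp⟩⟩
    simp at hN
    simp [hN]
  | insert i S hi ih =>
    obtain ⟨l, hl, hw⟩ := ih fun i hi => hS i (mem_insert_of_mem hi)
    have h1 := hS i (mem_insert_self _ _)
    obtain ⟨m, hm, hw'⟩ := exists_loop h1.2 h1.1
    rw [card_insert_of_notMem hi]
    refine ⟨l + m, by rw [add_mul]; omega, fun N hN => ?_⟩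
    rw [add_mul, one_mul] at hN
    obtain ⟨w, hwl, hwc⟩ := hw (N - min N X) (by omega)
    obtain ⟨w', hwl', hwc'⟩ := hw' (min N X)
    refine ⟨w.append w', by rw [SimpleGraph.Walk.length_append]; omega, fun v => ?_⟩
    rw [SimpleGraph.Walk.tail_support_append, List.count_append, sum_insert hi, mul_add X]
    have h2 := hwc v
    have h3 := hwc' v
    have h4 := Nat.mul_le_mul_right ((if v = i then 1 else 0) + if v = σ i then 1 else 0)
      (Nat.min_le_right N X)
    omega

/-- A large connected matching carries closed walks of every large even length which visit no
vertex too often. -/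
theorem HasConnectedMatching.exists_closed_walk [Fintype ι] {D X n : ℕ}
    (h : HasConnectedMatching R D) (hn : Fintype.card ι ^ 2 ≤ n) (hn' : 0 < n) (hX : n ≤ D * X) :
    ∃ c : ℕ → ι, (∀ t, t + 1 < 2 * n → R.Adj (c t) (c (t + 1))) ∧ R.Adj (c 0) (c (2 * n - 1)) ∧
      ∀ i, #{t ∈ range (2 * n) | c t = i} ≤ 2 * Fintype.card ι + 2 * X := by
  obtain ⟨r, S, σ, hσ, hS, hD⟩ := h
  obtain ⟨l, hl, hw⟩ := exists_closed_walk_aux X S hS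
  have hSι : #S ≤ Fintype.card ι := card_le_univ S
  have hl' : l ≤ n := hl.trans ((Nat.mul_le_mul_right _ hSι).trans (by rwa [← sq]))
  have h1 : D * X ≤ #S * X := Nat.mul_le_mul_right _ hD
  obtain ⟨w, hwl, hwc⟩ := hw (n - l) (by omega)
  rw [show l + (n - l) = n by omega] at hwl
  refine ⟨fun t => w.getVert (t + 1), fun t ht => w.adj_getVert_succ (by omega), ?_, fun i => ?_⟩
  · have h2 := w.adj_getVert_succ (i := 0) (by omega)
    rw [SimpleGraph.Walk.getVert_zero] at h2
    simp only [zero_add] at h2 ⊢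
    rw [show 2 * n - 1 + 1 = w.length by omega, SimpleGraph.Walk.getVert_length]
    exact h2.symm
  · rw [← hwl, card_filter_getVert]
    refine (hwc i).trans ?_
    have h2 : ∑ j ∈ S, (if i = j then 1 else 0) ≤ 1 := by
      rw [← card_filter, card_le_one]
      intro a ha b hb
      exact (mem_filter.1 ha).2.symm.trans (mem_filter.1 hb).2
    have h3 : ∑ j ∈ S, (if i = σ j then 1 else 0) ≤ 1 := by
      rw [← card_filter, card_le_one]
      intro a ha b hb
      exact hσ (mem_filter.1 ha).1 (mem_filter.1 hb).1
        ((mem_filter.1 ha).2.symm.trans (mem_filter.1 hb).2)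
    rw [sum_add_distrib]
    have h4 : X * (∑ j ∈ S, (if i = j then 1 else 0) + ∑ j ∈ S, (if i = σ j then 1 else 0)) ≤
      X * 2 := Nat.mul_le_mul_left _ (by omega)
    omega

end

lemma isUniform_of_eq_compl {V : Type*} [DecidableEq V] {G F : SimpleGraph V} [DecidableRel G.Adj]
    [DecidableRel F.Adj] (hF : F = Gᶜ) {ε : ℝ} (hε : 0 < ε) {U W : Finset V}
    (hU : U.Nonempty) (hW : W.Nonempty) (hd : Disjoint U W) (h : G.IsUniform ε U W) :
    F.IsUniform ε U W := by
  have hpos : ∀ S S' : Finset V, S.Nonempty → (#S : ℝ) * ε ≤ #S' → S'.Nonempty := by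
    intro S S' hS hS'
    have h1 : (0 : ℝ) < #S := by exact_mod_cast hS.card_pos
    have h2 : (0 : ℝ) < #S' := lt_of_lt_of_le (by positivity) hS'
    exact card_pos.1 (by exact_mod_cast h2)
  have hdens : ∀ S S' : Finset V, S.Nonempty → S'.Nonempty → Disjoint S S' →
      ((F.edgeDensity S S' : ℚ) : ℝ) = 1 - ((G.edgeDensity S S' : ℚ) : ℝ) := by
    intro S S' h1 h2 h3
    have h4 : F.edgeDensity S S' = Gᶜ.edgeDensity S S' := by
      subst hF
      congr!
    have h5 := G.edgeDensity_add_edgeDensity_compl h1 h2 h3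
    rw [h4]
    have h6 : ((G.edgeDensity S S' : ℚ) : ℝ) + ((Gᶜ.edgeDensity S S' : ℚ) : ℝ) = 1 := by
      exact_mod_cast h5
    linarith
  intro U' hU' W' hW' h1 h2
  have h3 := h hU' hW' h1 h2
  rw [hdens _ _ (hpos _ _ hU h1) (hpos _ _ hW h2)
    (disjoint_of_subset_left hU' (disjoint_of_subset_right hW' hd)), hdens _ _ hU hW hd]
  rw [abs_sub_comm] at h3
  convert h3 using 2
  ring

section
open scoped Classical

variable {V : Type*}

/-- The number of edges of `F` between `U` and `W`. -/
def crossing (F : SimpleGraph V) (U W : Finset V) : ℕ := #{p ∈ U ×ˢ W | F.Adj p.1 p.2}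

lemma crossing_eq_sum (F : SimpleGraph V) (U W : Finset V) :
    crossing F U W = ∑ x ∈ U, #{y ∈ W | F.Adj x y} := by
  simp only [crossing, card_filter, sum_product]

lemma crossing_comm (F : SimpleGraph V) (U W : Finset V) : crossing F U W = crossing F W U := by
  simp only [crossing, card_filter, sum_product]
  rw [sum_comm]
  simp only [F.adj_comm]

lemma edgeDensity_eq_crossing (F : SimpleGraph V) (U W : Finset V) :
    ((F.edgeDensity U W : ℚ) : ℝ) = crossing F U W / (#U * #W) := by
  simp [SimpleGraph.edgeDensity, Rel.edgeDensity, Rel.interedges, crossing]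

lemma goodPair_of_isUniform {F : SimpleGraph V} {U W : Finset V} {κ r b : ℕ} (hκ : 2 ≤ κ)
    (hu : F.IsUniform (1 / (κ : ℝ) ^ 3) U W) (hd : #U * #W ≤ κ * crossing F U W)
    (hU : U.Nonempty) (hW : W.Nonempty)
    (hr : #W ≤ κ ^ 3 * r) (hb : #U ≤ κ ^ 3 * b) : GoodPair F r (2 * κ) b U W := by
  intro Y hY hYr
  by_contra! hbad
  set B : Finset V := {x ∈ U | 2 * κ * #{y ∈ Y | F.Adj x y} < #Y} with hB
  have hκ0 : (2 : ℝ) ≤ κ := by exact_mod_cast hκ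
  have hU0 : (0 : ℝ) < #U := by exact_mod_cast hU.card_pos
  have hW0 : (0 : ℝ) < #W := by exact_mod_cast hW.card_pos
  have h1 : (#U : ℝ) * (1 / (κ : ℝ) ^ 3) ≤ #B := by
    rw [mul_one_div, div_le_iff₀ (by positivity)]
    have : #U ≤ #B * κ ^ 3 := hb.trans (by rw [mul_comm]; exact Nat.mul_le_mul_right _ hbad.le)
    exact_mod_cast this
  have h2 : (#W : ℝ) * (1 / (κ : ℝ) ^ 3) ≤ #Y := by
    rw [mul_one_div, div_le_iff₀ (by positivity)]
    have : #W ≤ #Y * κ ^ 3 := hr.trans (by rw [mul_comm]; exact Nat.mul_le_mul_right _ hYr)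
    exact_mod_cast this
  have hB0 : (0 : ℝ) < #B := lt_of_lt_of_le (by positivity) h1
  have hY0 : (0 : ℝ) < #Y := lt_of_lt_of_le (by positivity) h2
  have h3 := (abs_lt.1 (hu (filter_subset _ _) hY h1 h2)).1
  rw [edgeDensity_eq_crossing, edgeDensity_eq_crossing] at h3
  have h4 : (1 : ℝ) / κ ≤ crossing F U W / (#U * #W) := by
    rw [div_le_div_iff₀ (by positivity) (by positivity), one_mul, mul_comm _ (κ : ℝ)]
    exact_mod_cast hd
  have h5 : 2 * κ * crossing F B Y ≤ #B * #Y := by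
    rw [crossing_eq_sum, mul_sum, ← smul_eq_mul (#B), ← sum_const]
    exact sum_le_sum fun x hx => (mem_filter.1 hx).2.le
  have h6 : (crossing F B Y : ℝ) / (#B * #Y) ≤ 1 / (2 * κ) := by
    rw [div_le_div_iff₀ (by positivity) (by positivity), one_mul, mul_comm]
    exact_mod_cast h5
  have h7 : (1 : ℝ) / κ ^ 3 ≤ 1 / (2 * κ) := by
    apply one_div_le_one_div_of_le (by positivity)
    nlinarith [mul_nonneg (by positivity : (0:ℝ) ≤ κ) (by nlinarith : (0 : ℝ) ≤ (κ : ℝ) ^ 2 - 2)]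
  have h8 : (1 : ℝ) / κ = 1 / (2 * κ) + 1 / (2 * κ) := by
    field_simp
    norm_num
  linarith

/-- The outcome of the regularity lemma for a graph and its complement: disjoint clusters of nearly
equal size covering almost everything, such that most pairs of clusters are good for each of the two
graphs which is not sparse between them. -/
theorem exists_clusters (κ : ℕ) (hκ : 2 ≤ κ) : ∃ L, ∀ (V : Type) [Fintype V] (G : SimpleGraph V),
    L ≤ Fintype.card V → ∃ (T : Finset (Finset V)) (M s : ℕ) (Bad : Finset V → Finset V → Prop),
      κ ≤ M ∧ M ≤ L ∧ s * M ≤ Fintype.card V ∧ Fintype.card V < (s + 1) * M ∧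
      (∀ U ∈ T, s ≤ #U ∧ #U ≤ s + 1) ∧ (∀ U ∈ T, ∀ W ∈ T, U ≠ W → Disjoint U W) ∧
      #T ≤ M ∧ κ * M ≤ κ * #T + M ∧ (∀ U, Bad U U) ∧ (∀ U W, Bad U W → Bad W U) ∧
      (∀ U ∈ T, κ * #{W ∈ T | Bad U W} ≤ 2 * M) ∧
      ∀ F, F = G ∨ F = Gᶜ → ∀ U ∈ T, ∀ W ∈ T, ¬ Bad U W → #U * #W ≤ κ * crossing F U W →
        ∀ r b, s + 1 ≤ κ ^ 3 * r → s + 1 ≤ κ ^ 3 * b → GoodPair F r (2 * κ) b U W := by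
  have hκ0 : (2 : ℝ) ≤ κ := by exact_mod_cast hκ
  have hε : (0 : ℝ) < 1 / (κ : ℝ) ^ 3 := by positivity
  refine ⟨max κ (SzemerediRegularity.bound (1 / (κ : ℝ) ^ 3) κ), fun V _ G hV => ?_⟩
  obtain ⟨P, hP, hl, hL, hPu⟩ :=
    szemeredi_regularity (α := V) G hε ((le_max_left _ _).trans hV)
  set M := #P.parts with hM
  have hM0 : 0 < M := by omega
  obtain ⟨Bad, hBad⟩ : ∃ Bad : Finset V → Finset V → Prop,
      ∀ U W, Bad U W ↔ U = W ∨ ¬ G.IsUniform (1 / (κ : ℝ) ^ 3) U W := ⟨_, fun _ _ => Iff.rfl⟩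
  let T : Finset (Finset V) := {U ∈ P.parts | κ * #{W ∈ P.parts | Bad U W} ≤ 2 * M}
  have hTP : T ⊆ P.parts := filter_subset _ _
  refine ⟨T, M, Fintype.card V / M, Bad, hl, hL.trans (le_max_right _ _), Nat.div_mul_le_self _ _,
    ?_, ?_, ?_, card_le_card hTP, ?_, fun U => (hBad U U).2 (Or.inl rfl), ?_, ?_, ?_⟩
  · rw [mul_comm]
    exact Nat.lt_mul_div_succ _ hM0
  · intro U hU
    exact ⟨by simpa using hP.average_le_card_part (hTP hU),
      by simpa using hP.card_part_le_average_add_one (hTP hU)⟩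
  · intro U hU W hW hne
    exact P.disjoint (hTP hU) (hTP hW) hne
  · have h1 : #T + #{U ∈ P.parts | ¬ κ * #{W ∈ P.parts | Bad U W} ≤ 2 * M} = M :=
      card_filter_add_card_filter_not _
    set T' : Finset (Finset V) := {U ∈ P.parts | ¬ κ * #{W ∈ P.parts | Bad U W} ≤ 2 * M}
    have h2 : ∀ U ∈ T', M ≤ κ * #{W ∈ P.parts | (U, W) ∈ P.nonUniforms G (1 / (κ : ℝ) ^ 3)} := by
      intro U hU
      obtain ⟨hUP, hU⟩ := mem_filter.1 hU
      have h3 : ({W ∈ P.parts | Bad U W} : Finset (Finset V)) ⊆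
          insert U {W ∈ P.parts | (U, W) ∈ P.nonUniforms G (1 / (κ : ℝ) ^ 3)} := by
        intro W hW
        simp only [mem_filter, mem_insert, Finpartition.mk_mem_nonUniforms, hBad] at hW ⊢
        by_cases h4 : U = W
        · exact Or.inl h4.symm
        · exact Or.inr ⟨hW.1, hUP, hW.1, h4, hW.2.resolve_left h4⟩
      have h4 := Nat.mul_le_mul_left κ ((card_le_card h3).trans (card_insert_le _ _))
      rw [mul_add, mul_one] at h4
      omega
    have h3 : #T' * M ≤ κ * #(P.nonUniforms G (1 / (κ : ℝ) ^ 3)) := by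
      rw [← smul_eq_mul, ← sum_const]
      refine (sum_le_sum h2).trans ?_
      rw [← mul_sum]
      refine Nat.mul_le_mul_left _ ?_
      rw [← card_sigma]
      refine card_le_card_of_injOn (fun x => (x.1, x.2)) ?_ ?_
      · rintro ⟨U, W⟩ h
        simp only [coe_sigma, Set.mem_sigma_iff, mem_coe, mem_filter] at h
        exact h.2.2
      · rintro ⟨U, W⟩ - ⟨U', W'⟩ - h
        simp only [Prod.mk.injEq] at h
        obtain ⟨rfl, rfl⟩ := h
        rfl
    have h4 : (#(P.nonUniforms G (1 / (κ : ℝ) ^ 3)) : ℝ) ≤ (M * M : ℝ) * (1 / (κ : ℝ) ^ 3) := by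
      refine hPu.trans (mul_le_mul_of_nonneg_right ?_ hε.le)
      have : M * (M - 1) ≤ M * M := Nat.mul_le_mul_left _ (by omega)
      exact_mod_cast this
    have h5 : κ ^ 3 * #(P.nonUniforms G (1 / (κ : ℝ) ^ 3)) ≤ M * M := by
      rw [mul_one_div, le_div_iff₀ (by positivity), mul_comm] at h4
      exact_mod_cast h4
    have h6 : κ * #T' ≤ M := by
      have h7 : κ ^ 2 * (#T' * M) ≤ M * M := by
        refine (Nat.mul_le_mul_left _ h3).trans (le_trans (le_of_eq ?_) h5)
        ring
      have h8 : κ ^ 2 * #T' ≤ M := by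
        refine Nat.le_of_mul_le_mul_right ?_ hM0
        rwa [mul_assoc]
      refine le_trans (Nat.mul_le_mul_right _ ?_) h8
      nlinarith
    rw [← h1] at h6 ⊢
    rw [mul_add]
    omega
  · intro U W h
    rw [hBad] at h ⊢
    rcases h with rfl | h
    · exact Or.inl rfl
    · exact Or.inr fun h1 => h h1.symm
  · intro U hU
    refine le_trans (Nat.mul_le_mul_left _ (card_le_card ?_)) (mem_filter.1 hU).2
    exact fun W hW => mem_filter.2 ⟨hTP (mem_filter.1 hW).1, (mem_filter.1 hW).2⟩
  · intro F hF U hU W hW hbad hd r b hr hb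
    simp only [hBad, not_or, not_not] at hbad
    have hU1 := P.nonempty_of_mem_parts (hTP hU)
    have hW1 := P.nonempty_of_mem_parts (hTP hW)
    have hU2 : #U ≤ Fintype.card V / M + 1 := by
      simpa using hP.card_part_le_average_add_one (hTP hU)
    have hW2 : #W ≤ Fintype.card V / M + 1 := by
      simpa using hP.card_part_le_average_add_one (hTP hW)
    refine goodPair_of_isUniform hκ ?_ hd hU1 hW1 (hW2.trans hr) (hU2.trans hb)
    rcases hF with rfl | hF
    · exact hbad.2
    · exact isUniform_of_eq_compl hF hε hU1 hW1 (P.disjoint (hTP hU) (hTP hW) hbad.1) hbad.2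

end

section
open scoped Classical

variable {V : Type*} {F F' : SimpleGraph V} {T : Finset (Finset V)} {D L M b d e g m n r s κ : ℕ}
  {Bad : Finset V → Finset V → Prop}

lemma le_mul_of_cluster_bounds {X : ℕ} (hκ : 1 ≤ κ) (hs : 8 * κ ≤ s)
    (hD : 2 * (κ + 2) * M ≤ 3 * κ * D) (hX : s * (4 * κ - 1) ≤ 8 * κ * X)
    (hn : 3 * n ≤ (s + 1) * M) : n ≤ D * X := by
  have h1 : 2 * (κ + 2) * M * (s * (4 * κ - 1)) ≤ 3 * κ * D * (8 * κ * X) := Nat.mul_le_mul hD hX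
  obtain ⟨j, hj⟩ : ∃ j, 4 * κ - 1 = j := ⟨_, rfl⟩
  have h3 : 4 * κ = j + 1 := by omega
  rw [hj] at h1
  have h5 : 8 * κ ^ 2 + κ ≤ 2 * (κ + 2) * j := by nlinarith
  have h6 : (8 * κ ^ 2 + κ) * (s * M) ≤ 2 * (κ + 2) * j * (s * M) := Nat.mul_le_mul_right _ h5
  have h7 : 8 * κ ^ 2 * M ≤ κ * (s * M) := by
    have h8 : 8 * κ ^ 2 ≤ κ * s := by
      rw [sq, mul_left_comm]
      exact Nat.mul_le_mul_left _ hs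
    rw [← mul_assoc]
    exact Nat.mul_le_mul_right _ h8
  have h8 : 8 * κ ^ 2 * (3 * n) ≤ 8 * κ ^ 2 * ((s + 1) * M) := Nat.mul_le_mul_left _ hn
  have h9 : 24 * κ ^ 2 * n ≤ 24 * κ ^ 2 * (D * X) := by linarith
  exact Nat.le_of_mul_le_mul_left h9 (by positivity)

lemma pow_le_cycNum_of_matching [Finite V] {R : SimpleGraph T}
    (hT : ∀ U ∈ T, ∀ W ∈ T, U ≠ W → Disjoint U W)
    (hgood : ∀ U W : T, R.Adj U W → ∀ r b, s + 1 ≤ κ ^ 3 * r → s + 1 ≤ κ ^ 3 * b →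
      GoodPair F r (2 * κ) b U.1 W.1) (hsT : ∀ U ∈ T, s ≤ #U)
    (hm : HasConnectedMatching R D) (hκ : 1000 ≤ κ) (hML : M ≤ L) (hM : κ ≤ M) (hTM : #T ≤ M)
    (hs : 1000 * κ ^ 3 * (L + 1) ≤ s) (hsM : s * M + 1 ≤ 3 * n) (hsM' : 3 * n ≤ (s + 1) * M)
    (hD : 2 * (κ + 2) * M ≤ 3 * κ * D) :
    (s / (64 * κ ^ 2)) ^ (2 * n - 2) ≤ cycNum F (2 * n) := by
  set u := s / (64 * κ ^ 2) with hu
  have hκ2 : 0 < κ ^ 2 := by positivity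
  have hκ3 : 1000 * κ ^ 2 ≤ κ ^ 3 := by
    rw [pow_succ κ 2, mul_comm]
    exact Nat.mul_le_mul_left _ hκ
  have hκ23 : κ ≤ κ ^ 2 := Nat.le_self_pow (by omega) _
  have hu1 : 64 * κ ^ 2 * u ≤ s := Nat.mul_div_le _ _
  have hu2 : s < 64 * κ ^ 2 * (u + 1) := by
    rw [mul_add, mul_one]
    exact Nat.lt_mul_div_succ _ (by positivity)
  have hLs : 1000 * κ ^ 3 ≤ s := le_trans (Nat.le_mul_of_pos_right _ (by omega)) hs
  have hLs' : 1000 * κ * (L + 1) ≤ s := le_trans (Nat.mul_le_mul_right _ (by omega)) hs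
  have hu10 : 1 ≤ u := by
    rw [hu, Nat.le_div_iff_mul_le (by positivity)]
    omega
  have hsu : s + 1 ≤ κ ^ 3 * u := by
    have h1 : 1000 * κ ^ 2 * u ≤ κ ^ 3 * u := Nat.mul_le_mul_right _ hκ3
    have h2 : κ ^ 2 * 1 ≤ κ ^ 2 * u := Nat.mul_le_mul_left _ hu10
    nlinarith
  have hκu : κ * u ≤ κ ^ 2 * u := Nat.mul_le_mul_right _ hκ23
  have huκ : 1 * u ≤ κ * u := Nat.mul_le_mul_right _ (by omega)
  have hκκu : 64 * κ * (κ * u) ≤ s := by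
    rw [← mul_assoc, mul_assoc 64, ← sq]
    exact hu1
  have hκu64 : 64 * 1000 * (κ * u) ≤ 64 * κ * (κ * u) := Nat.mul_le_mul_right _ (by omega)
  have hLκ : 1000 * (L + 1) ≤ 1000 * κ * (L + 1) := Nat.mul_le_mul_right _ (by omega)
  set X := (s - 8 * (κ * u) - 2 * #T) / 2 with hX
  have hX1 : s ≤ 2 * X + 8 * (κ * u) + 2 * L + 1 := by omega
  have hX2 : s * (4 * κ - 1) ≤ 8 * κ * X := by
    have h1 := Nat.mul_le_mul_left (4 * κ) hX1
    have h2 : 2 * κ * (2 * L + 1) * 4 ≤ s * 2 := by nlinarith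
    obtain ⟨j, hj⟩ : ∃ j, 4 * κ - 1 = j := ⟨_, rfl⟩
    have h3 : 4 * κ = j + 1 := by omega
    rw [hj]
    nlinarith
  have hDX : n ≤ D * X := le_mul_of_cluster_bounds (by omega) (by omega) hD hX2 hsM'
  have hTn : #T ^ 2 ≤ n := by
    have h1 : #T ^ 2 ≤ M * M := by
      rw [sq]
      exact Nat.mul_le_mul hTM hTM
    have h2 : 3 * M * M ≤ s * M := Nat.mul_le_mul_right _ (by omega)
    nlinarith
  have hn : 0 < n := by omega
  obtain ⟨c, hc1, hc2, hc3⟩ := hm.exists_closed_walk (X := X) (n := n)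
    (by rwa [Fintype.card_coe]) hn hDX
  rw [Fintype.card_coe] at hc3
  have hn2 : 2 ≤ n := by
    have : 1 * M ≤ s * M := Nat.mul_le_mul_right _ (by omega)
    omega
  have hr : s + 1 ≤ κ ^ 3 * (4 * (κ * u)) := by
    refine hsu.trans (Nat.mul_le_mul_left _ (by omega))
  refine pow_le_cycNum_of_closed_walk (A := fun U : T => U.1) (c := c) (r := 4 * (κ * u))
    (w := 2 * κ) (b := u) ?_ (by omega) (fun t ht => (hc1 t ht).ne) hc2.ne
    (fun t ht => hgood _ _ (hc1 t ht) _ _ hr hsu) (hgood _ _ hc2 _ _ hr hsu) ?_ ?_ (by omega)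
    hu10 ?_
  · intro U W hne
    exact hT _ U.2 _ W.2 fun h => hne (Subtype.ext h)
  · intro U
    have h1 := hc3 U
    have h2 := hsT _ U.2
    omega
  · exact le_of_eq (by ring)
  · intro U
    refine le_trans ?_ (hsT _ U.2)
    rw [show 2 * κ * (2 * (4 * (κ * u))) = 16 * κ * (κ * u) by ring]
    exact (Nat.mul_le_mul_right _ (by omega)).trans hκκu

lemma mul_card_filter_le_crossing {A H : Finset V} (q : ℕ) :
    #{x ∈ A | q ≤ #{v ∈ H | F.Adj x v}} * q ≤ crossing F A H := by
  rw [crossing_eq_sum, ← smul_eq_mul, ← sum_const]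
  exact (sum_le_sum fun x hx => (mem_filter.1 hx).2).trans
    (sum_le_sum_of_subset (filter_subset _ _))

lemma crossing_biUnion_le (S S' : Finset T) :
    crossing F (S.biUnion fun U => U.1) (S'.biUnion fun U => U.1) ≤
      ∑ U ∈ S, ∑ W ∈ S', crossing F U.1 W.1 := by
  have h1 : ({p ∈ (S.biUnion fun U => U.1) ×ˢ (S'.biUnion fun U => U.1) | F.Adj p.1 p.2} :
      Finset (V × V)) ⊆
        S.biUnion fun U => S'.biUnion fun W => {p ∈ U.1 ×ˢ W.1 | F.Adj p.1 p.2} := by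
    rintro ⟨x, y⟩ h
    simp only [mem_filter, mem_product, mem_biUnion] at h ⊢
    obtain ⟨⟨⟨U, hU, hx⟩, W, hW, hy⟩, h⟩ := h
    exact ⟨U, hU, W, hW, ⟨hx, hy⟩, h⟩
  refine (card_le_card h1).trans (card_biUnion_le.trans (sum_le_sum fun U _ => ?_))
  exact card_biUnion_le

lemma crossing_biUnion_sparse {S S' : Finset T}
    (hS : ∀ U ∈ S, ∀ W ∈ S', Bad U.1 W.1 ∨ κ * crossing F U.1 W.1 ≤ #U.1 * #W.1)
    (hbad : ∀ U ∈ T, κ * #{W ∈ T | Bad U W} ≤ 2 * M) (hsT : ∀ U ∈ T, #U ≤ s + 1) (hTM : #T ≤ M) :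
    κ * crossing F (S.biUnion fun U => U.1) (S'.biUnion fun U => U.1) ≤ 3 * ((s + 1) * M) ^ 2 := by
  have hUW : ∀ U W : T, #U.1 * #W.1 ≤ (s + 1) ^ 2 := fun U W => by
    rw [sq]
    exact Nat.mul_le_mul (hsT _ U.2) (hsT _ W.2)
  have hcard : ∀ S : Finset T, #S ≤ M := fun S => by
    refine le_trans (card_le_univ S) ?_
    rwa [Fintype.card_coe]
  have h1 : ∀ U ∈ S, κ * ∑ W ∈ S', crossing F U.1 W.1 ≤ 3 * M * (s + 1) ^ 2 := by
    intro U hU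
    have h2 : ∀ W ∈ S', κ * crossing F U.1 W.1 ≤
        (if Bad U.1 W.1 then κ * (s + 1) ^ 2 else 0) + (s + 1) ^ 2 := by
      intro W hW
      split_ifs with h
      · refine le_trans (Nat.mul_le_mul_left _ ?_) (Nat.le_add_right _ _)
        exact ((card_filter_le _ _).trans_eq (card_product _ _)).trans (hUW U W)
      · rw [zero_add]
        exact ((hS U hU W hW).resolve_left h).trans (hUW U W)
    rw [mul_sum]
    refine (sum_le_sum h2).trans ?_
    rw [sum_add_distrib, ← sum_filter, sum_const, sum_const, smul_eq_mul, smul_eq_mul]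
    have h3 : #{W ∈ S' | Bad U.1 W.1} ≤ #{W ∈ T | Bad U.1 W} := by
      refine card_le_card_of_injOn Subtype.val ?_ Subtype.val_injective.injOn
      intro W hW
      exact mem_filter.2 ⟨W.2, (mem_filter.1 hW).2⟩
    have h4 := (Nat.mul_le_mul_left κ h3).trans (hbad _ U.2)
    have h5 := Nat.mul_le_mul_right ((s + 1) ^ 2) h4
    have h6 := Nat.mul_le_mul_right ((s + 1) ^ 2) (hcard S')
    nlinarith
  refine (Nat.mul_le_mul_left _ (crossing_biUnion_le S S')).trans ?_
  rw [mul_sum]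
  refine (sum_le_sum h1).trans ?_
  rw [sum_const, smul_eq_mul]
  have := Nat.mul_le_mul_right (3 * M * (s + 1) ^ 2) (hcard S)
  refine this.trans (le_of_eq (by ring))

lemma exists_clean_subset {A H : Finset V} {Z : ℕ} (hF : ∀ u v, u ≠ v → F.Adj u v ∨ F'.Adj u v)
    (hcross : 10 ^ 10 * crossing F A H ≤ 3 * (4 * n) ^ 2) (hA : 10 ^ 4 * Z ≤ 10 ^ 4 * #A + n)
    (hn : 10 ^ 7 ≤ n) (hZ : n ≤ Z) :
    ∃ A' ⊆ A, #A' + n / 1000 = Z ∧ ∀ a ∈ A', #{v ∈ H | ¬ F'.Adj a v} ≤ n / 1000 := by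
  set q := n / 1000 with hq
  have h1 := mul_card_filter_le_crossing (F := F) (A := A) (H := H) q
  set B : Finset V := {x ∈ A | q ≤ #{v ∈ H | F.Adj x v}} with hB
  have h2 : 10 ^ 5 * #B ≤ n := by
    by_contra! h
    have h3 : n ≤ 1001 * q := by omega
    have h4 : 10 ^ 10 * (#B * q) ≤ 48 * n ^ 2 := by nlinarith
    have h5 : (n + 1) * n ≤ 10 ^ 5 * #B * (1001 * q) := Nat.mul_le_mul h h3
    nlinarith
  have h3 : #(A \ B) + #B = #A := card_sdiff_add_card_eq_card (filter_subset _ _)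
  obtain ⟨A', hA', hA'c⟩ := exists_subset_card_eq (s := A \ B) (n := Z - q) (by omega)
  refine ⟨A', hA'.trans sdiff_subset, by omega, fun a ha => ?_⟩
  have h4 := mem_sdiff.1 (hA' ha)
  have h5 : #{v ∈ H | F.Adj a v} < q := by
    by_contra! h
    exact h4.2 (mem_filter.2 ⟨h4.1, h⟩)
  have h6 : ({v ∈ H | ¬ F'.Adj a v} : Finset V) ⊆ insert a {v ∈ H | F.Adj a v} := by
    intro v hv
    simp only [mem_filter, mem_insert] at hv ⊢
    by_cases h : v = a
    · exact Or.inl h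
    · exact Or.inr ⟨hv.1, (hF a v (Ne.symm h)).resolve_right hv.2⟩
  have h7 := (card_le_card h6).trans (card_insert_le _ _)
  omega

end

section
open scoped Classical

variable {V : Type*} {F F' : SimpleGraph V} {T : Finset (Finset V)} {D M g n s κ : ℕ}
  {Bad : Finset V → Finset V → Prop}

/-- The graph on the clusters in `T` whose edges are the pairs which are not bad and between which
`F` has density at least `1 / κ`. -/
def reducedGraph (T : Finset (Finset V)) (F : SimpleGraph V) (κ : ℕ)
    (hself : ∀ U, Bad U U) (hsymm : ∀ U W, Bad U W → Bad W U) : SimpleGraph T where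
  Adj U W := ¬ Bad U.1 W.1 ∧ #U.1 * #W.1 ≤ κ * crossing F U.1 W.1
  symm := ⟨fun U W h => ⟨fun h1 => h.1 (hsymm _ _ h1), by
    rw [mul_comm, crossing_comm]
    exact h.2⟩⟩
  loopless := ⟨fun U h => h.1 (hself _)⟩

lemma crossing_add_crossing {U W : Finset V} (hF : F' = Fᶜ) (h : Disjoint U W) :
    crossing F U W + crossing F' U W = #U * #W := by
  rw [← card_product, ← card_filter_add_card_filter_not (s := U ×ˢ W) (fun p => F.Adj p.1 p.2)]
  congr 1
  unfold crossing
  congr 1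
  refine filter_congr ?_
  rintro ⟨x, y⟩ hxy
  rw [mem_product] at hxy
  have hne : x ≠ y := fun h1 => Finset.disjoint_left.1 h hxy.1 (h1 ▸ hxy.2)
  rw [hF, SimpleGraph.compl_adj]
  tauto

lemma card_not_reducedGraph_adj_le (hF : F' = Fᶜ) (hκ : 3 ≤ κ) (hself : ∀ U, Bad U U)
    (hsymm : ∀ U W, Bad U W → Bad W U) (hT : ∀ U ∈ T, ∀ W ∈ T, U ≠ W → Disjoint U W)
    (hpos : ∀ U ∈ T, 0 < #U) (hbad : ∀ U ∈ T, κ * #{W ∈ T | Bad U W} ≤ 2 * M) (U : T) :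
    #{W | ¬ (reducedGraph T F κ hself hsymm).Adj U W ∧
      ¬ (reducedGraph T F' κ hself hsymm).Adj U W} ≤ 2 * M / κ := by
  rw [Nat.le_div_iff_mul_le (by omega), mul_comm]
  refine le_trans (Nat.mul_le_mul_left _ ?_) (hbad _ U.2)
  refine card_le_card_of_injOn Subtype.val ?_ Subtype.val_injective.injOn
  intro W hW
  have hW := (mem_filter.1 hW).2
  refine mem_filter.2 ⟨W.2, ?_⟩
  by_contra hb
  have hne : U.1 ≠ W.1 := fun h => hb (h ▸ hself _)
  have h1 := crossing_add_crossing hF (hT _ U.2 _ W.2 hne)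
  simp only [reducedGraph, hb, not_false_eq_true, true_and, not_le] at hW
  have h2 : 0 < #U.1 * #W.1 := Nat.mul_pos (hpos _ U.2) (hpos _ W.2)
  have h3 : κ * (#U.1 * #W.1) < 2 * (#U.1 * #W.1) := by
    rw [← h1, mul_add, h1]
    omega
  have h4 := Nat.mul_le_mul_right (#U.1 * #W.1) hκ
  omega

lemma mul_card_le_card_biUnion (hT : ∀ U ∈ T, ∀ W ∈ T, U ≠ W → Disjoint U W)
    (hsT : ∀ U ∈ T, s ≤ #U) (S : Finset T) : s * #S ≤ #(S.biUnion fun U => U.1) := by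
  rw [card_biUnion, mul_comm, ← smul_eq_mul, ← sum_const]
  · exact sum_le_sum fun U _ => hsT _ U.2
  · intro U _ W _ hne
    exact hT _ U.2 _ W.2 fun h => hne (Subtype.ext h)

lemma pow_le_cycNum_of_stability [Fintype V] {R : SimpleGraph T}
    (hF : ∀ u v, u ≠ v → F.Adj u v ∨ F'.Adj u v) (hV : 3 * n - 1 = Fintype.card V)
    (hn : 10 ^ 7 ≤ n) (hT : ∀ U ∈ T, ∀ W ∈ T, U ≠ W → Disjoint U W)
    (hR : ∀ U W : T, ¬ R.Adj U W → Bad U.1 W.1 ∨ 10 ^ 10 * crossing F U.1 W.1 ≤ #U.1 * #W.1)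
    (hbad : ∀ U ∈ T, 10 ^ 10 * #{W ∈ T | Bad U W} ≤ 2 * M)
    (hsT : ∀ U ∈ T, s ≤ #U ∧ #U ≤ s + 1) (hTM : #T ≤ M) (hMT : 10 ^ 10 * M ≤ 10 ^ 10 * #T + M)
    (hM : 10 ^ 10 ≤ M) (hs : 10 ^ 10 ≤ s) (hsM : s * M + 1 ≤ 3 * n) (hsM' : 3 * n ≤ (s + 1) * M)
    (hg : 10 ^ 10 * g ≤ 2 * M) (hD : 3 * 10 ^ 10 * D ≤ 2 * (10 ^ 10 + 2) * M + 3 * 10 ^ 10)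
    (h : (∃ X : Finset T, 2 * #T ≤ #X + 5 * g + 2 * D ∧ ∀ x ∈ X, ∀ y ∈ X, ¬ R.Adj x y) ∨
      ∃ X H : Finset T, Disjoint X H ∧ #T ≤ #X + 2 * g + D ∧
        2 * #T ≤ #H + 5 * g + 2 * D ∧ ∀ x ∈ X, ∀ y ∈ H, ¬ R.Adj x y) :
    (n / 1000) ^ (4 * n) ≤ cycNum F' (2 * n) * (2 * n) ^ (2 * n) ∨
      (n / 1000) ^ (4 * n) ≤ cycNum F (2 * n) * (2 * n) ^ (2 * n) := by
  have hF' : ∀ u v, u ≠ v → F'.Adj u v ∨ F.Adj u v := fun u v huv => (hF u v huv).symm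
  have hMs : 10 ^ 10 * M ≤ s * M := Nat.mul_le_mul_right _ hs
  rw [add_mul, one_mul] at hsM'
  have h4n : 3 * ((s + 1) * M) ^ 2 ≤ 3 * (4 * n) ^ 2 := by
    refine Nat.mul_le_mul_left _ (Nat.pow_le_pow_left ?_ 2)
    rw [add_mul, one_mul]
    omega
  have hbig : ∀ S : Finset T, 2 * #T ≤ #S + 5 * g + 2 * D →
      10 ^ 4 * (2 * n) ≤ 10 ^ 4 * #(S.biUnion fun U => U.1) + n := by
    intro S hS
    have h1 := mul_card_le_card_biUnion hT (fun U hU => (hsT U hU).1) S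
    have h2 : 10 ^ 10 * 2 * M ≤ 3 * 10 ^ 10 * #S + 100 * M := by omega
    have h3 := Nat.mul_le_mul_left s h2
    have h4 : 10 ^ 10 * 2 * (s * M) ≤ 3 * 10 ^ 10 * (s * #S) + 100 * (s * M) := by linarith
    omega
  rcases h with ⟨X, hX, hXR⟩ | ⟨X, H, hXH, hX, hH, hXR⟩
  · have hcross := (crossing_biUnion_sparse (F := F) (S := X) (S' := X)
      (fun U hU W hW => hR U W (hXR U hU W hW)) hbad (fun U hU => (hsT U hU).2) hTM).trans h4n
    obtain ⟨A, hA, hAc, hAd⟩ := exists_clean_subset hF hcross (hbig X hX) hn (by omega)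
    refine pow_le_cycNum_of_large_almost_clique hF' hV hAc le_rfl
      (fun a ha => (card_le_card ?_).trans (hAd a ha)) (by omega) (by omega)
    exact fun v hv => mem_filter.2 ⟨hA (mem_filter.1 hv).1, (mem_filter.1 hv).2⟩
  · have hcross := (crossing_biUnion_sparse (F := F) (S := X) (S' := H)
      (fun U hU W hW => hR U W (hXR U hU W hW)) hbad (fun U hU => (hsT U hU).2) hTM).trans h4n
    have hXbig : 10 ^ 4 * n ≤ 10 ^ 4 * #(X.biUnion fun U => U.1) + n := by
      have h1 := mul_card_le_card_biUnion hT (fun U hU => (hsT U hU).1) X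
      have h2 : 10 ^ 10 * M ≤ 3 * 10 ^ 10 * #X + 100 * M := by omega
      have h3 := Nat.mul_le_mul_left s h2
      have h4 : 10 ^ 10 * (s * M) ≤ 3 * 10 ^ 10 * (s * #X) + 100 * (s * M) := by linarith
      omega
    obtain ⟨A, hA, hAc, hAd⟩ := exists_clean_subset hF hcross hXbig hn le_rfl
    have hHbig := hbig H hH
    refine pow_le_cycNum_of_large_almost_biclique hF' hV (disjoint_of_subset_left hA ?_) hAc
      (by omega) le_rfl hAd (by omega) (by omega)
    rw [Finset.disjoint_left]
    intro v hv hv'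
    obtain ⟨U, hU, hvU⟩ := mem_biUnion.1 hv
    obtain ⟨W, hW, hvW⟩ := mem_biUnion.1 hv'
    have hne : U.1 ≠ W.1 := fun h => Finset.disjoint_left.1 hXH hU (Subtype.ext h ▸ hW)
    exact Finset.disjoint_left.1 (hT _ U.2 _ W.2 hne) hvU hvW

/-- For large `n`, one of any two complementary graphs on `3 n - 1` vertices contains many cycles of
length `2 n`. -/
theorem exists_many_mono_cycles : ∃ n₀ C : ℕ, 0 < C ∧ ∀ n ≥ n₀, ∀ (V : Type) [Fintype V]
    (G : SimpleGraph V), 3 * n - 1 = Fintype.card V → ∃ F, (F = G ∨ F = Gᶜ) ∧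
      ((n / 1000) ^ (4 * n) ≤ cycNum F (2 * n) * (2 * n) ^ (2 * n) ∨
        (n / C) ^ (2 * n - 2) ≤ cycNum F (2 * n)) := by
  obtain ⟨L, hL⟩ := exists_clusters (10 ^ 10) (by norm_num)
  refine ⟨(1000 * (10 ^ 10) ^ 3 * (L + 1) + 1) * (L + 1) + 10 ^ 7, (L + 1) * (64 * (10 ^ 10) ^ 2),
    by positivity, fun n hn V _ G hV => ?_⟩
  have hLn : L ≤ (1000 * (10 ^ 10) ^ 3 * (L + 1) + 1) * (L + 1) := by nlinarith
  obtain ⟨T, M, s, Bad, hM, hML, hsM, hsM', hsT, hT, hTM, hMT, hself, hsymm, hbad, hgood⟩ :=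
    hL V G (by omega)
  rw [← hV] at hsM hsM'
  have hn7 : 10 ^ 7 ≤ n := by omega
  have hsL : (s + 1) * M ≤ (s + 1) * (L + 1) := Nat.mul_le_mul_left _ (by omega)
  have hs : 1000 * (10 ^ 10) ^ 3 * (L + 1) ≤ s := by
    by_contra! h
    have h1 : (s + 1) * (L + 1) ≤ (1000 * (10 ^ 10) ^ 3 * (L + 1) + 1) * (L + 1) :=
      Nat.mul_le_mul_right _ (by omega)
    omega
  have hs10 : 10 ^ 10 ≤ s :=
    le_trans (Nat.le_trans (by norm_num) (Nat.le_mul_of_pos_right _ (Nat.succ_pos L))) hs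
  have hu : n / ((L + 1) * (64 * (10 ^ 10) ^ 2)) ≤ s / (64 * (10 ^ 10) ^ 2) := by
    rw [← Nat.div_div_eq_div_mul]
    refine Nat.div_le_div_right (Nat.lt_succ_iff.1 ?_)
    rw [Nat.div_lt_iff_lt_mul (by omega)]
    exact lt_of_le_of_lt (by omega) (hsM'.trans_le hsL)
  obtain ⟨D, hD, hD'⟩ : ∃ D, 2 * (10 ^ 10 + 2) * M ≤ 3 * 10 ^ 10 * D ∧
      3 * 10 ^ 10 * D ≤ 2 * (10 ^ 10 + 2) * M + 3 * 10 ^ 10 :=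
    ⟨2 * (10 ^ 10 + 2) * M / (3 * 10 ^ 10) + 1, by clear hs hn hLn; omega,
      by clear hs hn hLn; omega⟩
  have hcov : ∀ u v, u ≠ v → G.Adj u v ∨ Gᶜ.Adj u v := fun u v huv => by
    rw [SimpleGraph.compl_adj]
    tauto
  have key : ∀ F F', (F = G ∨ F = Gᶜ) → (F' = G ∨ F' = Gᶜ) →
      (∀ u v, u ≠ v → F.Adj u v ∨ F'.Adj u v) →
      (HasConnectedMatching (reducedGraph T F (10 ^ 10) hself hsymm) D ∨
        (∃ X : Finset T, 2 * Fintype.card T ≤ #X + 5 * (2 * M / 10 ^ 10) + 2 * D ∧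
          ∀ x ∈ X, ∀ y ∈ X, ¬ (reducedGraph T F (10 ^ 10) hself hsymm).Adj x y) ∨
        ∃ X H : Finset T, Disjoint X H ∧
          Fintype.card T ≤ #X + 2 * (2 * M / 10 ^ 10) + D ∧
          2 * Fintype.card T ≤ #H + 5 * (2 * M / 10 ^ 10) + 2 * D ∧
          ∀ x ∈ X, ∀ y ∈ H, ¬ (reducedGraph T F (10 ^ 10) hself hsymm).Adj x y) →
      ∃ F, (F = G ∨ F = Gᶜ) ∧
        ((n / 1000) ^ (4 * n) ≤ cycNum F (2 * n) * (2 * n) ^ (2 * n) ∨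
          (n / ((L + 1) * (64 * (10 ^ 10) ^ 2))) ^ (2 * n - 2) ≤ cycNum F (2 * n)) := by
    intro F F' hF hF' hFF' h
    rw [Fintype.card_coe] at h
    rcases h with h | h
    · refine ⟨F, hF, Or.inr ((Nat.pow_le_pow_left hu _).trans ?_)⟩
      exact pow_le_cycNum_of_matching (R := reducedGraph T F (10 ^ 10) hself hsymm) hT
        (fun U W hUW => hgood F hF U.1 U.2 W.1 W.2 hUW.1 hUW.2) (fun U hU => (hsT U hU).1) h
        (by norm_num) hML hM hTM hs (by omega) (by omega) hD
    · rcases pow_le_cycNum_of_stability (s := s) (M := M) hFF' hV hn7 hT (fun U W h => by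
          by_contra! h1
          exact h ⟨h1.1, h1.2.le⟩) hbad hsT hTM hMT hM hs10 (by omega) (by omega)
          (Nat.mul_div_le _ _) hD' h with h | h
      · exact ⟨F', hF', Or.inl h⟩
      · exact ⟨F, hF, Or.inl h⟩
  obtain ⟨F₀, hF₀, h⟩ := stability
    (card_not_reducedGraph_adj_le (F := G) (F' := Gᶜ) rfl (by norm_num) hself hsymm hT
      (fun U hU => by have := (hsT U hU).1; omega) hbad) (D := D)
    (by rw [Fintype.card_coe]; omega)
  rcases hF₀ with rfl | hF₀
  · exact key G Gᶜ (Or.inl rfl) (Or.inr rfl) hcov h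
  · rw [Set.mem_singleton_iff.1 hF₀] at h
    exact key Gᶜ G (Or.inr rfl) (Or.inl rfl) (fun u v huv => (hcov u v huv).symm) h

end

section

variable {n q N : ℕ} {d : ℝ}

lemma pow_le_of_pow_le_mul_pow (hn : 1000 ≤ n) (hd0 : 0 ≤ d) (hd : d ≤ 1 / (8 * 10 ^ 6))
    (h : (n / 1000) ^ (4 * n) ≤ N * (2 * n) ^ (2 * n)) : (d * n) ^ (2 * n) ≤ (N : ℝ) := by
  have hn0 : (0 : ℝ) < n := by exact_mod_cast (by omega : 0 < n)
  have h1 : (n : ℝ) / 2000 ≤ (n / 1000 : ℕ) := by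
    rw [div_le_iff₀ (by norm_num)]
    exact_mod_cast (by omega : n ≤ n / 1000 * 2000)
  have h2 : ((n / 1000 : ℕ) : ℝ) ^ (4 * n) ≤ N * (2 * n) ^ (2 * n) := by exact_mod_cast h
  have h3 : (d * n) ^ (2 * n) * (2 * n) ^ (2 * n) ≤ N * (2 * n) ^ (2 * n) := by
    refine le_trans ?_ h2
    rw [← mul_pow, show 4 * n = 2 * (2 * n) by ring,
      pow_mul ((n / 1000 : ℕ) : ℝ) 2]
    refine pow_le_pow_left₀ (by positivity) ?_ _
    calc d * n * (2 * n) ≤ 1 / (8 * 10 ^ 6) * n * (2 * n) := by gcongr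
      _ = (n / 2000) ^ 2 := by ring
      _ ≤ _ := pow_le_pow_left₀ (by positivity) h1 _
  exact le_of_mul_le_mul_right h3 (by positivity)

lemma pow_le_of_pow_sub_le {C : ℕ} (hC : 0 < C) (hn : C ≤ n) (hd0 : 0 ≤ d)
    (hd : d * (4 * C) ≤ 1) (h : (n / C) ^ (2 * n - 2) ≤ N) : (d * n) ^ (2 * n) ≤ (N : ℝ) := by
  have hn0 : (0 : ℝ) < n := by exact_mod_cast (by omega : 0 < n)
  have hC0 : (0 : ℝ) < C := by exact_mod_cast hC
  have h1 : 2 * d * n ≤ (n / C : ℕ) := by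
    have h2 : n ≤ 2 * C * (n / C) := by
      have h3 := Nat.lt_mul_div_succ n hC
      have h4 : 1 ≤ n / C := (Nat.one_le_div_iff hC).2 hn
      nlinarith
    have h3 : (n : ℝ) ≤ 2 * C * (n / C : ℕ) := by exact_mod_cast h2
    calc 2 * d * n ≤ 2 * d * (2 * C * (n / C : ℕ)) := by gcongr
      _ = d * (4 * C) * (n / C : ℕ) := by ring
      _ ≤ 1 * (n / C : ℕ) := by gcongr
      _ = _ := one_mul _
  have hdn : 2 * d * n ≤ n := h1.trans (by exact_mod_cast Nat.div_le_self _ _)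
  have h2 : ((n / C : ℕ) : ℝ) ^ (2 * n - 2) ≤ N := by exact_mod_cast h
  have h3 : (n : ℝ) ^ 2 ≤ 2 ^ (2 * n) := by
    rw [mul_comm, pow_mul]
    exact pow_le_pow_left₀ hn0.le (by exact_mod_cast Nat.lt_two_pow_self.le) _
  have h4 : (2 * d * n) ^ (2 * n) ≤ N * 2 ^ (2 * n) := by
    rw [show 2 * n = 2 * n - 2 + 2 by omega, pow_add]
    refine mul_le_mul ((pow_le_pow_left₀ (by positivity) h1 _).trans h2) ?_ (by positivity)
      (by positivity)
    rw [show 2 * n - 2 + 2 = 2 * n by omega]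
    exact (pow_le_pow_left₀ (by positivity) hdn _).trans h3
  rw [show 2 * d * n = d * n * 2 by ring, mul_pow] at h4
  exact le_of_mul_le_mul_right h4 (by positivity)

lemma half_pow_le_div (hn : 3 ≤ n) (hdn : 2 ≤ d * n) (h : (d * n) ^ (2 * n) ≤ (N : ℝ)) :
    (d * n / 2) ^ (2 * n) ≤ ((N / (2 * (2 * n)) : ℕ) : ℝ) := by
  set Q := N / (2 * (2 * n)) with hQ
  have hn0 : (0 : ℝ) < n := by exact_mod_cast (by omega : 0 < n)
  have h1 : (N : ℝ) ≤ 4 * n * (Q + 1) := by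
    have h2 : N < 2 * (2 * n) * (Q + 1) := Nat.lt_mul_div_succ _ (by omega)
    have h3 : N ≤ 4 * n * (Q + 1) := by linarith
    exact_mod_cast h3
  have h8 : 8 * n ≤ 2 ^ (2 * n) := by
    rw [two_mul n, pow_add]
    exact Nat.mul_le_mul (Nat.pow_le_pow_right (n := 2) (by norm_num) hn) Nat.lt_two_pow_self.le
  have h8' : (8 * n : ℝ) ≤ 2 ^ (2 * n) := by exact_mod_cast h8
  have h2 : (2 : ℝ) ^ (2 * n) ≤ (d * n) ^ (2 * n) := pow_le_pow_left₀ (by norm_num) hdn _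
  rw [div_pow, div_le_iff₀ (by positivity)]
  have h3 : (d * n) ^ (2 * n) ≤ Q * (8 * n) := by nlinarith
  exact h3.trans (by gcongr)

/-- Any two complementary graphs on `3 n - 1` vertices contain together many cycles of length
`2 n`. -/
theorem exists_pow_le_cycNum_div : ∃ c : ℝ, 0 < c ∧ ∀ n ≥ 3, ∀ G : SimpleGraph (Fin (3 * n - 1)),
    ∃ F, (F = G ∨ F = Gᶜ) ∧
      (c * (2 * n)) ^ (2 * n) ≤ ((cycNum F (2 * n) / (2 * (2 * n)) : ℕ) : ℝ) := by
  obtain ⟨n₀, C, hC, hmain⟩ := exists_many_mono_cycles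
  have hC1 : (1 : ℝ) ≤ C := by exact_mod_cast hC
  set d : ℝ := 1 / (8 * 10 ^ 6 * C) with hd
  have hd0 : 0 < d := by positivity
  set n₁ := n₀ + 1000 + 16 * 10 ^ 6 * C with hn₁
  have hn₁0 : (0 : ℝ) < n₁ := by exact_mod_cast (by omega : 0 < n₁)
  refine ⟨min (d / 4) (1 / (2 * n₁)), by positivity, fun n hn G => ?_⟩
  have hn0 : (0 : ℝ) < n := by exact_mod_cast (by omega : 0 < n)
  by_cases hlarge : n₁ ≤ n
  · obtain ⟨F, hF, h⟩ := hmain n (by omega) (Fin (3 * n - 1)) G (by simp)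
    refine ⟨F, hF, ?_⟩
    have h1 : (d * n) ^ (2 * n) ≤ (cycNum F (2 * n) : ℝ) := by
      rcases h with h | h
      · refine pow_le_of_pow_le_mul_pow (by omega) hd0.le ?_ h
        rw [hd]
        apply one_div_le_one_div_of_le (by positivity)
        linarith
      · refine pow_le_of_pow_sub_le hC (by omega) hd0.le ?_ h
        rw [hd, one_div_mul_eq_div, div_le_one (by positivity)]
        linarith
    refine le_trans ?_ (half_pow_le_div hn ?_ h1)
    · refine pow_le_pow_left₀ (by positivity) ?_ _
      have := min_le_left (d / 4) (1 / (2 * n₁))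
      calc _ ≤ d / 4 * (2 * n) := by gcongr
        _ = _ := by ring
    · have h2 : (16 * 10 ^ 6 * C : ℝ) ≤ n := by
        exact_mod_cast (by omega : 16 * 10 ^ 6 * C ≤ n)
      rw [hd, one_div_mul_eq_div, le_div_iff₀ (by positivity)]
      linarith
  · obtain ⟨F, hF, h⟩ : ∃ F, (F = G ∨ F = Gᶜ) ∧ HasCyc F (2 * n) := by
      rcases exists_mono_cycle (G := G) hn (by simp) with h | h
      · exact ⟨G, Or.inl rfl, h⟩
      · exact ⟨Gᶜ, Or.inr rfl, h⟩
    refine ⟨F, hF, ?_⟩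
    have h1 : 1 ≤ cycNum F (2 * n) / (2 * (2 * n)) :=
      (Nat.one_le_div_iff (by omega)).2 (HasCyc.two_mul_le_cycNum (by omega) h)
    refine le_trans (pow_le_one₀ (by positivity) ?_) (by exact_mod_cast h1)
    have h2 := min_le_right (d / 4) (1 / (2 * n₁))
    have h3 : (n : ℝ) ≤ n₁ := by exact_mod_cast (by omega : n ≤ n₁)
    calc _ ≤ 1 / (2 * (n₁ : ℝ)) * (2 * n₁) := by gcongr
      _ = 1 := by field_simp

end

end CycleRamsey

/-- There is a positive constant `c` such that for every even `k ≥ 6`, every red/blue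
two-coloring of the edges of the complete graph on `3k/2 - 1` vertices (given by its red
graph `R`, blue being `Rᶜ`) contains at least `(c * k) ^ k` monochromatic cycles of
length `k`. -/
theorem stmt_19 :
    ∃ c : ℝ, 0 < c ∧ ∀ k : ℕ, Even k → 6 ≤ k →
      ∀ R : SimpleGraph (Fin (3 * k / 2 - 1)),
        (c * k) ^ k ≤ ((cycleCount R k + cycleCount Rᶜ k : ℕ) : ℝ) := by
  obtain ⟨c, hc, h⟩ := CycleRamsey.exists_pow_le_cycNum_div
  refine ⟨c, hc, fun k hk hk6 => ?_⟩
  obtain ⟨n, rfl⟩ := hk.two_dvd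
  rw [show 3 * (2 * n) / 2 - 1 = 3 * n - 1 by omega]
  intro R
  obtain ⟨F, hF, hle⟩ := h n (by omega) R
  rw [Nat.cast_mul, Nat.cast_ofNat]
  refine hle.trans (Nat.cast_le.2 ?_)
  rcases hF with rfl | rfl
  · exact Nat.le_add_right (cycleCount F (2 * n)) _
  · exact Nat.le_add_left (cycleCount Rᶜ (2 * n)) _
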